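/- There exists an integer r₀ such that for every integer r ≥ r₀ the following holds: if A is an m × n integer matrix of rank r (rank computed over ℚ) that is 2-modular, every row of A is nonzero, and every two distinct rows of A are linearly independent over ℚ, then m ≤ (r+2)(r+1)/2 − 2 (that is, m ≤ binom(r+2,2) − 2). -/

import Mathlib

/-- A row of an integer matrix, viewed as a vector over `ℚ`. -/
def rowQ {m n : ℕ} (A : Matrix (Fin m) (Fin n) ℤ) (i : Fin m) : Fin n → ℚ :=
  fun j => (A i j : ℚ)

/-- An integer matrix of rank `r` is `2`-modular if every `r × r` submatrix has
determinant of absolute value at most `2`. -/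
def IsTwoModular {m n : ℕ} (A : Matrix (Fin m) (Fin n) ℤ) (r : ℕ) : Prop :=
  ∀ (f : Fin r → Fin m) (g : Fin r → Fin n), |(A.submatrix f g).det| ≤ 2


section
namespace TM

structure Cfg (r : ℕ) (V : Type) [AddCommGroup V] [Module ℚ V] where
  ω : V [⋀^Fin r]→ₗ[ℚ] ℚ
  X : Finset V
  bas : Nonempty (Module.Basis (Fin r) ℚ V)
  nz : ∀ x ∈ X, x ≠ 0
  np : ∀ x ∈ X, ∀ y ∈ X, ∀ a : ℚ, y = a • x → y = x
  int : ∀ f : Fin r → V, (∀ i, f i ∈ X) → ∃ z : ℤ, ω f = z ∧ |z| ≤ 2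
  full : ∃ f : Fin r → V, (∀ i, f i ∈ X) ∧ ω f ≠ 0

variable {r : ℕ} {V : Type} [AddCommGroup V] [Module ℚ V]

def Cfg.S (C : Cfg r V) : Set V := {x | x ∈ C.X ∨ -x ∈ C.X}

theorem Cfg.mem_S {C : Cfg r V} {x : V} : x ∈ C.S ↔ x ∈ C.X ∨ -x ∈ C.X := Iff.rfl

theorem Cfg.S_of_X {C : Cfg r V} {x : V} (h : x ∈ C.X) : x ∈ C.S := Or.inl h

theorem Cfg.neg_mem {C : Cfg r V} {x : V} (h : x ∈ C.S) : -x ∈ C.S := by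
  rcases h with h | h
  · right; simpa using h
  · left; exact h

theorem Cfg.S_nz {C : Cfg r V} {x : V} (h : x ∈ C.S) : x ≠ 0 := by
  rcases h with h | h
  · exact C.nz x h
  · intro h0; exact C.nz _ h (by simp [h0])

theorem Cfg.S_np {C : Cfg r V} {x y : V} (hx : x ∈ C.S) (hy : y ∈ C.S) (a : ℚ) (h : y = a • x) :
    y = x ∨ y = -x := by
  rcases hx with hx | hx <;> rcases hy with hy | hy
  · left; exact C.np x hx y hy a h
  · right
    have := C.np x hx _ hy (-a) (by rw [h]; simp)
    rw [← this]; simp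
  · right
    exact C.np _ hx _ hy (-a) (by rw [h]; simp)
  · left
    have := C.np _ hx _ hy a (by rw [h]; simp)
    simpa using this

theorem Cfg.X_np {C : Cfg r V} {x y : V} (hx : x ∈ C.X) (hy : y ∈ C.X) (h : y = -x) : y = x :=
  C.np x hx y hy (-1) (by simp [h])

theorem Cfg.exists_X {C : Cfg r V} {x : V} (hx : x ∈ C.S) :
    ∃ s : ℚ, (s = 1 ∨ s = -1) ∧ s • x ∈ C.X := by
  rcases hx with hx | hx
  · exact ⟨1, Or.inl rfl, by simpa using hx⟩
  · exact ⟨-1, Or.inr rfl, by simpa using hx⟩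

theorem Cfg.int_S (C : Cfg r V) (f : Fin r → V) (hf : ∀ i, f i ∈ C.S) :
    ∃ z : ℤ, C.ω f = z ∧ |z| ≤ 2 := by
  choose s hs hX using fun i => Cfg.exists_X (hf i)
  obtain ⟨z, hz, hz2⟩ := C.int _ hX
  have h1 : C.ω (fun i => s i • f i) = (∏ i, s i) * C.ω f := by
    have := C.ω.toMultilinearMap.map_smul_univ s f
    simpa using this
  have h2 : (∏ i, s i) = 1 ∨ (∏ i, s i) = -1 := by
    apply Finset.prod_induction s (fun x => x = 1 ∨ x = -1)
    · rintro a b (rfl | rfl) (rfl | rfl) <;> norm_num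
    · left; rfl
    · intro i _; exact hs i
  rw [h1] at hz
  rcases h2 with h | h
  · exact ⟨z, by rw [← hz, h]; ring, hz2⟩
  · exact ⟨-z, by push_cast; rw [← hz, h]; ring, by simpa using hz2⟩

theorem Cfg.full_S (C : Cfg r V) : ∃ f : Fin r → V, (∀ i, f i ∈ C.S) ∧ C.ω f ≠ 0 := by
  obtain ⟨f, hf, h⟩ := C.full
  exact ⟨f, fun i => Or.inl (hf i), h⟩

theorem Cfg.ω_basis (C : Cfg r V) (b : Module.Basis (Fin r) ℚ V) : C.ω b ≠ 0 := by
  obtain ⟨f, hf, h⟩ := C.full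
  rw [AlternatingMap.map_basis_ne_zero_iff]
  rintro h0
  rw [h0] at h
  exact h rfl

/-- a family with nonzero ω is a basis -/
theorem Cfg.mkBasis (C : Cfg r V) (f : Fin r → V) (hf : C.ω f ≠ 0) :
    ∃ b : Module.Basis (Fin r) ℚ V, ⇑b = f := by
  obtain ⟨b0⟩ := C.bas
  have hli : LinearIndependent ℚ f := by
    by_contra h
    exact hf (C.ω.map_linearDependent f h)
  have : Module.Finite ℚ V := Module.Finite.of_basis b0
  have hfr : Module.finrank ℚ V = r := by simp [Module.finrank_eq_card_basis b0]
  have hsp : ⊤ ≤ Submodule.span ℚ (Set.range f) := by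
    rw [hli.span_eq_top_of_card_eq_finrank' (by simp [hfr])]
  exact ⟨Module.Basis.mk hli hsp, by simp⟩

theorem Cfg.ω_update (C : Cfg r V) (b : Module.Basis (Fin r) ℚ V) (i : Fin r) (x : V) :
    C.ω (Function.update b i x) = b.repr x i * C.ω b := by
  conv_lhs => rw [← b.sum_repr x]
  rw [C.ω.map_update_sum]
  rw [Finset.sum_eq_single i]
  · rw [C.ω.map_update_smul]; simp
  · intro k _ hk
    rw [C.ω.map_update_smul, C.ω.map_update_self _ hk.symm]; simp
  · simp

/-- replaced-minor lemma -/
theorem Cfg.ω_minor (C : Cfg r V) (b : Module.Basis (Fin r) ℚ V) {k : ℕ} (e : Fin k → Fin r)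
    (he : Function.Injective e) (y : Fin k → V) :
    ∃ g : Fin r → V, (∀ q, g (e q) = y q) ∧ (∀ i, (¬ ∃ q, e q = i) → g i = b i) ∧
      C.ω g = (Matrix.of fun p q => b.repr (y p) (e q)).det * C.ω b := by
  classical
  let g : Fin r → V := fun i => if h : ∃ q, e q = i then y h.choose else b i
  have hge : ∀ q, g (e q) = y q := by
    intro q
    have h : ∃ q', e q' = e q := ⟨q, rfl⟩
    simp only [g, dif_pos h]
    rw [he h.choose_spec]
  have hgn : ∀ i, (¬ ∃ q, e q = i) → g i = b i := by
    intro i h; simp only [g, dif_neg h]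
  refine ⟨g, hge, hgn, ?_⟩
  · have h1 : C.ω g = C.ω b * b.det g := by
      conv_lhs => rw [C.ω.eq_smul_basis_det b]
      simp
    have h2 : b.det g = (Matrix.of fun p q => b.repr (y p) (e q)).det := by
      rw [Module.Basis.det_apply, ← Matrix.det_transpose]
      rw [Matrix.twoBlockTriangular_det _ (fun i => ∃ q, e q = i)]
      · have hid : (Matrix.toSquareBlockProp (b.toMatrix g).transpose fun i => ¬ ∃ q, e q = i) = 1 := by
          ext i j
          simp [Matrix.toSquareBlockProp, Module.Basis.toMatrix_apply, hgn i.1 i.2, Matrix.one_apply,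
            Finsupp.single_apply, Subtype.ext_iff]
        rw [hid, Matrix.det_one, mul_one]
        let E : Fin k ≃ {i // ∃ q, e q = i} := Equiv.ofBijective (fun q => ⟨e q, q, rfl⟩)
          ⟨fun a b h => he (by simpa using h), fun ⟨i, q, h⟩ => ⟨q, by simp [h]⟩⟩
        rw [← Matrix.det_submatrix_equiv_self E]
        congr 1
        ext p q
        change b.repr (g (e p)) (e q) = _
        rw [hge]; rfl
      · intro i hi j hj
        have : i ≠ j := by rintro rfl; exact hi hj
        simp [Module.Basis.toMatrix_apply, hgn i hi, this]
    rw [h1, h2, mul_comm]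

end TM
end

section
namespace TM
variable {r : ℕ} {V : Type} [AddCommGroup V] [Module ℚ V]
open Module

def Cfg.Odd (C : Cfg r V) (B : Basis (Fin r) ℚ V) (J : Finset (Fin r)) : Prop :=
  (∀ i, B i ∈ C.S) ∧ ∀ f : Fin r → V, (∀ i, f i ∈ C.S) → (∀ j ∈ J, f j = B j) →
    ∃ k : ℤ, C.ω f = 2 * k

def Cfg.JFr (C : Cfg r V) (B : Basis (Fin r) ℚ V) (J : Finset (Fin r)) (b : Basis (Fin r) ℚ V) :
    Prop := (∀ i, b i ∈ C.S) ∧ ∀ j ∈ J, b j = B j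

def T (B : Basis (Fin r) ℚ V) (J : Finset (Fin r)) : Submodule ℚ V :=
  Submodule.span ℚ (B '' (J : Set (Fin r)))

theorem mem_T {B : Basis (Fin r) ℚ V} {J : Finset (Fin r)} {x : V} :
    x ∈ T B J ↔ ∀ i, i ∉ J → B.repr x i = 0 := by
  unfold T
  rw [Basis.mem_span_image]
  constructor
  · intro h i hi
    by_contra h0
    exact hi (by simpa using h (by simpa using h0))
  · intro h i hi
    by_contra h0
    simp at hi h0
    exact hi (h i h0)

theorem B_mem_T (B : Basis (Fin r) ℚ V) {J : Finset (Fin r)} {j : Fin r} (hj : j ∈ J) :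
    B j ∈ T B J := Submodule.subset_span ⟨j, by simpa using hj, rfl⟩

theorem sum_T {B : Basis (Fin r) ℚ V} {J : Finset (Fin r)} {x : V} (hx : x ∈ T B J) :
    x = ∑ j ∈ J, B.repr x j • B j := by
  conv_lhs => rw [← B.sum_repr x]
  symm
  apply Finset.sum_subset (Finset.subset_univ _)
  intro i _ hi
  rw [mem_T.1 hx i hi]; simp

theorem T_mono (B : Basis (Fin r) ℚ V) {J J' : Finset (Fin r)} (h : J ⊆ J') : T B J ≤ T B J' :=
  Submodule.span_mono (Set.image_mono (by simpa using h))

section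
variable {C : Cfg r V} {B b : Basis (Fin r) ℚ V} {J : Finset (Fin r)}

theorem Cfg.Odd.jfr (h : C.Odd B J) : C.JFr B J B := ⟨h.1, fun _ _ => rfl⟩

theorem Cfg.JFr.T_eq (hb : C.JFr B J b) : T b J = T B J := by
  unfold T
  congr 1
  apply Set.image_congr
  intro j hj
  exact hb.2 j (by simpa using hj)

theorem Cfg.JFr.repr_T (hb : C.JFr B J b) {d : V} (hd : d ∈ T B J) : b.repr d = B.repr d := by
  have h := sum_T hd
  have h1 : d = ∑ j ∈ J, B.repr d j • b j := by
    conv_lhs => rw [h]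
    exact Finset.sum_congr rfl fun j hj => by rw [hb.2 j hj]
  ext i
  by_cases hi : i ∈ J
  · conv_lhs => rw [h1]
    simp [Finsupp.single_apply, hi]
  · rw [mem_T.1 hd i hi]
    exact mem_T.1 (by rw [hb.T_eq]; exact hd) i hi

theorem Cfg.JFr.odd (hb : C.JFr B J b) (h : C.Odd B J) : C.Odd b J :=
  ⟨hb.1, fun f hf hj => h.2 f hf fun j hjJ => (hj j hjJ).trans (hb.2 j hjJ)⟩

theorem Cfg.JFr.trans {b' : Basis (Fin r) ℚ V} (hb : C.JFr B J b) (hb' : C.JFr b J b') :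
    C.JFr B J b' := ⟨hb'.1, fun j hj => (hb'.2 j hj).trans (hb.2 j hj)⟩

theorem Cfg.JFr.symm (hb : C.JFr B J b) (h : C.Odd B J) : C.JFr b J B :=
  ⟨h.1, fun j hj => (hb.2 j hj).symm⟩

theorem Cfg.JFr.mono {J' : Finset (Fin r)} (hb : C.JFr B J b) (h : J' ⊆ J) : C.JFr B J' b :=
  ⟨hb.1, fun j hj => hb.2 j (h hj)⟩

theorem Cfg.Odd.mono {J' : Finset (Fin r)} (h : C.Odd B J) (hJ : J ⊆ J') : C.Odd B J' :=
  ⟨h.1, fun f hf hj => h.2 f hf fun j hjJ => hj j (hJ hjJ)⟩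

theorem Cfg.Odd.two (h : C.Odd b J) : C.ω b = 2 ∨ C.ω b = -2 := by
  obtain ⟨k, hk⟩ := h.2 b h.1 (fun _ _ => rfl)
  obtain ⟨z, hz, hz2⟩ := C.int_S b h.1
  have h0 := C.ω_basis b
  have h1 : z = 2 * k := by exact_mod_cast hz.symm.trans hk
  have h2 : z ≠ 0 := by rintro rfl; exact h0 (by simpa using hz)
  rw [abs_le] at hz2
  have h3 : k = 1 ∨ k = -1 := by omega
  rcases h3 with rfl | rfl
  · left; rw [hk]; norm_num
  · right; rw [hk]; norm_num

theorem Cfg.Odd.minor (h : C.Odd b J) {k : ℕ} (e : Fin k → Fin r)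
    (he : Function.Injective e) (y : Fin k → V) (hy : ∀ q, y q ∈ C.S) :
    |(Matrix.of fun p q => b.repr (y p) (e q)).det| ≤ 1 := by
  obtain ⟨g, hg, hg', hω⟩ := C.ω_minor b e he y
  have hgS : ∀ i, g i ∈ C.S := by
    intro i
    by_cases hi : ∃ q, e q = i
    · obtain ⟨q, rfl⟩ := hi; rw [hg]; exact hy q
    · rw [hg' i hi]; exact h.1 i
  obtain ⟨z, hz, hz2⟩ := C.int_S g hgS
  have h2 : |C.ω g| ≤ 2 := by rw [hz]; exact_mod_cast hz2
  have h3 : |C.ω b| = 2 := by rcases h.two with h | h <;> rw [h] <;> norm_num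
  rw [hω, abs_mul, h3] at h2
  linarith

theorem Cfg.Odd.minor2 (h : C.Odd b J) {i j : Fin r} (hij : i ≠ j) {x y : V} (hx : x ∈ C.S)
    (hy : y ∈ C.S) : |b.repr x i * b.repr y j - b.repr x j * b.repr y i| ≤ 1 := by
  have := h.minor ![i, j] (by
    intro p q; fin_cases p <;> fin_cases q <;> simp [hij, hij.symm]) ![x, y]
    (by intro q; fin_cases q <;> simp [hx, hy])
  simpa [Matrix.det_fin_two] using this

theorem Cfg.Odd.minor3 (h : C.Odd b J) {i j k : Fin r} (hij : i ≠ j) (hik : i ≠ k) (hjk : j ≠ k)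
    {x y z : V} (hx : x ∈ C.S) (hy : y ∈ C.S) (hz : z ∈ C.S) :
    |b.repr x i * (b.repr y j * b.repr z k - b.repr y k * b.repr z j)
      - b.repr x j * (b.repr y i * b.repr z k - b.repr y k * b.repr z i)
      + b.repr x k * (b.repr y i * b.repr z j - b.repr y j * b.repr z i)| ≤ 1 := by
  have := h.minor ![i, j, k] (by
    intro p q; fin_cases p <;> fin_cases q <;> simp [hij, hik, hjk, hij.symm, hik.symm, hjk.symm])
    ![x, y, z] (by intro q; fin_cases q <;> simp [hx, hy, hz])
  rw [Matrix.det_fin_three] at this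
  simp only [Matrix.of_apply, Matrix.cons_val] at this
  convert this using 2
  ring

theorem Cfg.Odd.coord (h : C.Odd b J) {x : V} (hx : x ∈ C.S) (i : Fin r) :
    ∃ z : ℤ, b.repr x i = z / 2 ∧ |z| ≤ 2 := by
  obtain ⟨z, hz, hz2⟩ := C.int_S (Function.update b i x) (by
    intro k
    by_cases hk : k = i
    · subst hk; simpa using hx
    · rw [Function.update_of_ne hk]; exact h.1 k)
  rw [C.ω_update] at hz
  rcases h.two with h2 | h2
  · exact ⟨z, by rw [h2] at hz; linarith, hz2⟩
  · exact ⟨-z, by rw [h2] at hz; push_cast; linarith, by simpa using hz2⟩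

theorem Cfg.Odd.abs_le (h : C.Odd b J) {x : V} (hx : x ∈ C.S) (i : Fin r) :
    |b.repr x i| ≤ 1 := by
  obtain ⟨z, hz, hz2⟩ := h.coord hx i
  have : |(z : ℚ)| ≤ 2 := by exact_mod_cast hz2
  rw [hz, abs_div]; norm_num; linarith

theorem Cfg.Odd.le1 (h : C.Odd b J) {x : V} (hx : x ∈ C.S) (i : Fin r) :
    b.repr x i ≤ 1 := (_root_.abs_le.1 (h.abs_le hx i)).2

theorem Cfg.Odd.ge1 (h : C.Odd b J) {x : V} (hx : x ∈ C.S) (i : Fin r) :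
    -1 ≤ b.repr x i := (_root_.abs_le.1 (h.abs_le hx i)).1

theorem Cfg.Odd.outer (h : C.Odd b J) {x : V} (hx : x ∈ C.S) {i : Fin r} (hi : i ∉ J) :
    b.repr x i = 0 ∨ b.repr x i = 1 ∨ b.repr x i = -1 := by
  obtain ⟨z, hz, hz2⟩ := C.int_S (Function.update b i x) (by
    intro k
    by_cases hk : k = i
    · subst hk; simpa using hx
    · rw [Function.update_of_ne hk]; exact h.1 k)
  obtain ⟨k, hk⟩ := h.2 (Function.update b i x) (by
    intro k
    by_cases hk : k = i
    · subst hk; simpa using hx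
    · rw [Function.update_of_ne hk]; exact h.1 k) (by
    intro j hj
    rw [Function.update_of_ne (by rintro rfl; exact hi hj)])
  have h1 : z = 2 * k := by exact_mod_cast hz.symm.trans hk
  rw [_root_.abs_le] at hz2
  have h3 : k = 0 ∨ k = 1 ∨ k = -1 := by omega
  rw [C.ω_update] at hk
  rcases h.two with h2 | h2 <;> rw [h2] at hk <;> rcases h3 with rfl | rfl | rfl <;> norm_num at hk
  · left; exact hk
  · right; left; linarith
  · right; right; linarith
  · left; exact hk
  · right; right; linarith
  · right; left; linarith

theorem Cfg.JFr.pivot (hb : C.JFr B J b) {x : V} (hx : x ∈ C.S) {i : Fin r} (hi : i ∉ J)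
    (h0 : b.repr x i ≠ 0) : ∃ b' : Basis (Fin r) ℚ V, C.JFr B J b' ∧ b' i = x ∧
      ∀ k, k ≠ i → b' k = b k := by
  obtain ⟨b', hb'⟩ := C.mkBasis (Function.update b i x) (by
    rw [C.ω_update]; exact mul_ne_zero h0 (C.ω_basis b))
  have h1 : b' i = x := by rw [hb']; simp
  have h2 : ∀ k, k ≠ i → b' k = b k := by
    intro k hk; rw [hb', Function.update_of_ne hk]
  refine ⟨b', ⟨?_, ?_⟩, h1, h2⟩
  · intro k
    by_cases hk : k = i
    · subst hk; rw [h1]; exact hx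
    · rw [h2 k hk]; exact hb.1 k
  · intro j hj
    rw [h2 j (by rintro rfl; exact hi hj)]; exact hb.2 j hj

theorem Cfg.JFr.shift (hb : C.JFr B J b) (δ : Fin r → V) (hT : ∀ i, δ i ∈ T B J)
    (hJ : ∀ j ∈ J, δ j = 0) (hS : ∀ i, b i + δ i ∈ C.S) :
    ∃ b' : Basis (Fin r) ℚ V, C.JFr B J b' ∧ (∀ i, b' i = b i + δ i) ∧
      (∀ x i, b'.repr x i = b.repr x i - ∑ k, b.repr x k * B.repr (δ k) i) := by
  let N : V →ₗ[ℚ] V := b.constr ℚ δ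
  have hNb : ∀ i, N (b i) = δ i := fun i => by simp [N]
  have hNT : ∀ d ∈ T B J, N d = 0 := by
    intro d hd
    rw [sum_T hd, map_sum]
    apply Finset.sum_eq_zero
    intro j hj
    rw [map_smul, ← hb.2 j hj, hNb, hJ j hj, smul_zero]
  have hNx : ∀ x, N x = ∑ k, b.repr x k • δ k := by
    intro x
    simp [N, Basis.constr_apply_fintype]
  have hNr : ∀ x, N x ∈ T B J := by
    intro x
    rw [hNx]
    exact Submodule.sum_mem _ fun k _ => Submodule.smul_mem _ _ (hT k)
  let L : V ≃ₗ[ℚ] V := LinearEquiv.ofLinearMap (LinearMap.id + N) (LinearMap.id - N)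
    (by ext x; simp [hNT _ (hNr x)]) (by ext x; simp [hNT _ (hNr x)])
  have hL : ∀ i, (b.map L) i = b i + δ i := by
    intro i; simp [L, hNb]
  refine ⟨b.map L, ⟨?_, ?_⟩, hL, ?_⟩
  · intro i; rw [hL]; exact hS i
  · intro j hj; rw [hL, hJ j hj, add_zero]; exact hb.2 j hj
  · intro x i
    have : (b.map L).repr x = b.repr (x - N x) := by
      simp [L, Basis.map]
    rw [this, map_sub, hb.repr_T (hNr x), hNx]
    simp

end
end TM
end

section
namespace TM
variable {r : ℕ} {V : Type} [AddCommGroup V] [Module ℚ V]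
open Module

theorem exists_transversal {α : Type*} [DecidableEq α] (Z K : Finset α) (R : α → α → Prop)
    (hsymm : ∀ a b, R a b → R b a) (hK : K ⊆ Z)
    (hKp : ∀ a ∈ K, ∀ b ∈ K, a ≠ b → ¬ R a b) :
    ∃ Z0 ⊆ Z, K ⊆ Z0 ∧ (∀ a ∈ Z0, ∀ b ∈ Z0, a ≠ b → ¬ R a b) ∧
      ∀ z ∈ Z, z ∈ Z0 ∨ ∃ z0 ∈ Z0, R z z0 := by
  classical
  let F := Z.powerset.filter fun Z0 => K ⊆ Z0 ∧ (∀ a ∈ Z0, ∀ b ∈ Z0, a ≠ b → ¬ R a b)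
  obtain ⟨Z0, hZ0, hmax⟩ := Finset.exists_max_image F Finset.card ⟨K, by simp [F, hK]; exact hKp⟩
  simp only [F, Finset.mem_filter, Finset.mem_powerset] at hZ0 hmax
  refine ⟨Z0, hZ0.1, hZ0.2.1, hZ0.2.2, ?_⟩
  intro z hz
  by_contra! hcon
  have := hmax (insert z Z0) ⟨by
    intro a ha
    rcases Finset.mem_insert.1 ha with rfl | ha
    · exact hz
    · exact hZ0.1 ha, hZ0.2.1.trans (Finset.subset_insert _ _), by
    intro a ha b hb hab
    rcases Finset.mem_insert.1 ha with ha' | ha' <;> rcases Finset.mem_insert.1 hb with hb' | hb'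
    · exact absurd (ha'.trans hb'.symm) hab
    · rw [ha']; exact hcon.2 b hb'
    · rw [hb']; exact fun h => hcon.2 a ha' (hsymm _ _ h)
    · exact hZ0.2.2 a ha' b hb' hab⟩
  rw [Finset.card_insert_of_notMem hcon.1] at this
  omega

theorem Cfg.card_supp (C : Cfg r V) (B : Basis (Fin r) ℚ V) (hB : ∀ i, B i ∈ C.S)
    (I : Finset (Fin r)) (X' : Finset V) (hX' : X' ⊆ C.X)
    (hI : ∀ x ∈ X', ∀ i, i ∉ I → B.repr x i = 0) : X'.card ≤ 5 ^ I.card := by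
  classical
  let R5 : Finset ℚ := {-2, -1, 0, 1, 2}
  have h5 : R5.card = 5 := by rfl
  let P : Finset (Fin r → ℚ) := Fintype.piFinset fun i => if i ∈ I then R5 else {0}
  have hP : P.card = 5 ^ I.card := by
    simp only [P, Fintype.card_piFinset]
    rw [← Finset.prod_subset (Finset.subset_univ I)]
    · rw [Finset.prod_congr rfl (g := fun _ => 5)]
      · simp
      · intro i hi; simp [hi, h5]
    · intro i _ hi; simp [hi]
  rw [← hP]
  apply Finset.card_le_card_of_injOn (fun x i => C.ω (Function.update B i x))
  · intro x hx
    simp only [P, Finset.mem_coe, Fintype.mem_piFinset]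
    intro i
    by_cases hi : i ∈ I
    · obtain ⟨z, hz, hz2⟩ := C.int_S (Function.update B i x) (by
        intro k
        by_cases hk : k = i
        · subst hk; simpa using Cfg.S_of_X (hX' hx)
        · rw [Function.update_of_ne hk]; exact hB k)
      rw [hz]
      simp only [hi, if_true, R5]
      rw [abs_le] at hz2
      obtain ⟨h1, h2⟩ := hz2
      interval_cases z <;> simp
    · simp only [hi, if_false, Finset.mem_singleton]
      rw [C.ω_update, hI x hx i hi, zero_mul]
  · intro x hx y hy hxy
    apply B.repr.injective
    ext i
    have := congrFun hxy i
    simp only [C.ω_update] at this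
    exact mul_right_cancel₀ (C.ω_basis B) this

/-- Lemma O -/
theorem Cfg.odd_of_rel (C : Cfg r V) (B : Basis (Fin r) ℚ V) (hB : ∀ i, B i ∈ C.S) {x : V}
    (hx : x ∈ C.S) (m : Fin r → ℤ) (hm : ∀ i, 2 * B.repr x i = m i) (H : Finset (Fin r))
    (hH : ∀ i, i ∉ H → Even (m i)) (h : Fin r) (hh : h ∈ H) (hodd : _root_.Odd (m h)) : C.Odd B H := by
  refine ⟨hB, fun g hg hgH => ?_⟩
  have hS : ∀ y ∈ C.S, ∀ k, Function.update g h y k ∈ C.S := by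
    intro y hy k
    by_cases hk : k = h
    · subst hk; simpa using hy
    · rw [Function.update_of_ne hk]; exact hg k
  have hI : ∀ y ∈ C.S, ∃ z : ℤ, C.ω (Function.update g h y) = z := by
    intro y hy
    obtain ⟨z, hz, _⟩ := C.int_S _ (hS y hy)
    exact ⟨z, hz⟩
  obtain ⟨a, ha⟩ := hI x hx
  choose q hq using fun i => hI (B i) (hB i)
  have h1 : (2 : ℚ) * a = ∑ i, m i * q i := by
    rw [← ha]
    conv_lhs => rw [← B.sum_repr x]
    rw [C.ω.map_update_sum, Finset.mul_sum]
    push_cast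
    apply Finset.sum_congr rfl
    intro i _
    rw [C.ω.map_update_smul, ← hq, ← hm, smul_eq_mul]; ring
  have h2 : (2 : ℤ) * a = ∑ i, m i * q i := by exact_mod_cast h1
  rw [← Finset.add_sum_erase _ _ (Finset.mem_univ h)] at h2
  have hev : Even (∑ i ∈ Finset.univ.erase h, m i * q i) := by
    apply Finset.even_sum
    intro i hi
    have hih : i ≠ h := Finset.ne_of_mem_erase hi
    by_cases hiH : i ∈ H
    · have : q i = 0 := by
        have h3 := hq i
        rw [← hgH i hiH, C.ω.map_update_self _ hih.symm] at h3
        exact_mod_cast h3.symm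
      rw [this]; simp
    · exact (hH i hiH).mul_right _
  have hq2 : Even (m h * q h) := by
    have : m h * q h = 2 * a - ∑ i ∈ Finset.univ.erase h, m i * q i := by linarith
    rw [this]
    exact (even_two_mul a).sub hev
  rw [Int.even_mul] at hq2
  rcases hq2 with h3 | h3
  · exact absurd h3 (Int.not_even_iff_odd.2 hodd)
  · obtain ⟨k, hk⟩ := h3
    refine ⟨k, ?_⟩
    have h4 := hq h
    rw [← hgH h hh, Function.update_eq_self] at h4
    rw [h4, hk]; push_cast; ring

theorem Cfg.contract (C : Cfg (r + 1) V) (B : Basis (Fin (r + 1)) ℚ V) (hB : ∀ i, B i ∈ C.S)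
    (i0 : Fin (r + 1)) (K : Finset V) (hK : K ⊆ C.X) (hK0 : ∀ k ∈ K, ∀ a : ℚ, k ≠ a • B i0)
    (hKp : ∀ k ∈ K, ∀ k' ∈ K, k ≠ k' → ∀ a c : ℚ, k' ≠ a • k + c • B i0) :
    ∃ Y ⊆ C.X, K ⊆ Y ∧ (∀ y ∈ Y, ∀ a : ℚ, y ≠ a • B i0) ∧
      (∀ y ∈ Y, ∀ y' ∈ Y, y ≠ y' → ∀ a c : ℚ, y' ≠ a • y + c • B i0) ∧
      (∀ z ∈ C.X, z ∈ Y ∨ (∃ a : ℚ, z = a • B i0) ∨ ∃ y ∈ Y, ∃ a c : ℚ, z = a • y + c • B i0) ∧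
      ∃ C' : Cfg r (Fin r → ℚ), C'.X.card = Y.card ∧ ∀ J, C.Odd B J →
        (∀ j ∈ J, j ≠ i0 → B j ∈ K ∨ -B j ∈ K) →
        ∃ B' J', C'.Odd B' J' ∧ J'.card ≤ (J.erase i0).card := by
  classical
  set v := B i0 with hv
  obtain ⟨Y, hY, hKY, hYp, hYm⟩ := exists_transversal
    (C.X.filter fun x => ∀ a : ℚ, x ≠ a • v) K
    (fun y y' => (∃ a c : ℚ, y' = a • y + c • v) ∧ (∃ a c : ℚ, y = a • y' + c • v))
    (fun a b h => h.symm)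
    (by intro k hk; simp [hK hk]; exact hK0 k hk)
    (by
      intro k hk k' hk' hne h
      obtain ⟨⟨a, c, h⟩, _⟩ := h
      exact hKp k hk k' hk' hne a c h)
  have hYX : Y ⊆ C.X := fun y hy => (Finset.mem_filter.1 (hY hy)).1
  have hY0 : ∀ y ∈ Y, ∀ a : ℚ, y ≠ a • v := fun y hy => (Finset.mem_filter.1 (hY hy)).2
  have hinv : ∀ y y' : V, (∀ a : ℚ, y' ≠ a • v) → ∀ a c : ℚ, y' = a • y + c • v →
      y = a⁻¹ • y' + (-(a⁻¹ * c)) • v := by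
    intro y y' h0 a c h
    have ha : a ≠ 0 := by rintro rfl; exact h0 c (by simpa using h)
    rw [h, smul_add, smul_smul, smul_smul, inv_mul_cancel₀ ha]
    module
  have hYp' : ∀ y ∈ Y, ∀ y' ∈ Y, y ≠ y' → ∀ a c : ℚ, y' ≠ a • y + c • v := by
    intro y hy y' hy' hne a c h
    exact hYp y hy y' hy' hne ⟨⟨a, c, h⟩, ⟨_, _, hinv y y' (hY0 y' hy') a c h⟩⟩
  refine ⟨Y, hYX, hKY, hY0, hYp', ?_, ?_⟩
  · intro z hz
    by_cases h0 : ∃ a : ℚ, z = a • v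
    · right; left; exact h0
    · push Not at h0
      rcases hYm z (by simp [hz]; exact h0) with h | ⟨y, hy, _, h⟩
      · left; exact h
      · right; right; exact ⟨y, hy, h⟩
  let π : V →ₗ[ℚ] (Fin r → ℚ) := LinearMap.pi fun i => (B.coord (i0.succAbove i))
  have hπ : ∀ x i, π x i = B.repr x (i0.succAbove i) := fun x i => by simp [π]
  have hπ0 : ∀ x, π x = 0 → x = B.repr x i0 • v := by
    intro x hx
    apply B.repr.injective
    ext i
    by_cases hi : i = i0
    · subst hi; simp [v]
    · obtain ⟨k, rfl⟩ := Fin.exists_succAbove_eq hi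
      have := congrFun hx k
      rw [hπ] at this
      simp [this, v, Finsupp.single_apply, Ne.symm hi]
  have hπpar : ∀ x y (a : ℚ), π y = a • π x → ∃ c : ℚ, y = a • x + c • v := by
    intro x y a h
    have := hπ0 (y - a • x) (by rw [map_sub, map_smul, h, sub_self])
    exact ⟨_, by rw [← this]; abel⟩
  have hπv : π v = 0 := by
    ext i; rw [hπ]; simp [v, Finsupp.single_apply]
  let ω' : (Fin r → ℚ) [⋀^Fin r]→ₗ[ℚ] ℚ := C.ω B • Matrix.detRowAlternating
  have key : ∀ g : Fin r → V, ∃ G : Fin (r + 1) → V, G i0 = v ∧ (∀ p, G (i0.succAbove p) = g p) ∧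
      ω' (fun p => π (g p)) = C.ω G := by
    intro g
    obtain ⟨G, hG, hG', hω⟩ := C.ω_minor B i0.succAbove Fin.succAbove_right_injective g
    refine ⟨G, hG' i0 ?_, hG, ?_⟩
    · rintro ⟨q, hq⟩; exact Fin.succAbove_ne _ _ hq
    · rw [hω]
      simp only [ω', AlternatingMap.smul_apply, smul_eq_mul]
      rw [mul_comm]
      congr 1
  have hGS : ∀ g : Fin r → V, (∀ p, g p ∈ C.S) → ∀ G : Fin (r + 1) → V, G i0 = v →
      (∀ p, G (i0.succAbove p) = g p) → ∀ i, G i ∈ C.S := by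
    intro g hg G h1 h2 i
    by_cases hi : i = i0
    · subst hi; rw [h1]; exact hB _
    · obtain ⟨k, rfl⟩ := Fin.exists_succAbove_eq hi
      rw [h2]; exact hg k
  -- representatives
  have hrep : ∀ p : Fin r, ∃ s : V, (s ∈ Y ∨ -s ∈ Y) ∧ (∃ a : ℚ, a ≠ 0 ∧
      π (B (i0.succAbove p)) = a • π s) ∧
      (B (i0.succAbove p) ∈ K ∨ -B (i0.succAbove p) ∈ K → s = B (i0.succAbove p)) := by
    intro p
    set w := B (i0.succAbove p) with hw
    by_cases hwK : w ∈ K ∨ -w ∈ K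
    · exact ⟨w, hwK.imp (fun h => hKY h) (fun h => hKY h), ⟨1, one_ne_zero, by simp⟩, fun _ => rfl⟩
    · have hπw : π w ≠ 0 := by
        intro h
        have := congrFun h p
        rw [hπ] at this
        simp [hw] at this
      obtain ⟨s, hs, hsX⟩ := Cfg.exists_X (hB (i0.succAbove p))
      have hs0 : s ≠ 0 := by rcases hs with rfl | rfl <;> norm_num
      have hwn : ∀ a : ℚ, s • w ≠ a • v := by
        intro a h
        have := congrArg π h
        rw [map_smul, map_smul, hπv, smul_zero] at this
        exact (smul_ne_zero hs0 hπw) this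
      rcases hYm (s • w) (by simp [hw, hsX]; exact hwn) with h | ⟨y, hy, _, a, c, h⟩
      · refine ⟨s • w, Or.inl h, ⟨s⁻¹, inv_ne_zero hs0, ?_⟩, fun h => absurd h hwK⟩
        rw [map_smul, smul_smul, inv_mul_cancel₀ hs0, one_smul]
      · have ha : a ≠ 0 := by rintro rfl; exact hwn c (by simpa using h)
        refine ⟨y, Or.inl hy, ⟨s⁻¹ * a, mul_ne_zero (inv_ne_zero hs0) ha, ?_⟩,
          fun h => absurd h hwK⟩
        have := congrArg π h
        rw [map_smul, map_add, map_smul, map_smul, hπv, smul_zero, add_zero] at this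
        rw [mul_smul, ← this, smul_smul, inv_mul_cancel₀ hs0, one_smul]
  choose s hsY hsa hsK using hrep
  choose a ha0 ha using hsa
  have hsω : ω' (fun p => π (s p)) ≠ 0 := by
    intro h0
    obtain ⟨G, h1, h2, h3⟩ := key (fun p => B (i0.succAbove p))
    have hGB : G = B := by
      ext i
      by_cases hi : i = i0
      · subst hi; rw [h1]
      · obtain ⟨k, rfl⟩ := Fin.exists_succAbove_eq hi
        rw [h2]
    rw [hGB] at h3
    apply C.ω_basis B
    rw [← h3]
    have h4 : (fun p => π (B (i0.succAbove p))) = fun p => a p • π (s p) := funext ha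
    rw [h4]
    have := ω'.toMultilinearMap.map_smul_univ a (fun p => π (s p))
    simp only [AlternatingMap.coe_multilinearMap] at this
    rw [this, h0, smul_zero]
  have hYS : ∀ x, x ∈ Y ∨ -x ∈ Y → x ∈ C.S := fun x hx => hx.imp (fun h => hYX h) (fun h => hYX h)
  have hpr : ∀ x : V, x ∈ Y ∨ -x ∈ Y → π x ∈ Y.image π ∨ -π x ∈ Y.image π := by
    rintro x (h | h)
    · left; exact Finset.mem_image_of_mem _ h
    · right; rw [← map_neg]; exact Finset.mem_image_of_mem _ h
  let C' : Cfg r (Fin r → ℚ) :=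
    { ω := ω'
      X := Y.image π
      bas := ⟨Pi.basisFun ℚ (Fin r)⟩
      nz := by
        intro x hx h0
        obtain ⟨y, hy, rfl⟩ := Finset.mem_image.1 hx
        exact hY0 y hy _ (hπ0 y h0)
      np := by
        intro x hx y hy c h
        obtain ⟨x', hx', rfl⟩ := Finset.mem_image.1 hx
        obtain ⟨y', hy', rfl⟩ := Finset.mem_image.1 hy
        by_cases hxy : x' = y'
        · rw [hxy]
        · obtain ⟨d, hd⟩ := hπpar x' y' c h
          exact absurd hd (hYp' x' hx' y' hy' hxy c d)
      int := by
        intro f hf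
        choose g hg hgf using fun p => Finset.mem_image.1 (hf p)
        obtain ⟨G, h1, h2, h3⟩ := key g
        have : f = fun p => π (g p) := funext fun p => (hgf p).symm
        rw [this, h3]
        exact C.int_S G (hGS g (fun p => Or.inl (hYX (hg p))) G h1 h2)
      full := by
        have h1 : ∀ p, ∃ c : ℚ, c ≠ 0 ∧ c • π (s p) ∈ Y.image π := by
          intro p
          rcases hpr _ (hsY p) with h | h
          · exact ⟨1, one_ne_zero, by simpa using h⟩
          · exact ⟨-1, by norm_num, by simpa using h⟩
        choose c hc hcm using h1
        refine ⟨fun p => c p • π (s p), hcm, ?_⟩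
        have := ω'.toMultilinearMap.map_smul_univ c (fun p => π (s p))
        simp only [AlternatingMap.coe_multilinearMap] at this
        rw [this]
        exact smul_ne_zero (Finset.prod_ne_zero_iff.2 fun p _ => hc p) hsω }
  refine ⟨C', ?_, ?_⟩
  · apply Finset.card_image_of_injOn
    intro x hx y hy hxy
    by_contra hne
    obtain ⟨c, hc⟩ := hπpar x y 1 (by rw [one_smul]; exact hxy.symm)
    exact hYp' x hx y hy hne 1 c hc
  · intro J hJ hJK
    obtain ⟨B', hB'⟩ := C'.mkBasis (fun p => π (s p)) hsω
    refine ⟨B', Finset.univ.filter fun p => i0.succAbove p ∈ J, ⟨?_, ?_⟩, ?_⟩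
    · intro p; rw [hB']; exact hpr _ (hsY p)
    · intro f hf hfJ
      have hl : ∀ p, ∃ g : V, (g ∈ Y ∨ -g ∈ Y) ∧ π g = f p ∧
          (i0.succAbove p ∈ J → g = B (i0.succAbove p)) := by
        intro p
        by_cases hp : i0.succAbove p ∈ J
        · have h1 := hsK p (hJK _ hp (Fin.succAbove_ne _ _))
          refine ⟨s p, hsY p, ?_, fun _ => h1⟩
          rw [hfJ p (by simpa using hp), hB']
        · rcases hf p with h | h
          · obtain ⟨y, hy, hyf⟩ := Finset.mem_image.1 h
            exact ⟨y, Or.inl hy, hyf, fun h => absurd h hp⟩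
          · obtain ⟨y, hy, hyf⟩ := Finset.mem_image.1 h
            exact ⟨-y, Or.inr (by simpa using hy), by rw [map_neg, hyf, neg_neg],
              fun h => absurd h hp⟩
      choose g hg hgf hgJ using hl
      obtain ⟨G, h1, h2, h3⟩ := key g
      have : f = fun p => π (g p) := funext fun p => (hgf p).symm
      have h4 := hJ.2 G (hGS g (fun p => hYS _ (hg p)) G h1 h2) (by
        intro j hj
        by_cases hji : j = i0
        · subst hji; exact h1
        · obtain ⟨k, rfl⟩ := Fin.exists_succAbove_eq hji
          rw [h2, hgJ k hj])
      obtain ⟨k, hk⟩ := h4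
      refine ⟨k, ?_⟩
      rw [← hk, ← h3, ← this]
    · apply Finset.card_le_card_of_injOn i0.succAbove
      · intro p hp
        have : i0.succAbove p ∈ J := by simpa using hp
        simp [this]
      · exact Fin.succAbove_right_injective.injOn

end TM
end

section
namespace TM
variable {r : ℕ} {V : Type} [AddCommGroup V] [Module ℚ V]
open Module

theorem exists_maxi {α : Type*} (P : α → Prop) (N : α → ℕ) (M : ℕ) (hM : ∀ a, P a → N a ≤ M)
    (h : ∃ a, P a) : ∃ a, P a ∧ ∀ a', P a' → N a' ≤ N a := by
  obtain ⟨a0, h0⟩ := h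
  induction hk : M - N a0 using Nat.strong_induction_on generalizing a0 with
  | _ k ih =>
    by_cases hmax : ∀ a', P a' → N a' ≤ N a0
    · exact ⟨a0, h0, hmax⟩
    · push Not at hmax
      obtain ⟨a', ha', hlt⟩ := hmax
      have := hM a' ha'
      exact ih (M - N a') (by omega) a' ha' rfl

section
variable {C : Cfg r V} {B b : Basis (Fin r) ℚ V} {J : Finset (Fin r)}

theorem Cfg.JFr.repr_add (hb : C.JFr B J b) {z z' : V} (h : z' - z ∈ T B J) (i : Fin r) :
    b.repr z' i = b.repr z i + B.repr (z' - z) i := by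
  rw [← hb.repr_T h]; simp

theorem Cfg.JFr.repr_out (hb : C.JFr B J b) {z z' : V} (h : z' - z ∈ T B J) {i : Fin r}
    (hi : i ∉ J) : b.repr z' i = b.repr z i := by
  rw [hb.repr_add h, mem_T.1 h i hi, add_zero]

theorem Cfg.Odd.range0 (hO : C.Odd B J) (hb : C.JFr B J b) {z z' : V} (hz : z ∈ C.S)
    (hz' : z' ∈ C.S) (hzz : z' - z ∈ T B J) (lo hi : Fin r → V)
    (hlT : ∀ i, lo i ∈ T B J) (hlJ : ∀ j ∈ J, lo j = 0) (hlS : ∀ i, b i + lo i ∈ C.S)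
    (hhT : ∀ i, hi i ∈ T B J) (hhJ : ∀ j ∈ J, hi j = 0) (hhS : ∀ i, b i + hi i ∈ C.S)
    (j : Fin r) :
    B.repr (z' - z) j + ∑ k, b.repr z k * B.repr (hi k - lo k) j ≤ 2 := by
  obtain ⟨b1, hb1, _, h1⟩ := hb.shift lo hlT hlJ hlS
  obtain ⟨b2, hb2, _, h2⟩ := hb.shift hi hhT hhJ hhS
  have e1 := (hb1.odd hO).le1 hz' j
  have e2 := (hb2.odd hO).ge1 hz j
  rw [h1, hb.repr_add hzz] at e1
  rw [h2] at e2
  have e3 : ∑ k, b.repr z k * B.repr (hi k - lo k) j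
      = ∑ k, b.repr z k * B.repr (hi k) j - ∑ k, b.repr z' k * B.repr (lo k) j := by
    rw [← Finset.sum_sub_distrib]
    apply Finset.sum_congr rfl
    intro k _
    by_cases hk : k ∈ J
    · rw [hlJ k hk, hhJ k hk]; simp
    · rw [hb.repr_out hzz hk, map_sub, Finsupp.sub_apply]; ring
  rw [e3]; linarith

theorem Cfg.Odd.range (hO : C.Odd B J) (hb : C.JFr B J b) {z z' : V} (hz : z ∈ C.S)
    (hz' : z' ∈ C.S) (hzz : z' - z ∈ T B J) (I : Finset (Fin r)) (hI : ∀ i ∈ I, i ∉ J)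
    (x y : Fin r → V) (hx : ∀ i ∈ I, x i ∈ C.S) (hy : ∀ i ∈ I, y i ∈ C.S)
    (hxT : ∀ i ∈ I, x i - b i ∈ T B J) (hyT : ∀ i ∈ I, y i - b i ∈ T B J) (j : Fin r) :
    B.repr (z' - z) j + ∑ k ∈ I, |b.repr z k| * B.repr (y k - x k) j ≤ 2 := by
  classical
  have key := hO.range0 hb hz hz' hzz
    (fun i => if i ∈ I then (if 0 ≤ b.repr z i then x i - b i else y i - b i) else 0)
    (fun i => if i ∈ I then (if 0 ≤ b.repr z i then y i - b i else x i - b i) else 0)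
    (by
      intro i; split_ifs with h1 h2
      · exact hxT i h1
      · exact hyT i h1
      · exact zero_mem _)
    (by intro j hj; rw [if_neg (fun h => hI j h hj)])
    (by
      intro i; split_ifs with h1 h2
      · simpa using hx i h1
      · simpa using hy i h1
      · simpa using hb.1 i)
    (by
      intro i; split_ifs with h1 h2
      · exact hyT i h1
      · exact hxT i h1
      · exact zero_mem _)
    (by intro j hj; rw [if_neg (fun h => hI j h hj)])
    (by
      intro i; split_ifs with h1 h2
      · simpa using hy i h1
      · simpa using hx i h1
      · simpa using hb.1 i) j
  refine le_trans (le_of_eq ?_) key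
  congr 1
  rw [← Finset.sum_subset (Finset.subset_univ I)]
  · apply Finset.sum_congr rfl
    intro k hk
    simp only [hk, if_true]
    split_ifs with h
    · rw [abs_of_nonneg h]; congr 2; simp
    · push Not at h
      rw [abs_of_neg h]
      have : x k - b k - (y k - b k) = -(y k - x k) := by abel
      rw [this, map_neg, Finsupp.neg_apply]; ring
  · intro k _ hk; simp [hk]

/-- width at most one outside of T -/
theorem Cfg.Odd.width (hO : C.Odd B J) {x y : V} (hx : x ∈ C.S) (hy : y ∈ C.S)
    (hxT : x ∉ T B J) (hT : y - x ∈ T B J) (j : Fin r) : B.repr (y - x) j ≤ 1 := by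
  classical
  have : ∃ i, i ∉ J ∧ B.repr x i ≠ 0 := by
    by_contra! h; exact hxT (mem_T.2 h)
  obtain ⟨i, hi, hx0⟩ := this
  obtain ⟨b, hb, hbi, _⟩ := hO.jfr.pivot hx hi hx0
  have := hO.range hb hx hy hT {i} (by simpa using hi) (fun _ => x) (fun _ => y)
    (fun _ _ => hx) (fun _ _ => hy)
    (by intro k hk; rw [Finset.mem_singleton.1 hk, hbi, sub_self]; exact zero_mem _)
    (by intro k hk; rw [Finset.mem_singleton.1 hk, hbi]; exact hT) j
  rw [Finset.sum_singleton] at this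
  have e : b.repr x i = 1 := by rw [← hbi]; simp
  rw [e] at this
  norm_num at this ⊢
  linarith

def Cfg.Wide (C : Cfg r V) (B : Basis (Fin r) ℚ V) (J : Finset (Fin r)) (j : Fin r) (z : V) :
    Prop := ∃ x ∈ C.S, ∃ y ∈ C.S, x - z ∈ T B J ∧ y - z ∈ T B J ∧ 1 ≤ B.repr (y - x) j

theorem Cfg.Wide.neg {j : Fin r} {z : V} (h : C.Wide B J j z) : C.Wide B J j (-z) := by
  obtain ⟨x, hx, y, hy, h1, h2, h3⟩ := h
  refine ⟨-y, Cfg.neg_mem hy, -x, Cfg.neg_mem hx, ?_, ?_, ?_⟩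
  · have := (T B J).neg_mem h2; convert this using 1; abel
  · have := (T B J).neg_mem h1; convert this using 1; abel
  · convert h3 using 3; abel

theorem Cfg.Wide.shift {j : Fin r} {z z' : V} (h : C.Wide B J j z) (hz : z - z' ∈ T B J) :
    C.Wide B J j z' := by
  obtain ⟨x, hx, y, hy, h1, h2, h3⟩ := h
  refine ⟨x, hx, y, hy, ?_, ?_, h3⟩
  · have := add_mem h1 hz; convert this using 1; abel
  · have := add_mem h2 hz; convert this using 1; abel

theorem exists_out {b : Basis (Fin r) ℚ V} {z : V} (h : z ∉ T b J) : ∃ i, i ∉ J ∧ b.repr z i ≠ 0 := by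
  by_contra! h'; exact h (mem_T.2 h')

/-- in a frame of wide elements, a wide element has only one outer coordinate there -/
theorem Cfg.Odd.wide2 (hO : C.Odd B J) (hb : C.JFr B J b) {j : Fin r} {z z' : V} (hz : z ∈ C.S)
    (hz' : z' ∈ C.S) (hzT : z' - z ∈ T B J) {i1 i2 : Fin r} (h1 : i1 ∉ J) (h2 : i2 ∉ J)
    (h12 : i1 ≠ i2)
    (hw1 : C.Wide B J j (b i1)) (hw2 : C.Wide B J j (b i2)) (hz1 : b.repr z i1 ≠ 0)
    (hz2 : b.repr z i2 ≠ 0) : B.repr (z' - z) j ≤ 0 := by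
  classical
  obtain ⟨x1, hx1, y1, hy1, hx1T, hy1T, hw1⟩ := hw1
  obtain ⟨x2, hx2, y2, hy2, hx2T, hy2T, hw2⟩ := hw2
  have := hO.range hb hz hz' hzT {i1, i2} (by
      intro i hi; simp at hi; rcases hi with rfl | rfl <;> assumption)
    (fun i => if i = i1 then x1 else x2) (fun i => if i = i1 then y1 else y2)
    (by intro i hi; split_ifs <;> assumption)
    (by intro i hi; split_ifs <;> assumption)
    (by
      intro i hi
      simp at hi; rcases hi with rfl | rfl
      · simpa using hx1T
      · simpa [h12.symm] using hx2T)
    (by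
      intro i hi
      simp at hi; rcases hi with rfl | rfl
      · simpa using hy1T
      · simpa [h12.symm] using hy2T) j
  rw [Finset.sum_pair h12] at this
  simp only [if_true, h12.symm, if_false] at this
  have a1 : |b.repr z i1| = 1 := by
    rcases (hb.odd hO).outer hz h1 with h | h | h
    · exact absurd h hz1
    · rw [h]; norm_num
    · rw [h]; norm_num
  have a2 : |b.repr z i2| = 1 := by
    rcases (hb.odd hO).outer hz h2 with h | h | h
    · exact absurd h hz2
    · rw [h]; norm_num
    · rw [h]; norm_num
  rw [a1, a2] at this
  linarith

theorem Cfg.Odd.L1 (hO : C.Odd B J) (j : Fin r) (Z0 : Finset V) (hS : ∀ z ∈ Z0, z ∈ C.S)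
    (hT : ∀ z ∈ Z0, z ∉ T B J) (hW : ∀ z ∈ Z0, C.Wide B J j z)
    (hp : ∀ z ∈ Z0, ∀ z' ∈ Z0, z ≠ z' → ∀ a : ℚ, z' - a • z ∉ T B J) :
    ∃ b, C.JFr B J b ∧ ∀ z ∈ Z0, ∃ i, i ∉ J ∧ b i = z := by
  classical
  obtain ⟨b, hb, hmax⟩ := exists_maxi (fun b => C.JFr B J b)
    (fun b => (Finset.univ.filter fun i => i ∉ J ∧ b i ∈ Z0).card) r
    (fun b _ => (Finset.card_le_univ _).trans (by simp)) ⟨B, hO.jfr⟩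
  refine ⟨b, hb, ?_⟩
  intro z hz
  by_contra! hcon
  have hI : ∀ i, i ∉ J → b.repr z i ≠ 0 → b i ∈ Z0 := by
    intro i hi h0
    by_contra hn
    obtain ⟨b', hb', h1, h2⟩ := hb.pivot (hS z hz) hi h0
    have hlt : (Finset.univ.filter fun i => i ∉ J ∧ b i ∈ Z0).card <
        (Finset.univ.filter fun i => i ∉ J ∧ b' i ∈ Z0).card := by
      apply Finset.card_lt_card
      rw [Finset.ssubset_iff_of_subset]
      · exact ⟨i, by simp [hi, h1, hz], by simp [hn]⟩
      · intro k hk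
        simp only [Finset.mem_filter, Finset.mem_univ, true_and] at hk ⊢
        have : k ≠ i := by rintro rfl; exact hn hk.2
        rw [h2 k this]; exact hk
    exact absurd (hmax b' hb') (by omega)
  obtain ⟨i1, hi1, h1⟩ := exists_out (b := b) (J := J) (z := z) (by rw [hb.T_eq]; exact hT z hz)
  have : z - b.repr z i1 • b i1 ∉ T b J := by
    rw [hb.T_eq]
    apply hp _ (hI i1 hi1 h1) z hz
    intro h; exact hcon i1 hi1 h
  obtain ⟨i2, hi2, h2⟩ := exists_out this
  have h12 : i1 ≠ i2 := by rintro rfl; simp at h2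
  have h2' : b.repr z i2 ≠ 0 := by simpa [Finsupp.single_apply, h12] using h2
  obtain ⟨x, hx, y, hy, hxT, hyT, hw⟩ := hW z hz
  have hyx : y - x ∈ T B J := by
    have := sub_mem hyT hxT; convert this using 1; abel
  have := hO.wide2 hb (j := j) hx hy hyx hi1 hi2 h12 (hW _ (hI i1 hi1 h1)) (hW _ (hI i2 hi2 h2'))
    (by rw [hb.repr_out hxT hi1]; exact h1) (by rw [hb.repr_out hxT hi2]; exact h2')
  linarith

theorem Cfg.Odd.L1_card (hO : C.Odd B J) (j : Fin r) (Z0 : Finset V) (hS : ∀ z ∈ Z0, z ∈ C.S)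
    (hT : ∀ z ∈ Z0, z ∉ T B J) (hW : ∀ z ∈ Z0, C.Wide B J j z)
    (hp : ∀ z ∈ Z0, ∀ z' ∈ Z0, z ≠ z' → ∀ a : ℚ, z' - a • z ∉ T B J) :
    Z0.card + J.card ≤ r := by
  classical
  obtain ⟨b, hb, h⟩ := hO.L1 j Z0 hS hT hW hp
  have h1 : Z0 ⊆ (Jᶜ).image b := by
    intro z hz
    obtain ⟨i, hi, rfl⟩ := h z hz
    exact Finset.mem_image_of_mem _ (by simpa using hi)
  have h2 := (Finset.card_le_card h1).trans Finset.card_image_le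
  rw [Finset.card_compl, Fintype.card_fin] at h2
  have := Finset.card_le_univ J
  rw [Fintype.card_fin] at this
  omega

end

/-- contraction with the lost set -/
theorem Cfg.contract2 (C : Cfg (r + 1) V) (B : Basis (Fin (r + 1)) ℚ V) (hB : ∀ i, B i ∈ C.S)
    (i0 : Fin (r + 1)) (K : Finset V) (hK : K ⊆ C.X) (hK0 : ∀ k ∈ K, ∀ a : ℚ, k ≠ a • B i0)
    (hKp : ∀ k ∈ K, ∀ k' ∈ K, k ≠ k' → ∀ a c : ℚ, k' ≠ a • k + c • B i0) :
    ∃ (C' : Cfg r (Fin r → ℚ)) (Y Z : Finset V), C.X.card ≤ C'.X.card + 1 + Z.card ∧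
      Y ⊆ C.X ∧ Z ⊆ C.X ∧ K ⊆ Y ∧ (∀ y ∈ Y, ∀ a : ℚ, y ≠ a • B i0) ∧
      (∀ y ∈ Y, ∀ y' ∈ Y, y ≠ y' → ∀ a c : ℚ, y' ≠ a • y + c • B i0) ∧
      (∀ z ∈ Z, z ∉ Y) ∧ (∀ z ∈ Z, ∀ a : ℚ, z ≠ a • B i0) ∧
      (∀ z ∈ Z, ∃ y ∈ Y, ∃ a c : ℚ, a ≠ 0 ∧ c ≠ 0 ∧ z = a • y + c • B i0) ∧
      ∀ J, C.Odd B J → (∀ j ∈ J, j ≠ i0 → B j ∈ K ∨ -B j ∈ K) →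
        ∃ B' J', C'.Odd B' J' ∧ J'.card ≤ (J.erase i0).card := by
  classical
  obtain ⟨Y, hYX, hKY, hY0, hYp, hcov, C', hC', hodd⟩ := C.contract B hB i0 K hK hK0 hKp
  obtain ⟨s, hs, hsX⟩ := Cfg.exists_X (hB i0)
  have hs0 : s ≠ 0 := by rcases hs with rfl | rfl <;> norm_num
  refine ⟨C', Y, (C.X \ Y).erase (s • B i0), ?_, hYX, ?_, hKY, hY0, hYp, ?_, ?_, ?_, hodd⟩
  · rw [hC']
    have h1 := Finset.card_sdiff_add_card_eq_card hYX
    have h2 := Finset.pred_card_le_card_erase (s := C.X \ Y) (a := s • B i0)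
    omega
  · intro z hz
    simp at hz; exact hz.2.1
  · intro z hz
    simp at hz; exact hz.2.2
  · intro z hz a h
    simp only [Finset.mem_erase, Finset.mem_sdiff] at hz
    exact hz.1 (C.np _ hsX z hz.2.1 (a * s⁻¹) (by
      rw [h, smul_smul, mul_assoc, inv_mul_cancel₀ hs0, mul_one]))
  · intro z hz
    simp only [Finset.mem_erase, Finset.mem_sdiff] at hz
    rcases hcov z hz.2.1 with h | ⟨a, h⟩ | ⟨y, hy, a, c, h⟩
    · exact absurd h hz.2.2
    · exact absurd (C.np _ hsX z hz.2.1 (a * s⁻¹) (by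
        rw [h, smul_smul, mul_assoc, inv_mul_cancel₀ hs0, mul_one])) hz.1
    · refine ⟨y, hy, a, c, ?_, ?_, h⟩
      · rintro rfl
        exact hz.1 (C.np _ hsX z hz.2.1 (c * s⁻¹) (by
          rw [h, smul_smul, mul_assoc, inv_mul_cancel₀ hs0, mul_one]; simp))
      · rintro rfl
        have := C.np y (hYX hy) z hz.2.1 a (by simpa using h)
        exact hz.2.2 (this ▸ hy)

/-- pairwise nonparallel modulo v -/
theorem Cfg.lines_pair {C : Cfg r V} {v : V} {Y Z : Finset V} (hZ : Z ⊆ C.X)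
    (hYp : ∀ y ∈ Y, ∀ y' ∈ Y, y ≠ y' → ∀ a c : ℚ, y' ≠ a • y + c • v)
    (hZl : ∀ z ∈ Z, ∃ y ∈ Y, ∃ a c : ℚ, (a = 1 ∨ a = -1) ∧ (c = 1 ∨ c = -1) ∧ z = a • y + c • v)
    (hnb : ∀ z ∈ Z, ∀ y ∈ Y, ∀ a c : ℚ, z = a • y + c • v → ¬ (y + v ∈ C.S ∧ y - v ∈ C.S)) :
    ∀ z ∈ Z, ∀ z' ∈ Z, z ≠ z' → ∀ a c : ℚ, a ≠ 0 → z' ≠ a • z + c • v := by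
  intro z hz z' hz' hne a c ha0 h
  obtain ⟨y, hy, a1, c1, ha1, hc1, h1⟩ := hZl z hz
  obtain ⟨y', hy', a2, c2, ha2, hc2, h2⟩ := hZl z' hz'
  have hyy : y = y' := by
    by_contra hyy
    apply hYp y hy y' hy' hyy (a2 * a * a1) (a2 * (a * c1 + c - c2))
    have e : a2 * a2 = 1 := by rcases ha2 with rfl | rfl <;> norm_num
    have e2 : a2 • z' = a2 • (a2 • y' + c2 • v) := by rw [h2]
    rw [smul_add, smul_smul, e, one_smul] at e2
    have e3 : y' = a2 • z' - (a2 • c2 • v) := by rw [e2]; abel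
    rw [e3, h, h1]; module
  subst hyy
  have hb := hnb z hz y hy a1 c1 h1
  have hzS := Cfg.S_of_X (hZ hz)
  have hzS' := Cfg.S_of_X (hZ hz')
  apply hne
  rcases ha1 with rfl | rfl <;> rcases hc1 with rfl | rfl <;> rcases ha2 with rfl | rfl <;>
    rcases hc2 with rfl | rfl
  · rw [h1, h2]
  · exact absurd ⟨by convert hzS using 1; rw [h1]; module, by convert hzS' using 1; rw [h2]; module⟩ hb
  · exact absurd ⟨by convert hzS using 1; rw [h1]; module, by convert Cfg.neg_mem hzS' using 1; rw [h2]; module⟩ hb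
  · exact (Cfg.X_np (hZ hz) (hZ hz') (by rw [h1, h2]; module)).symm
  · exact absurd ⟨by convert hzS' using 1; rw [h2]; module, by convert hzS using 1; rw [h1]; module⟩ hb
  · rw [h1, h2]
  · exact (Cfg.X_np (hZ hz) (hZ hz') (by rw [h1, h2]; module)).symm
  · exact absurd ⟨by convert Cfg.neg_mem hzS' using 1; rw [h2]; module, by convert hzS using 1; rw [h1]; module⟩ hb
  · exact absurd ⟨by convert hzS' using 1; rw [h2]; module, by convert Cfg.neg_mem hzS using 1; rw [h1]; module⟩ hb
  · exact (Cfg.X_np (hZ hz) (hZ hz') (by rw [h1, h2]; module)).symm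
  · rw [h1, h2]
  · exact absurd ⟨by convert Cfg.neg_mem hzS' using 1; rw [h2]; module, by convert Cfg.neg_mem hzS using 1; rw [h1]; module⟩ hb
  · exact (Cfg.X_np (hZ hz) (hZ hz') (by rw [h1, h2]; module)).symm
  · exact absurd ⟨by convert Cfg.neg_mem hzS using 1; rw [h1]; module, by convert hzS' using 1; rw [h2]; module⟩ hb
  · exact absurd ⟨by convert Cfg.neg_mem hzS using 1; rw [h1]; module, by convert Cfg.neg_mem hzS' using 1; rw [h2]; module⟩ hb
  · rw [h1, h2]

theorem Cfg.line_pm {C : Cfg r V} {v y z : V} (hy : y ∈ C.S) {a c : ℚ} (ha : a = 1 ∨ a = -1)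
    (hc : c = 1 ∨ c = -1) (h : z = a • y + c • v) : z + v ∈ C.S ∨ z - v ∈ C.S := by
  rcases hc with rfl | rfl
  · right
    rcases ha with rfl | rfl
    · convert hy using 1; rw [h]; module
    · convert Cfg.neg_mem hy using 1; rw [h]; module
  · left
    rcases ha with rfl | rfl
    · convert hy using 1; rw [h]; module
    · convert Cfg.neg_mem hy using 1; rw [h]; module

end TM
end

section
namespace TM
variable {r : ℕ} {V : Type} [AddCommGroup V] [Module ℚ V]
open Module

section
variable {C : Cfg r V}

theorem Cfg.exists_basis (C : Cfg r V) : ∃ B : Basis (Fin r) ℚ V, ∀ i, B i ∈ C.S := by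
  obtain ⟨f, hf, h⟩ := C.full_S
  obtain ⟨B, hB⟩ := C.mkBasis f h
  exact ⟨B, fun i => by rw [hB]; exact hf i⟩

theorem jfr_self {B : Basis (Fin r) ℚ V} (hB : ∀ i, B i ∈ C.S) (J : Finset (Fin r)) :
    C.JFr B J B := ⟨hB, fun _ _ => rfl⟩

theorem exists_coord (B : Basis (Fin r) ℚ V) {x : V} (hx : x ≠ 0) : ∃ i, B.repr x i ≠ 0 := by
  by_contra! h
  apply hx
  apply B.repr.injective
  ext i; simp [h i]

theorem Cfg.basis1 (C : Cfg r V) {x : V} (hx : x ∈ C.S) :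
    ∃ (B : Basis (Fin r) ℚ V) (i : Fin r), (∀ k, B k ∈ C.S) ∧ B i = x := by
  obtain ⟨B, hB⟩ := C.exists_basis
  obtain ⟨i, hi⟩ := exists_coord B (Cfg.S_nz hx)
  obtain ⟨b, hb, h1, _⟩ := (jfr_self hB ∅).pivot hx (by simp) hi
  exact ⟨b, i, hb.1, h1⟩

theorem Cfg.basis2 (C : Cfg r V) {x y : V} (hx : x ∈ C.S) (hy : y ∈ C.S)
    (hn : ∀ a : ℚ, y ≠ a • x) : ∃ (B : Basis (Fin r) ℚ V) (i j : Fin r), i ≠ j ∧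
      (∀ k, B k ∈ C.S) ∧ B i = x ∧ B j = y := by
  classical
  obtain ⟨B, i, hB, rfl⟩ := C.basis1 hx
  have : y ∉ T B {i} := by
    intro h
    have := sum_T h
    rw [Finset.sum_singleton] at this
    exact hn _ this
  obtain ⟨j, hj, h0⟩ := exists_out this
  have hj' : j ≠ i := by simpa using hj
  obtain ⟨b, hb, h1, h2⟩ := (jfr_self hB {i}).pivot hy hj h0
  exact ⟨b, i, j, hj'.symm, hb.1, h2 i hj'.symm, h1⟩

theorem Cfg.ω_coord (C : Cfg r V) {b : Basis (Fin r) ℚ V} (hb : ∀ i, b i ∈ C.S) {x : V}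
    (hx : x ∈ C.S) (i : Fin r) : ∃ z : ℤ, b.repr x i * C.ω b = z ∧ |z| ≤ 2 := by
  rw [← C.ω_update]
  apply C.int_S
  intro k
  by_cases hk : k = i
  · subst hk; simpa using hx
  · rw [Function.update_of_ne hk]; exact hb k

theorem Cfg.basis_one (hno : ∀ B J, C.Odd B J → 4 < J.card) {x y : V} (hx : x ∈ C.S)
    (hy : y ∈ C.S) (hn : ∀ a : ℚ, y ≠ a • x) : ∃ (B : Basis (Fin r) ℚ V) (i j : Fin r), i ≠ j ∧
      (∀ k, B k ∈ C.S) ∧ B i = x ∧ B j = y ∧ |C.ω B| = 1 := by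
  classical
  obtain ⟨B, i, j, hij, hB, hi, hj⟩ := C.basis2 hx hy hn
  have : ¬ C.Odd B {i, j} := by
    intro h
    have := hno _ _ h
    have := Finset.card_le_two (a := i) (b := j)
    omega
  unfold Cfg.Odd at this
  push Not at this
  obtain ⟨f, hf, hfB, hk⟩ := this hB
  obtain ⟨z, hz, hz2⟩ := C.int_S f hf
  have hz1 : |z| = 1 := by
    rw [abs_le] at hz2
    have h0 : z ≠ 0 := by rintro rfl; exact hk 0 (by simpa using hz)
    have h2 : z ≠ 2 := by rintro rfl; exact hk 1 (by rw [hz]; norm_num)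
    have h3 : z ≠ -2 := by rintro rfl; exact hk (-1) (by rw [hz]; norm_num)
    have : z = 1 ∨ z = -1 := by omega
    rcases this with rfl | rfl <;> rfl
  have hω : |C.ω f| = 1 := by rw [hz]; exact_mod_cast hz1
  obtain ⟨b, hb⟩ := C.mkBasis f (by intro h; rw [h] at hω; norm_num at hω)
  refine ⟨b, i, j, hij, ?_, ?_, ?_, ?_⟩
  · intro k; rw [hb]; exact hf k
  · rw [hb, hfB i (by simp), hi]
  · rw [hb, hfB j (by simp), hj]
  · rw [hb]; exact hω

theorem Cfg.col_int (hno : ∀ B J, C.Odd B J → 4 < J.card) {x y z : V} (hx : x ∈ C.S)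
    (hy : y ∈ C.S) (hz : z ∈ C.S) (hn : ∀ a : ℚ, y ≠ a • x) {α β : ℚ} (h : z = α • x + β • y) :
    ∃ k : ℤ, α = k := by
  obtain ⟨B, i, j, hij, hB, hi, hj, hω⟩ := Cfg.basis_one hno hx hy hn
  obtain ⟨m, hm, _⟩ := C.ω_coord hB hz i
  have : B.repr z i = α := by
    rw [h, ← hi, ← hj]; simp [Finsupp.single_apply, hij.symm]
  rw [this] at hm
  rcases (abs_eq (by norm_num : (0 : ℚ) ≤ 1)).1 hω with h1 | h1
  · exact ⟨m, by rw [← hm, h1, mul_one]⟩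
  · exact ⟨-m, by push_cast; rw [← hm, h1]; ring⟩

theorem Cfg.col_pm (hno : ∀ B J, C.Odd B J → 4 < J.card) {x y z : V} (hx : x ∈ C.S)
    (hy : y ∈ C.S) (hz : z ∈ C.S) (hn : ∀ a : ℚ, y ≠ a • x) {α β : ℚ} (hα : α ≠ 0)
    (h : z = α • x + β • y) : α = 1 ∨ α = -1 := by
  obtain ⟨k, hk⟩ := Cfg.col_int hno hx hy hz hn h
  have hx' : x = α⁻¹ • z + (-(α⁻¹ * β)) • y := by
    rw [h, smul_add, smul_smul, inv_mul_cancel₀ hα]; module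
  have hyz : ∀ a : ℚ, y ≠ a • z := by
    intro a ha
    rw [h] at ha
    by_cases ha0 : a = 0
    · subst ha0; simp at ha; exact Cfg.S_nz hy ha
    · have e : (a * α) • x = (1 - a * β) • y := by
        have : (a * α) • x - (1 - a * β) • y = a • (α • x + β • y) - y := by module
        rw [← sub_eq_zero, this, ← ha, sub_self]
      have hne : 1 - a * β ≠ 0 := by
        intro h0; rw [h0, zero_smul] at e
        exact Cfg.S_nz hx ((smul_eq_zero.1 e).resolve_left (mul_ne_zero ha0 hα))
      apply hn ((1 - a * β)⁻¹ * (a * α))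
      rw [mul_smul, e, smul_smul, inv_mul_cancel₀ hne, one_smul]
  obtain ⟨l, hl⟩ := Cfg.col_int hno hz hy hx hyz hx'
  have e : k * l = 1 := by
    have : (k : ℚ) * l = 1 := by rw [← hk, ← hl, mul_inv_cancel₀ hα]
    exact_mod_cast this
  rcases Int.isUnit_iff.1 (IsUnit.of_mul_eq_one _ e) with h1 | h1
  · left; rw [hk, h1]; simp
  · right; rw [hk, h1]; simp

theorem Cfg.ω_shift (C : Cfg r V) (b b' : Basis (Fin r) ℚ V) (i0 : Fin r) (c : Fin r → ℚ)
    (hc : c i0 = 0) (h : ∀ i, b' i = b i + c i • b i0) : C.ω b' = C.ω b := by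
  have h1 : C.ω b' = C.ω b * b.det b' := by
    conv_lhs => rw [C.ω.eq_smul_basis_det b]
    simp
  have h2 : b.det b' = b.det b := by
    rw [Basis.det_apply, Basis.det_apply, ← Matrix.det_transpose, ← Matrix.det_transpose (b.toMatrix b)]
    apply Matrix.det_eq_of_forall_row_eq_smul_add_const c i0 hc
    intro i j
    simp only [Matrix.transpose_apply, Basis.toMatrix_apply, h]
    simp [Finsupp.single_apply]
  rw [h1, h2, b.det_self, mul_one]

theorem Cfg.shiftv (C : Cfg r V) {f : Basis (Fin r) ℚ V} (hf : ∀ i, f i ∈ C.S) (i0 : Fin r)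
    (D : Finset (Fin r)) (hD : i0 ∉ D) (hS : ∀ i ∈ D, f i + f i0 ∈ C.S) :
    ∃ f' : Basis (Fin r) ℚ V, (∀ i, f' i ∈ C.S) ∧ C.ω f' = C.ω f ∧ f' i0 = f i0 ∧
      (∀ x, f'.repr x i0 = f.repr x i0 - ∑ k ∈ D, f.repr x k) ∧
      (∀ x i, i ≠ i0 → f'.repr x i = f.repr x i) := by
  classical
  obtain ⟨f', hf', h1, h2⟩ := (jfr_self hf {i0}).shift (fun i => if i ∈ D then f i0 else 0)
    (by
      intro i; split_ifs
      · exact B_mem_T f (by simp)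
      · exact zero_mem _)
    (by intro j hj; rw [Finset.mem_singleton.1 hj, if_neg hD])
    (by
      intro i; split_ifs with h
      · exact hS i h
      · simpa using hf i)
  refine ⟨f', hf'.1, ?_, hf'.2 i0 (by simp), ?_, ?_⟩
  · apply C.ω_shift f f' i0 (fun i => if i ∈ D then 1 else 0) (by simp [hD])
    intro i; rw [h1]; split_ifs <;> simp
  · intro x; rw [h2]
    congr 1
    rw [← Finset.sum_subset (Finset.subset_univ D)]
    · apply Finset.sum_congr rfl
      intro k hk; simp [hk]
    · intro k _ hk; simp [hk]
  · intro x i hi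
    rw [h2, Finset.sum_eq_zero, sub_zero]
    intro k _
    split_ifs
    · simp [Finsupp.single_apply, Ne.symm hi]
    · simp

theorem Cfg.odd_two (hno : ∀ B J, C.Odd B J → 4 < J.card) {f : Basis (Fin r) ℚ V}
    (hf : ∀ i, f i ∈ C.S) (hω : |C.ω f| = 1) (i0 : Fin r) {x : V} (hx : x ∈ C.S)
    (I : Finset (Fin r)) (hI : ∀ i, i ∉ I → f.repr x i = 0) (hcard : I.card ≤ 4)
    (h2 : f.repr x i0 = 2 ∨ f.repr x i0 = -2) : False := by
  classical
  have h0 : f.repr x i0 ≠ 0 := by rcases h2 with h | h <;> rw [h] <;> norm_num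
  obtain ⟨g, hg, hgi, hgk⟩ := (jfr_self hf ∅).pivot hx (by simp) h0
  have hint : ∀ i, ∃ m : ℤ, f.repr x i = m := by
    intro i
    obtain ⟨m, hm, _⟩ := C.ω_coord hf hx i
    rcases (abs_eq (by norm_num : (0 : ℚ) ≤ 1)).1 hω with h1 | h1
    · exact ⟨m, by rw [← hm, h1, mul_one]⟩
    · exact ⟨-m, by push_cast; rw [← hm, h1]; ring⟩
  choose m hm using hint
  set u := f.repr x i0 with hu
  have hfx : ∀ i, g.repr (f i0) i = if i = i0 then u⁻¹ else -u⁻¹ * f.repr x i := by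
    have e : f i0 = u⁻¹ • g i0 + ∑ k ∈ Finset.univ.erase i0, (-u⁻¹ * f.repr x k) • g k := by
      rw [hgi]
      have e1 : ∑ k ∈ Finset.univ.erase i0, (-u⁻¹ * f.repr x k) • g k =
          (-u⁻¹) • ∑ k ∈ Finset.univ.erase i0, f.repr x k • f k := by
        rw [Finset.smul_sum]
        apply Finset.sum_congr rfl
        intro k hk
        rw [hgk k (Finset.ne_of_mem_erase hk), mul_smul]
      have e2 : x = u • f i0 + ∑ k ∈ Finset.univ.erase i0, f.repr x k • f k := by
        rw [hu, Finset.add_sum_erase Finset.univ (fun k => f.repr x k • f k) (Finset.mem_univ i0), f.sum_repr]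
      rw [e1]
      generalize (∑ k ∈ Finset.univ.erase i0, f.repr x k • f k) = S at e2
      have e3 : u⁻¹ • x = f i0 + u⁻¹ • S := by
        conv_lhs => rw [e2]
        rw [smul_add, smul_smul, inv_mul_cancel₀ h0, one_smul]
      rw [e3]
      module
    intro i
    rw [e]
    by_cases hi : i = i0
    · subst hi
      simp [Finsupp.single_apply, Finset.sum_ite_eq']
    · simp [Finsupp.single_apply, hi, Ne.symm hi]
  have hn : ∃ e : ℤ, _root_.Odd e ∧ 2 * u⁻¹ = e := by
    rcases h2 with h | h
    · exact ⟨1, by decide, by rw [h]; norm_num⟩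
    · exact ⟨-1, by decide, by rw [h]; norm_num⟩
  obtain ⟨e, he, hue⟩ := hn
  have := C.odd_of_rel g hg.1 (hf i0) (fun i => if i = i0 then e else -e * m i) (by
    intro i
    rw [hfx]
    split_ifs
    · exact hue
    · push_cast; rw [← hue, hm]; ring) I (by
    intro i hi
    have hii : i ≠ i0 := by rintro rfl; exact h0 (hI _ hi)
    have : m i = 0 := by
      have := hI i hi; rw [hm] at this; exact_mod_cast this
    simp [hii, this]) i0 (by by_contra h; exact h0 (hI _ h)) (by simpa using he)
  have := hno _ _ this
  omega

theorem Cfg.lineS (hno : ∀ B J, C.Odd B J → 4 < J.card) {v : V} (hv : v ∈ C.S) (W : Finset V)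
    (hW : ∀ w ∈ W, w ∈ C.S) (hWv : ∀ w ∈ W, w + v ∈ C.S) (hW0 : ∀ w ∈ W, ∀ a : ℚ, w ≠ a • v)
    (hWp : ∀ w ∈ W, ∀ w' ∈ W, w ≠ w' → ∀ a c : ℚ, w' ≠ a • w + c • v) : W.card + 1 ≤ r := by
  classical
  obtain ⟨B, i0, hB, rfl⟩ := C.basis1 hv
  obtain ⟨f, hf, hmax⟩ := exists_maxi (fun b => C.JFr B {i0} b)
    (fun b => (Finset.univ.filter fun i => i ∉ ({i0} : Finset (Fin r)) ∧ b i ∈ W).card) r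
    (fun b _ => (Finset.card_le_univ _).trans (by simp)) ⟨B, jfr_self hB _⟩
  have hfi : f i0 = B i0 := hf.2 i0 (by simp)
  by_cases hall : ∀ w ∈ W, ∃ i, i ∉ ({i0} : Finset (Fin r)) ∧ f i = w
  · have h1 : W ⊆ (({i0} : Finset (Fin r))ᶜ).image f := by
      intro z hz
      obtain ⟨i, hi, rfl⟩ := hall z hz
      exact Finset.mem_image_of_mem _ (by simpa using hi)
    have h2 := (Finset.card_le_card h1).trans Finset.card_image_le
    rw [Finset.card_compl, Fintype.card_fin, Finset.card_singleton] at h2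
    have : 0 < r := i0.pos
    omega
  exfalso
  push Not at hall
  obtain ⟨w, hw, hwn⟩ := hall
  have hI : ∀ i, i ∉ ({i0} : Finset (Fin r)) → f.repr w i ≠ 0 → f i ∈ W := by
    intro i hi h0
    by_contra hn
    obtain ⟨b', hb', h1, h2⟩ := hf.pivot (hW w hw) hi h0
    have hlt : (Finset.univ.filter fun i => i ∉ ({i0} : Finset (Fin r)) ∧ f i ∈ W).card <
        (Finset.univ.filter fun i => i ∉ ({i0} : Finset (Fin r)) ∧ b' i ∈ W).card := by
      apply Finset.card_lt_card
      rw [Finset.ssubset_iff_of_subset]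
      · refine ⟨i, ?_, by simp [hn]⟩
        simp only [Finset.mem_filter, Finset.mem_univ, true_and]
        exact ⟨hi, by rw [h1]; exact hw⟩
      · intro k hk
        simp only [Finset.mem_filter, Finset.mem_univ, true_and] at hk ⊢
        have : k ≠ i := by rintro rfl; exact hn hk.2
        rw [h2 k this]; exact hk
    exact absurd (hmax b' hb') (by omega)
  have hwT : w ∉ T f {i0} := by
    intro h; have := sum_T h; rw [Finset.sum_singleton, hfi] at this; exact hW0 w hw _ this
  obtain ⟨i1, hi1, h1⟩ := exists_out hwT
  have hwT2 : w - f.repr w i1 • f i1 ∉ T f {i0} := by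
    intro h; have := sum_T h; rw [Finset.sum_singleton, hfi] at this
    exact hWp _ (hI i1 hi1 h1) w hw (hwn i1 hi1) _ _ (by rw [← this]; abel)
  obtain ⟨i2, hi2, h2⟩ := exists_out hwT2
  have h12 : i1 ≠ i2 := by rintro rfl; simp at h2
  have h2' : f.repr w i2 ≠ 0 := by simpa [Finsupp.single_apply, h12] using h2
  -- the support
  let I : Finset (Fin r) := Finset.univ.filter fun i => i ≠ i0 ∧ f.repr w i ≠ 0
  have hIm : ∀ i, i ∈ I ↔ i ≠ i0 ∧ f.repr w i ≠ 0 := by intro i; simp [I]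
  have hIW : ∀ i ∈ I, f i + f i0 ∈ C.S := by
    intro i hi
    rw [hfi]
    exact hWv _ (hI i (by simpa using ((hIm i).1 hi).1) ((hIm i).1 hi).2)
  have hi1I : i1 ∈ I := (hIm _).2 ⟨by simpa using hi1, h1⟩
  have hi2I : i2 ∈ I := (hIm _).2 ⟨by simpa using hi2, h2'⟩
  let Dn := I.filter fun i => f.repr w i < 0
  let Dp := I.filter fun i => ¬ f.repr w i < 0
  have hi0I : i0 ∉ I := by simp [hIm]
  obtain ⟨g, hg, hgω, hg0, hgr, hgr'⟩ := C.shiftv hf.1 i0 Dn (fun h => hi0I (Finset.mem_filter.1 h).1)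
    (fun i hi => hIW i (Finset.mem_filter.1 hi).1)
  obtain ⟨g2, hg2, hg2ω, hg20, hg2r, hg2r'⟩ := C.shiftv hf.1 i0 Dp
    (fun h => hi0I (Finset.mem_filter.1 h).1) (fun i hi => hIW i (Finset.mem_filter.1 hi).1)
  have hsum : ∑ k ∈ Dp, f.repr w k - ∑ k ∈ Dn, f.repr w k = ∑ k ∈ I, |f.repr w k| := by
    rw [← Finset.sum_filter_add_sum_filter_not I (fun i => f.repr w i < 0)]
    have e1 : ∑ k ∈ I.filter (fun i => f.repr w i < 0), |f.repr w k| = - ∑ k ∈ Dn, f.repr w k := by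
      rw [← Finset.sum_neg_distrib]
      apply Finset.sum_congr rfl
      intro k hk; exact abs_of_neg (Finset.mem_filter.1 hk).2
    have e2 : ∑ k ∈ I.filter (fun i => ¬ f.repr w i < 0), |f.repr w k| = ∑ k ∈ Dp, f.repr w k := by
      apply Finset.sum_congr rfl
      intro k hk; exact abs_of_nonneg (not_lt.1 (Finset.mem_filter.1 hk).2)
    rw [e1, e2]; ring
  have hwvS : w + f i0 ∈ C.S := by rw [hfi]; exact hWv w hw
  have hr0 : f.repr (w + f i0) i0 = f.repr w i0 + 1 := by simp
  have hrk : ∀ i, i ≠ i0 → f.repr (w + f i0) i = f.repr w i := by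
    intro i hi; simp [Finsupp.single_apply, Ne.symm hi]
  obtain ⟨M, hM, hM2⟩ := C.ω_coord hg hwvS i0
  obtain ⟨m, hm, hm2⟩ := C.ω_coord hg2 (hW w hw) i0
  rw [hgω, hgr, hr0, Finset.sum_congr rfl (fun k hk => hrk k (by
    rintro rfl; exact hi0I (Finset.mem_filter.1 hk).1))] at hM
  rw [hg2ω, hg2r] at hm
  choose A hA _ using fun i => C.ω_coord hf.1 (hW w hw) i
  obtain ⟨p, hp, hp2⟩ := C.int_S f hf.1
  have hp0 : p ≠ 0 := by rintro rfl; exact C.ω_basis f (by simpa using hp)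
  have hMm : ((M - m : ℤ) : ℚ) = (1 + ∑ k ∈ I, |f.repr w k|) * p := by
    push_cast; rw [← hM, ← hm, hp, ← hsum]; ring
  have hMm2 : |((M - m : ℤ) : ℚ)| = ((|p| + ∑ k ∈ I, |A k| : ℤ) : ℚ) := by
    rw [hMm, abs_mul, abs_of_nonneg (by positivity), add_mul, one_mul, Finset.sum_mul]
    push_cast
    congr 1
    apply Finset.sum_congr rfl
    intro k _
    rw [← hA, abs_mul, hp]
  have hMm3 : |M - m| = |p| + ∑ k ∈ I, |A k| := by exact_mod_cast hMm2
  have hA1 : ∀ k ∈ I, 1 ≤ |A k| := by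
    intro k hk
    apply Int.one_le_abs
    intro h0
    have := hA k
    rw [h0] at this
    rcases mul_eq_zero.1 (this.trans Int.cast_zero) with h | h
    · exact ((hIm k).1 hk).2 h
    · exact C.ω_basis f h
  have hcardA : (I.card : ℤ) ≤ ∑ k ∈ I, |A k| := by
    have := Finset.sum_le_sum hA1
    simpa using this
  have hA12 : |A i1| + |A i2| ≤ ∑ k ∈ I, |A k| := by
    rw [← Finset.sum_pair h12 (f := fun k => |A k|)]
    apply Finset.sum_le_sum_of_subset_of_nonneg
    · intro k hk; simp at hk; rcases hk with rfl | rfl <;> assumption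
    · intro k _ _; exact abs_nonneg _
  have ha1 := hA1 i1 hi1I
  have ha2 := hA1 i2 hi2I
  have hsupp : ∀ i, i ∉ insert i0 I → f.repr w i = 0 := by
    intro i hi
    by_contra h
    apply hi
    by_cases hii : i = i0
    · subst hii; simp
    · exact Finset.mem_insert_of_mem ((hIm i).2 ⟨hii, h⟩)
  have hcI : (insert i0 I).card ≤ I.card + 1 := Finset.card_insert_le _ _
  rw [abs_le] at hM2 hm2 hp2
  have hpc : p = 1 ∨ p = -1 ∨ p = 2 ∨ p = -2 := by omega
  have hMm4 : |M - m| ≤ 4 := by rw [abs_le]; omega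
  have fin1 : |p| = 1 → False := by
    intro hp1
    rw [hp1] at hMm3
    have hω : |C.ω f| = 1 := by rw [hp]; exact_mod_cast hp1
    have hcM : M = 2 ∨ M = -2 ∨ m = 2 ∨ m = -2 := by
      by_contra! hcon
      have : |M - m| ≤ 2 := by rw [abs_le]; omega
      omega
    have hpp : (p : ℚ) = 1 ∨ (p : ℚ) = -1 := by
      rcases (abs_eq (by norm_num : (0 : ℤ) ≤ 1)).1 hp1 with h | h <;> rw [h] <;> norm_num
    have hc4 : (insert i0 I).card ≤ 4 := by omega
    have caseM : M = 2 ∨ M = -2 → False := by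
      intro h
      apply Cfg.odd_two hno hg (by rw [hgω]; exact hω) i0 hwvS (insert i0 I) ?_ hc4 ?_
      · intro i hi
        have : i ≠ i0 := by rintro rfl; exact hi (by simp)
        rw [hgr' _ _ this, hrk i this, hsupp i hi]
      · rw [hgr, hr0, Finset.sum_congr rfl (fun k hk => hrk k (by
          rintro rfl; exact hi0I (Finset.mem_filter.1 hk).1))]
        rw [hp] at hM
        rcases h with rfl | rfl <;> rcases hpp with h | h <;> rw [h] at hM <;> push_cast at hM
        · left; linarith
        · right; linarith
        · right; linarith
        · left; linarith
    have casem : m = 2 ∨ m = -2 → False := by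
      intro h
      apply Cfg.odd_two hno hg2 (by rw [hg2ω]; exact hω) i0 (hW w hw) (insert i0 I) ?_ hc4 ?_
      · intro i hi
        have : i ≠ i0 := by rintro rfl; exact hi (by simp)
        rw [hg2r' _ _ this, hsupp i hi]
      · rw [hg2r]
        rw [hp] at hm
        rcases h with rfl | rfl <;> rcases hpp with h | h <;> rw [h] at hm <;> push_cast at hm
        · left; linarith
        · right; linarith
        · right; linarith
        · left; linarith
    tauto
  have fin2 : |p| = 2 → False := by
    intro hp1
    rw [hp1] at hMm3
    have hc4 : (insert i0 I).card ≤ 4 := by omega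
    have hA1' : |A i1| = 1 := by omega
    have hAodd : _root_.Odd (A i1) := by
      rcases (abs_eq (by norm_num : (0 : ℤ) ≤ 1)).1 hA1' with h | h <;> rw [h] <;> decide
    have hpp : ∃ e : ℤ, _root_.Odd e ∧ (2 : ℚ) = e * p := by
      rcases (abs_eq (by norm_num : (0 : ℤ) ≤ 2)).1 hp1 with h | h
      · exact ⟨1, by decide, by rw [h]; norm_num⟩
      · exact ⟨-1, by decide, by rw [h]; norm_num⟩
    obtain ⟨e, he, hep⟩ := hpp
    have := C.odd_of_rel f hf.1 (hW w hw) (fun i => e * A i) (by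
      intro i; push_cast; rw [← hA, hp, hep]; ring) (insert i0 I) (by
      intro i hi
      have h0 := hA i
      rw [hsupp i hi, zero_mul] at h0
      have : A i = 0 := by exact_mod_cast h0.symm
      simp [this]) i1 (Finset.mem_insert_of_mem hi1I) (he.mul hAodd)
    have := hno _ _ this
    omega
  rcases hpc with h | h | h | h
  · exact fin1 (by rw [h]; rfl)
  · exact fin1 (by rw [h]; rfl)
  · exact fin2 (by rw [h]; rfl)
  · exact fin2 (by rw [h]; rfl)

end

/-- the final estimate: no small odd set -/
theorem Cfg.stepS (C : Cfg (r + 1) V) (hno : ∀ B J, C.Odd B J → 4 < J.card) :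
    ∃ C' : Cfg r (Fin r → ℚ), C.X.card ≤ C'.X.card + 1 + r := by
  classical
  obtain ⟨B, hB⟩ := C.exists_basis
  obtain ⟨C', Y, Z, hcard, hY, hZ, -, hY0, hYp, hZY, hZ0, hZl, -⟩ :=
    C.contract2 B hB 0 ∅ (by simp) (by simp) (by simp)
  refine ⟨C', hcard.trans ?_⟩
  set v := B 0 with hv
  have hvS : v ∈ C.S := hB 0
  have hYv : ∀ y ∈ Y, ∀ a : ℚ, v ≠ a • y := by
    intro y hy a h
    rcases Cfg.S_np (Cfg.S_of_X (hY hy)) hvS a h with h1 | h1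
    · exact hY0 y hy 1 (by rw [h1]; simp)
    · exact hY0 y hy (-1) (by rw [h1]; simp)
  have hl : ∀ z ∈ Z, ∃ y ∈ Y, ∃ a c : ℚ, (a = 1 ∨ a = -1) ∧ (c = 1 ∨ c = -1) ∧
      z = a • y + c • v := by
    intro z hz
    obtain ⟨y, hy, a, c, ha, hc, h⟩ := hZl z hz
    refine ⟨y, hy, a, c, ?_, ?_, h⟩
    · exact Cfg.col_pm hno (Cfg.S_of_X (hY hy)) hvS (Cfg.S_of_X (hZ hz)) (hYv y hy) ha h
    · exact Cfg.col_pm hno hvS (Cfg.S_of_X (hY hy)) (Cfg.S_of_X (hZ hz)) (hY0 y hy) hc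
        (by rw [h, add_comm])
  have hpair := Cfg.lines_pair hZ hYp hl (by
    intro z hz y hy a c h hb
    have h1 : ∀ a : ℚ, y - v ≠ a • (y + v) := by
      intro a h
      by_cases ha : 1 - a = 0
      · have : a = 1 := by linarith
        subst this
        have : (2 : ℚ) • v = 0 := by
          have e : (2 : ℚ) • v = (1 : ℚ) • (y + v) - (y - v) := by module
          rw [e, ← h, sub_self]
        exact Cfg.S_nz hvS ((smul_eq_zero.1 this).resolve_left (by norm_num))
      · apply hY0 y hy ((1 - a)⁻¹ * (1 + a))
        have e : (1 - a) • y = (1 + a) • v := by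
          have : (1 - a) • y - (1 + a) • v = (y - v) - a • (y + v) := by module
          rw [← sub_eq_zero, this, h, sub_self]
        rw [mul_smul, ← e, smul_smul, inv_mul_cancel₀ ha, one_smul]
    have := Cfg.col_pm hno hb.1 hb.2 (Cfg.S_of_X (hY hy)) h1 (α := 1 / 2) (β := 1 / 2)
      (by norm_num) (by module)
    norm_num at this)
  let F : V → V := fun z => if z + v ∈ C.S then z else z - v
  have hF : ∀ z, ∃ c : ℚ, F z = z + c • v := by
    intro z
    by_cases h : z + v ∈ C.S
    · exact ⟨0, by simp [F, h]⟩
    · exact ⟨-1, by simp [F, h]; abel⟩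
  have hFS : ∀ z ∈ Z, F z ∈ C.S ∧ F z + v ∈ C.S := by
    intro z hz
    obtain ⟨y, hy, a, c, ha, hc, h⟩ := hl z hz
    by_cases h1 : z + v ∈ C.S
    · simp only [F, h1, if_true]; exact ⟨Cfg.S_of_X (hZ hz), trivial⟩
    · have := (Cfg.line_pm (Cfg.S_of_X (hY hy)) ha hc h).resolve_left h1
      simp only [F, h1, if_false, sub_add_cancel]; exact ⟨this, Cfg.S_of_X (hZ hz)⟩
  have hFp : ∀ z ∈ Z, ∀ z' ∈ Z, z ≠ z' → ∀ a c : ℚ, F z' ≠ a • F z + c • v := by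
    intro z hz z' hz' hne a c h
    obtain ⟨d, hd⟩ := hF z
    obtain ⟨d', hd'⟩ := hF z'
    rw [hd, hd'] at h
    have e : z' = a • z + (a * d + c - d') • v := by
      have : z' = (z' + d' • v) - d' • v := by abel
      rw [this, h]; module
    by_cases ha : a = 0
    · subst ha; exact hZ0 z' hz' _ (by rw [zero_smul, zero_add] at e; exact e)
    · exact hpair z hz z' hz' hne a _ ha e
  have hinj : Set.InjOn F Z := by
    intro z hz z' hz' h
    by_contra hne
    exact hFp z hz z' hz' hne 1 0 (by rw [h]; simp)
  have := Cfg.lineS hno hvS (Z.image F)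
    (by intro w hw; obtain ⟨z, hz, rfl⟩ := Finset.mem_image.1 hw; exact (hFS z hz).1)
    (by intro w hw; obtain ⟨z, hz, rfl⟩ := Finset.mem_image.1 hw; exact (hFS z hz).2)
    (by
      intro w hw a h
      obtain ⟨z, hz, rfl⟩ := Finset.mem_image.1 hw
      obtain ⟨d, hd⟩ := hF z
      rw [hd] at h
      exact hZ0 z hz (a - d) (by rw [sub_smul, ← h]; abel))
    (by
      intro w hw w' hw' hne
      obtain ⟨z, hz, rfl⟩ := Finset.mem_image.1 hw
      obtain ⟨z', hz', rfl⟩ := Finset.mem_image.1 hw'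
      exact hFp z hz z' hz' (by rintro rfl; exact hne rfl))
  rw [Finset.card_image_of_injOn hinj] at this
  omega

end TM
end

section
namespace TM
variable {r : ℕ} {V : Type} [AddCommGroup V] [Module ℚ V]
open Module

theorem Cfg.Odd.par_pm {C : Cfg r V} {b : Basis (Fin r) ℚ V} {J : Finset (Fin r)} (hO : C.Odd b J)
    {x y : V} (hx : x ∈ C.S) (hy : y ∈ C.S) (hyT : y ∉ T b J) {a : ℚ} (h : y - a • x ∈ T b J) :
    a = 1 ∨ a = -1 := by
  obtain ⟨k, hk, hk0⟩ := exists_out hyT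
  have e := mem_T.1 h k hk
  simp only [map_sub, map_smul, Finsupp.sub_apply, Finsupp.smul_apply, smul_eq_mul] at e
  rcases hO.outer hy hk with h1 | h1 | h1 <;> rcases hO.outer hx hk with h2 | h2 | h2 <;>
    rw [h1, h2] at e
  · exact absurd h1 hk0
  · exact absurd h1 hk0
  · exact absurd h1 hk0
  · norm_num at e
  · left; linarith
  · right; linarith
  · norm_num at e
  · right; linarith
  · left; linarith

theorem notT_of_par {b : Basis (Fin r) ℚ V} {J : Finset (Fin r)} {x y : V} (hy : y ∉ T b J)
    {a : ℚ} (h : y - a • x ∈ T b J) : x ∉ T b J := by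
  intro hx
  apply hy
  have := add_mem h ((T b J).smul_mem a hx)
  simpa using this

theorem Cfg.contract3 (C : Cfg (r + 1) V) (b : Basis (Fin (r + 1)) ℚ V) (J : Finset (Fin (r + 1)))
    (hO : C.Odd b J) (i : Fin (r + 1)) (hi : i ∈ J)
    (K : Finset V) (hK : K ⊆ C.X) (hK0 : ∀ k ∈ K, ∀ a : ℚ, k ≠ a • b i)
    (hKp : ∀ k ∈ K, ∀ k' ∈ K, k ≠ k' → ∀ a c : ℚ, k' ≠ a • k + c • b i)
    (hβ : ∀ x ∈ C.S, ∀ y ∈ C.S, x ∉ T b J → ∀ β : ℚ, y - x = β • b i → ∃ k : ℤ, β = k) :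
    ∃ (C' : Cfg r (Fin r → ℚ)) (Y ZT W0 Rest : Finset V) (wf df : V → V),
      C.X.card ≤ C'.X.card + 1 + (ZT.card + W0.card + Rest.card) ∧
      (Y ⊆ C.X ∧ K ⊆ Y ∧ (∀ y ∈ Y, ∀ a : ℚ, y ≠ a • b i) ∧
      (∀ y ∈ Y, ∀ y' ∈ Y, y ≠ y' → ∀ a c : ℚ, y' ≠ a • y + c • b i)) ∧
      (ZT ⊆ C.X ∧ ∀ z ∈ ZT, z ∈ T b J ∧ z ∉ Y ∧ (∀ a : ℚ, z ≠ a • b i) ∧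
        ∃ y ∈ Y, ∃ a c : ℚ, a ≠ 0 ∧ c ≠ 0 ∧ z = a • y + c • b i) ∧
      ((∀ w ∈ W0, w ∈ C.S ∧ w + b i ∈ C.S ∧ w ∉ T b J) ∧
        (∀ w ∈ W0, ∀ w' ∈ W0, w ≠ w' → ∀ a : ℚ, w' - a • w ∉ T b J) ∧
        W0.card + J.card ≤ r + 1) ∧
      ((∀ ρ ∈ Rest, wf ρ ∈ W0 ∧ df ρ ∈ T b J ∧ df ρ ≠ 0 ∧ b.repr (df ρ) i = 0 ∧
          wf ρ + df ρ ∈ C.S ∧ wf ρ + df ρ + b i ∈ C.S) ∧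
        (∀ ρ ∈ Rest, ∀ ρ' ∈ Rest, ρ ≠ ρ' → wf ρ = wf ρ' → df ρ ≠ df ρ')) ∧
      ∀ J, C.Odd b J → (∀ j ∈ J, j ≠ i → b j ∈ K ∨ -b j ∈ K) →
        ∃ B' J', C'.Odd B' J' ∧ J'.card ≤ (J.erase i).card := by
  classical
  obtain ⟨C', Y, Z, hcard, hY, hZ, hKY, hY0, hYp, hZY, hZ0, hZl, hodd⟩ :=
    C.contract2 b hO.1 i K hK hK0 hKp
  set v := b i with hv
  have hvT : v ∈ T b J := B_mem_T b hi
  have hvv : b.repr v i = 1 := by simp [hv]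
  let Zo := Z.filter fun z => z ∉ T b J
  have hZoZ : ∀ z ∈ Zo, z ∈ Z ∧ z ∉ T b J := fun z hz => Finset.mem_filter.1 hz
  have hl : ∀ z ∈ Zo, ∃ y ∈ Y, ∃ a c : ℚ, (a = 1 ∨ a = -1) ∧ (c = 1 ∨ c = -1) ∧
      z = a • y + c • v := by
    intro z hz
    obtain ⟨hzZ, hzT⟩ := hZoZ z hz
    obtain ⟨y, hy, a, c, ha, hc, h⟩ := hZl z hzZ
    have hzS := Cfg.S_of_X (hZ hzZ)
    have hyS := Cfg.S_of_X (hY hy)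
    have hd : z - a • y = c • v := by rw [h]; abel
    have hdT : z - a • y ∈ T b J := by rw [hd]; exact (T b J).smul_mem _ hvT
    have ha1 := hO.par_pm hyS hzS hzT hdT
    refine ⟨y, hy, a, c, ha1, ?_, h⟩
    have hayS : a • y ∈ C.S := by
      rcases ha1 with rfl | rfl
      · simpa using hyS
      · simpa using Cfg.neg_mem hyS
    have hayT : a • y ∉ T b J := by
      intro hh; apply hzT; have := add_mem hdT hh; simpa using this
    obtain ⟨k, hk⟩ := hβ _ hayS z hzS hayT c hd
    have w1 := hO.width hayS hzS hayT hdT i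
    have w2 := hO.width hzS hayS hzT (by
      have := (T b J).neg_mem hdT; simpa using this) i
    rw [hd] at w1
    have hd' : a • y - z = (-c) • v := by rw [neg_smul, ← hd]; abel
    rw [hd'] at w2
    simp only [map_smul, Finsupp.smul_apply, hvv, smul_eq_mul, mul_one] at w1 w2
    rw [hk] at w1 w2 hc ⊢
    have hk1 : k ≤ 1 := by exact_mod_cast w1
    have hk2 : -k ≤ 1 := by exact_mod_cast w2
    have hk3 : k ≠ 0 := by rintro rfl; simp at hc
    have : k = 1 ∨ k = -1 := by omega
    rcases this with rfl | rfl
    · left; simp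
    · right; simp
  have hpair := Cfg.lines_pair (Z := Zo) (fun z hz => hZ (hZoZ z hz).1) hYp hl (by
    intro z hz y hy a c h hb
    have hyT : y ∉ T b J := by
      intro hh; apply (hZoZ z hz).2; rw [h]
      exact add_mem ((T b J).smul_mem _ hh) ((T b J).smul_mem _ hvT)
    have e : y + v - (y - v) = (2 : ℚ) • v := by module
    have := hO.width hb.2 hb.1 (by
      intro hh; apply hyT; have := add_mem hh hvT; simpa using this) (by
      rw [e]; exact (T b J).smul_mem _ hvT) i
    rw [e] at this
    simp only [map_smul, Finsupp.smul_apply, hvv, smul_eq_mul, mul_one] at this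
    norm_num at this)
  let F : V → V := fun z => if z + v ∈ C.S then z else z - v
  have hF : ∀ z, ∃ c : ℚ, F z = z + c • v := by
    intro z
    by_cases h : z + v ∈ C.S
    · exact ⟨0, by simp [F, h]⟩
    · exact ⟨-1, by simp [F, h]; abel⟩
  have hFS : ∀ z ∈ Zo, F z ∈ C.S ∧ F z + v ∈ C.S := by
    intro z hz
    obtain ⟨y, hy, a, c, ha, hc, h⟩ := hl z hz
    have hzS := Cfg.S_of_X (hZ (hZoZ z hz).1)
    by_cases h1 : z + v ∈ C.S
    · simp only [F, h1, if_true]; exact ⟨hzS, trivial⟩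
    · have := (Cfg.line_pm (Cfg.S_of_X (hY hy)) ha hc h).resolve_left h1
      simp only [F, h1, if_false, sub_add_cancel]; exact ⟨this, hzS⟩
  have hFT : ∀ z ∈ Zo, F z ∉ T b J := by
    intro z hz h
    obtain ⟨c, hc⟩ := hF z
    rw [hc] at h
    apply (hZoZ z hz).2
    have := sub_mem h ((T b J).smul_mem c hvT)
    simpa using this
  have hFp : ∀ z ∈ Zo, ∀ z' ∈ Zo, z ≠ z' → ∀ a c : ℚ, F z' ≠ a • F z + c • v := by
    intro z hz z' hz' hne a c h
    obtain ⟨d, hd⟩ := hF z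
    obtain ⟨d', hd'⟩ := hF z'
    rw [hd, hd'] at h
    have e : z' = a • z + (a * d + c - d') • v := by
      have : z' = (z' + d' • v) - d' • v := by abel
      rw [this, h]; module
    by_cases ha : a = 0
    · subst ha; exact hZ0 z' (hZoZ z' hz').1 _ (by rw [zero_smul, zero_add] at e; exact e)
    · exact hpair z hz z' hz' hne a _ ha e
  have hinj : Set.InjOn F Zo := by
    intro z hz z' hz' h
    by_contra hne
    exact hFp z hz z' hz' hne 1 0 (by rw [h]; simp)
  let W := Zo.image F
  have hWcard : W.card = Zo.card := Finset.card_image_of_injOn hinj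
  have hWS : ∀ w ∈ W, w ∈ C.S ∧ w + v ∈ C.S ∧ w ∉ T b J := by
    intro w hw; obtain ⟨z, hz, rfl⟩ := Finset.mem_image.1 hw
    exact ⟨(hFS z hz).1, (hFS z hz).2, hFT z hz⟩
  have hWp : ∀ w ∈ W, ∀ w' ∈ W, w ≠ w' → ∀ a c : ℚ, w' ≠ a • w + c • v := by
    intro w hw w' hw' hne
    obtain ⟨z, hz, rfl⟩ := Finset.mem_image.1 hw
    obtain ⟨z', hz', rfl⟩ := Finset.mem_image.1 hw'
    exact hFp z hz z' hz' (by rintro rfl; exact hne rfl)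
  obtain ⟨W0, hW0W, -, hW0p, hW0c⟩ := exists_transversal W ∅
    (fun w w' => ∃ a : ℚ, a ≠ 0 ∧ w' - a • w ∈ T b J) (by
      rintro x y ⟨a, ha, h⟩
      refine ⟨a⁻¹, inv_ne_zero ha, ?_⟩
      have := (T b J).smul_mem (-a⁻¹) h
      convert this using 1
      rw [smul_sub, smul_smul, neg_mul, inv_mul_cancel₀ ha]; module) (by simp) (by simp)
  have hrest : ∀ ρ ∈ W \ W0, ∃ w ∈ W0, ∃ d ∈ T b J, d ≠ 0 ∧ b.repr d i = 0 ∧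
      w + d ∈ C.S ∧ w + d + v ∈ C.S ∧ (ρ = w + d ∨ ρ = -(w + d) - v) := by
    intro ρ hρ
    obtain ⟨hρW, hρ0⟩ := Finset.mem_sdiff.1 hρ
    obtain ⟨w, hw, a, ha0, ha⟩ := (hW0c ρ hρW).resolve_left hρ0
    obtain ⟨hρS, hρv, hρT⟩ := hWS ρ hρW
    obtain ⟨hwS, hwv, hwT⟩ := hWS w (hW0W hw)
    have hne : ρ ≠ w := by rintro rfl; exact hρ0 hw
    have main : ∀ ρ' ∈ C.S, ρ' + v ∈ C.S → ρ' ∉ T b J → ρ' - w ∈ T b J → b.repr (ρ' - w) i = 0 := by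
      intro ρ' h1 h2 h3 h4
      have e1 : ρ' + v - w = (ρ' - w) + v := by abel
      have e2 : w + v - ρ' = -(ρ' - w) + v := by abel
      have w1 := hO.width hwS h2 hwT (by rw [e1]; exact add_mem h4 hvT) i
      have w2 := hO.width h1 hwv h3 (by rw [e2]; exact add_mem ((T b J).neg_mem h4) hvT) i
      rw [e1] at w1; rw [e2] at w2
      rw [map_add, Finsupp.add_apply, hvv] at w1 w2
      rw [map_neg, Finsupp.neg_apply] at w2
      linarith
    rcases hO.par_pm hρS hwS hwT ha with rfl | rfl
    · have h4 : ρ - w ∈ T b J := by have := (T b J).neg_mem ha; simpa using this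
      refine ⟨w, hw, ρ - w, h4, sub_ne_zero.2 hne, main ρ hρS hρv hρT h4, ?_, ?_, ?_⟩
      · simpa using hρS
      · simpa using hρv
      · left; abel
    · have h4 : (-ρ - v) - w ∈ T b J := by
        have := (T b J).neg_mem (add_mem ha hvT)
        convert this using 1; module
      have hS1 : -ρ - v ∈ C.S := by
        have := Cfg.neg_mem hρv; convert this using 1; abel
      refine ⟨w, hw, (-ρ - v) - w, h4, ?_, main _ hS1 ?_ ?_ h4, ?_, ?_, ?_⟩
      · intro h0
        exact hWp ρ hρW w (hW0W hw) hne (-1) (-1) (by rw [← sub_eq_zero.1 h0]; module)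
      · simpa using Cfg.neg_mem hρS
      · intro hh; apply hρT
        have := (T b J).neg_mem (add_mem hh hvT); simpa using this
      · simpa using hS1
      · simpa using Cfg.neg_mem hρS
      · right; abel
  choose! wf hwf df hdT hd0 hdi hdS hdv hρ using hrest
  refine ⟨C', Y, Z.filter fun z => z ∈ T b J, W0, W \ W0, wf, df, ?_, ⟨hY, hKY, hY0, hYp⟩,
    ⟨?_, ?_⟩, ⟨fun w hw => hWS w (hW0W hw), ?_, ?_⟩, ⟨?_, ?_⟩, hodd⟩
  · have h1 := Finset.card_sdiff_add_card_eq_card hW0W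
    have h2 : (Z.filter fun z => z ∈ T b J).card + Zo.card = Z.card :=
      Finset.card_filter_add_card_filter_not _
    omega
  · exact (Finset.filter_subset _ _).trans hZ
  · intro z hz
    obtain ⟨h1, h2⟩ := Finset.mem_filter.1 hz
    exact ⟨h2, hZY z h1, hZ0 z h1, hZl z h1⟩
  · intro w hw w' hw' hne a h
    refine hW0p w hw w' hw' hne ⟨a, ?_, h⟩
    rintro rfl
    exact (hWS w' (hW0W hw')).2.2 (by simpa using h)
  · apply hO.L1_card i W0 (fun w hw => (hWS w (hW0W hw)).1) (fun w hw => (hWS w (hW0W hw)).2.2)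
    · intro w hw
      obtain ⟨h1, h2, h3⟩ := hWS w (hW0W hw)
      refine ⟨w, h1, w + v, h2, by simp, by simpa using hvT, ?_⟩
      rw [add_sub_cancel_left, hvv]
    · intro w hw w' hw' hne a h
      refine hW0p w hw w' hw' hne ⟨a, ?_, h⟩
      rintro rfl
      exact (hWS w' (hW0W hw')).2.2 (by simpa using h)
  · intro ρ h
    exact ⟨hwf ρ h, hdT ρ h, hd0 ρ h, hdi ρ h, hdS ρ h, hdv ρ h⟩
  · intro ρ h ρ' h' hne hw hd
    have e1 := hρ ρ h
    have e2 := hρ ρ' h'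
    rw [← hw, ← hd] at e2
    have hp := hWp ρ (Finset.mem_sdiff.1 h).1 ρ' (Finset.mem_sdiff.1 h').1 hne
    rcases e1 with e1 | e1 <;> rcases e2 with e2 | e2
    · exact hne (e1.trans e2.symm)
    · exact hp (-1) (-1) (by rw [e2, ← e1]; module)
    · exact hp (-1) (-1) (by rw [e1, ← e2]; module)
    · exact hne (e1.trans e2.symm)

end TM
end

section
namespace TM
variable {r : ℕ} {V : Type} [AddCommGroup V] [Module ℚ V]
open Module

section
variable {C : Cfg r V} {B b : Basis (Fin r) ℚ V} {J : Finset (Fin r)}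

theorem Cfg.Odd.ext (hO : C.Odd b J) {x : V} (hx : x ∈ C.S) (hxT : x ∉ T b J) :
    ∃ (b' : Basis (Fin r) ℚ V) (i : Fin r), i ∉ J ∧ b' i = x ∧ C.JFr b J b' ∧
      C.Odd b' (insert i J) := by
  obtain ⟨i, hi, h0⟩ := exists_out hxT
  obtain ⟨b', hb', h1, _⟩ := hO.jfr.pivot hx hi h0
  exact ⟨b', i, hi, h1, hb', (hb'.odd hO).mono (Finset.subset_insert _ _)⟩

theorem mem_T_insert {i : Fin r} {x : V} (hx : x ∈ T b (insert i J)) :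
    ∃ a : ℚ, x - a • b i ∈ T b J := by
  classical
  refine ⟨b.repr x i, mem_T.2 fun k hk => ?_⟩
  by_cases hki : k = i
  · subst hki; simp
  · rw [map_sub, Finsupp.sub_apply, mem_T.1 hx k (by simp [hki, hk])]
    simp [Ne.symm hki]

theorem T_insert_of {i : Fin r} {x : V} {a : ℚ} (hx : x - a • b i ∈ T b J) :
    x ∈ T b (insert i J) := by
  have h1 := T_mono b (Finset.subset_insert i J) hx
  have h2 := (T b (insert i J)).smul_mem a (B_mem_T b (Finset.mem_insert_self i J))
  have := add_mem h1 h2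
  simpa using this

theorem mem_T_single {i : Fin r} {x : V} : x ∈ T b {i} ↔ ∃ a : ℚ, x = a • b i := by
  constructor
  · intro h; have := sum_T h; rw [Finset.sum_singleton] at this; exact ⟨_, this⟩
  · rintro ⟨a, rfl⟩; exact (T b {i}).smul_mem _ (B_mem_T b (by simp))

theorem par_symm {x y : V} (hx : x ∉ T b J) {a : ℚ} (h : x - a • y ∈ T b J) :
    y - a⁻¹ • x ∈ T b J := by
  have ha : a ≠ 0 := by rintro rfl; exact hx (by simpa using h)
  have := (T b J).smul_mem (-a⁻¹) h
  convert this using 1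
  rw [smul_sub, smul_smul, neg_mul, inv_mul_cancel₀ ha]; module

theorem dim_le (f : Basis (Fin r) ℚ V) {I : Finset (Fin r)} (h : ∀ i ∈ I, b i ∈ T f J) :
    I.card ≤ J.card := by
  classical
  have : Module.Finite ℚ V := Module.Finite.of_basis b
  let g : I → T f J := fun i => ⟨b i, h i i.2⟩
  have hg : LinearIndependent ℚ g := by
    apply LinearIndependent.of_comp (T f J).subtype
    exact b.linearIndependent.comp (fun i : I => (i : Fin r)) Subtype.val_injective
  have h1 := hg.fintype_card_le_finrank
  have h2 : finrank ℚ (T f J) ≤ J.card := by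
    have e : T f J = Submodule.span ℚ ((J.image f : Finset V) : Set V) := by
      unfold T; rw [Finset.coe_image]
    rw [e]
    exact (finrank_span_finset_le_card _).trans Finset.card_image_le
  simpa using h1.trans h2

variable {j0 : Fin r}

theorem Cfg.Odd.gam (hO : C.Odd B {j0}) {x : V} (hx : x ∈ C.S) (hxT : x ∉ T B {j0}) {g : ℚ}
    (h : x + g • B j0 ∈ C.S) : g = 0 ∨ g = 1 / 2 ∨ g = -1 / 2 ∨ g = 1 ∨ g = -1 := by
  have hgT : ∀ g : ℚ, g • B j0 ∈ T B {j0} := fun g => mem_T_single.2 ⟨g, rfl⟩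
  have w1 := hO.width hx h hxT (by rw [add_sub_cancel_left]; exact hgT g) j0
  have w2 := hO.width h hx (by
    intro hh; apply hxT; have := sub_mem hh (hgT g); simpa using this)
    (by have := hgT (-g); convert this using 1; module) j0
  obtain ⟨z1, h1, _⟩ := hO.coord hx j0
  obtain ⟨z2, h2, _⟩ := hO.coord h j0
  have e : B.repr (x + g • B j0) j0 = B.repr x j0 + g := by simp
  rw [map_sub, Finsupp.sub_apply, e] at w1 w2
  rw [e, h1] at h2
  have hg : g = ((z2 - z1 : ℤ) : ℚ) / 2 := by push_cast; linarith
  generalize z2 - z1 = k at hg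
  have k1 : (k : ℚ) ≤ 2 := by linarith
  have k2 : (-2 : ℚ) ≤ k := by linarith
  have k1' : k ≤ 2 := by exact_mod_cast k1
  have k2' : -2 ≤ k := by exact_mod_cast k2
  rw [hg]
  interval_cases k <;> norm_num

theorem notT_add {x : V} (hx : x ∉ T B {j0}) (g : ℚ) : x + g • B j0 ∉ T B {j0} := by
  intro h
  apply hx
  have := sub_mem h (mem_T_single.2 ⟨g, rfl⟩ : g • B j0 ∈ T B {j0})
  simpa using this

/-- in case (ii) widths are at most one half -/
theorem Cfg.Odd.gam2 (hO : C.Odd B {j0})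
    (hii : ∀ x ∈ C.S, x ∉ T B {j0} → x + B j0 ∉ C.S) {x : V} {p q : ℚ}
    (hxT : x ∉ T B {j0}) (hp : x + p • B j0 ∈ C.S)
    (hq : x + q • B j0 ∈ C.S) : |q - p| ≤ 1 / 2 := by
  have e : x + p • B j0 + (q - p) • B j0 ∈ C.S := by convert hq using 1; module
  rcases hO.gam hp (notT_add hxT p) e with h | h | h | h | h
  · rw [h]; norm_num
  · rw [h]; norm_num
  · rw [h]; norm_num [abs_of_neg]
  · exact absurd (by rw [h, one_smul] at e; exact e) (hii _ hp (notT_add hxT p))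
  · exfalso
    apply hii _ hq (notT_add hxT q)
    convert hp using 1
    have : p = q + 1 := by linarith
    rw [this]; module

open Classical in
noncomputable def Cfg.Gam (C : Cfg r V) (c v : V) : Finset ℚ :=
  ({1 / 2, -1 / 2, 1, -1} : Finset ℚ).filter fun g => v + g • c ∈ C.S

end

theorem Cfg.t1_contract (C : Cfg (r + 1) V) (B : Basis (Fin (r + 1)) ℚ V) (j0 : Fin (r + 1))
    (hO : C.Odd B {j0}) {v : V} (hv : v ∈ C.S) (hvT : v ∉ T B {j0}) :
    ∃ (C' : Cfg r (Fin r → ℚ)), (∃ B' J', C'.Odd B' J' ∧ J'.card ≤ 1) ∧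
    ∃ (b : Basis (Fin (r + 1)) ℚ V) (i : Fin (r + 1)) (N : ℕ) (W0 Rest : Finset V) (wf : V → V)
      (gf : V → ℚ), i ≠ j0 ∧ C.JFr B {j0} b ∧ b i = v ∧
      C.X.card ≤ C'.X.card + 1 + (N + W0.card + Rest.card) ∧ N ≤ (C.Gam (B j0) v).card ∧
      ((∀ w ∈ W0, w ∈ C.S ∧ w + v ∈ C.S ∧ w ∉ T b {i, j0}) ∧
        (∀ w ∈ W0, ∀ w' ∈ W0, w ≠ w' → ∀ a : ℚ, w' - a • w ∉ T b {i, j0}) ∧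
        W0.card + 2 ≤ r + 1) ∧
      ((∀ ρ ∈ Rest, wf ρ ∈ W0 ∧ gf ρ ≠ 0 ∧ wf ρ + gf ρ • B j0 ∈ C.S ∧
          wf ρ + gf ρ • B j0 + v ∈ C.S) ∧
        (∀ ρ ∈ Rest, ∀ ρ' ∈ Rest, ρ ≠ ρ' → wf ρ = wf ρ' → gf ρ ≠ gf ρ')) := by
  classical
  obtain ⟨b, i, hi, hbi, hb, hO2⟩ := hO.ext hv hvT
  have hij : i ≠ j0 := by simpa using hi
  have hbj : b j0 = B j0 := hb.2 j0 (by simp)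
  have hOb := hb.odd hO
  obtain ⟨s, hs, hsX⟩ := Cfg.exists_X (hO.1 j0)
  have hs0 : s ≠ 0 := by rcases hs with rfl | rfl <;> norm_num
  obtain ⟨C', Y, ZT, W0, Rest, wf, df, hcard, ⟨hY, hKY, hY0, hYp⟩, ⟨hZT, hZT'⟩, ⟨hW, hWp, hWc⟩,
    ⟨hR, hRi⟩, hodd⟩ := C.contract3 b _ hO2 i (by simp) {s • B j0} (by simpa using hsX)
    (by
      intro k hk a h
      rw [Finset.mem_singleton.1 hk, ← hbj] at h
      have := congrArg (fun x => b.repr x j0) h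
      simp [hij] at this
      exact hs0 this)
    (by
      intro k hk k' hk' hne
      rw [Finset.mem_singleton] at hk hk'
      exact absurd (hk.trans hk'.symm) hne)
    (by
      intro x hx y hy _ β h
      have := congrArg (fun x => b.repr x i) h
      simp at this
      rcases hOb.outer hx (i := i) (by simpa using hij) with h1 | h1 | h1 <;>
      rcases hOb.outer hy (i := i) (by simpa using hij) with h2 | h2 | h2 <;>
      rw [h1, h2] at this
      · exact ⟨0, by rw [← this]; norm_num⟩
      · exact ⟨1, by rw [← this]; norm_num⟩
      · exact ⟨-1, by rw [← this]; norm_num⟩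
      · exact ⟨-1, by rw [← this]; norm_num⟩
      · exact ⟨0, by rw [← this]; norm_num⟩
      · exact ⟨-2, by rw [← this]; norm_num⟩
      · exact ⟨1, by rw [← this]; norm_num⟩
      · exact ⟨2, by rw [← this]; norm_num⟩
      · exact ⟨0, by rw [← this]; norm_num⟩)
  have hcardJ : (insert i ({j0} : Finset (Fin (r + 1)))).card = 2 := Finset.card_pair hij
  refine ⟨C', ?_, b, i, ZT.card, W0, Rest, wf, fun ρ => b.repr (df ρ) j0, hij, hb, hbi, hcard,
    ?_, ⟨?_, hWp, ?_⟩, ⟨?_, ?_⟩⟩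
  · obtain ⟨B', J', h1, h2⟩ := hodd {j0} hOb (by
      intro j hj _
      rw [Finset.mem_singleton.1 hj, hbj]
      rcases hs with rfl | rfl
      · left; simp
      · right; simp)
    refine ⟨B', J', h1, h2.trans ((Finset.card_erase_le).trans (by simp))⟩
  · have hform : ∀ z ∈ ZT, ∃ e g : ℚ, (e = 1 ∨ e = -1) ∧ g ≠ 0 ∧ z = e • (v + g • B j0) := by
      intro z hz
      obtain ⟨hzT, hzY, hzv, -⟩ := hZT' z hz
      have hsum := sum_T hzT
      rw [Finset.sum_pair hij, hbi, hbj] at hsum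
      have hzS := Cfg.S_of_X (hZT hz)
      have he : b.repr z i ≠ 0 := by
        intro h0
        rw [h0, zero_smul, zero_add] at hsum
        have := C.np _ hsX z (hZT hz) (b.repr z j0 * s⁻¹) (by
          rw [smul_smul, mul_assoc, inv_mul_cancel₀ hs0, mul_one]; exact hsum)
        exact hzY (hKY (by simp [this]))
      have hg : b.repr z j0 ≠ 0 := by
        intro h0
        rw [h0, zero_smul, add_zero] at hsum
        exact hzv (b.repr z i) (by rw [hbi]; exact hsum)
      have he1 := (hOb.outer hzS (i := i) (by simpa using hij)).resolve_left he
      refine ⟨b.repr z i, b.repr z i * b.repr z j0, he1, mul_ne_zero he hg, ?_⟩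
      conv_lhs => rw [hsum]
      have e2 : b.repr z i * b.repr z i = 1 := by rcases he1 with h | h <;> rw [h] <;> norm_num
      rw [smul_add, smul_smul, ← mul_assoc, e2, one_mul]
    choose! e g he hg hz using hform
    apply Finset.card_le_card_of_injOn g
    · intro z hzm
      have hzm' : z ∈ ZT := by simpa using hzm
      have hvg : v + g z • B j0 ∈ C.S := by
        have hzS := Cfg.S_of_X (hZT hzm')
        rw [hz z hzm'] at hzS
        rcases he z hzm' with h | h <;> rw [h] at hzS
        · simpa using hzS
        · have := Cfg.neg_mem hzS
          convert this using 1; module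
      have := (hO.gam hv hvT hvg).resolve_left (hg z hzm')
      simp only [Cfg.Gam, Finset.coe_filter, Set.mem_ofPred_eq, Finset.mem_insert,
        Finset.mem_singleton]
      exact ⟨this, hvg⟩
    · intro z hzm z' hzm' hgg
      have h1 : z ∈ ZT := by simpa using hzm
      have h2 : z' ∈ ZT := by simpa using hzm'
      have e1 := hz z h1
      have e2 := hz z' h2
      rw [← hgg] at e2
      symm
      refine C.np z (hZT h1) z' (hZT h2) (e z' * e z) ?_
      have e3 : v + g z • B j0 = e z • z := by
        have e4 : e z * e z = 1 := by rcases he z h1 with h | h <;> rw [h] <;> norm_num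
        calc v + g z • B j0 = (e z * e z) • (v + g z • B j0) := by rw [e4, one_smul]
          _ = e z • (e z • (v + g z • B j0)) := by rw [smul_smul]
          _ = e z • z := by rw [← e1]
      rw [e3, smul_smul] at e2
      exact e2
  · intro w hw; rw [← hbi]; exact hW w hw
  · rw [hcardJ] at hWc; exact hWc
  · intro ρ hρ
    obtain ⟨h1, h2, h3, h4, h5, h6⟩ := hR ρ hρ
    have hsum := sum_T h2
    rw [Finset.sum_pair hij, h4, zero_smul, zero_add, hbj] at hsum
    refine ⟨h1, ?_, ?_, ?_⟩
    all_goals dsimp only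
    · intro h0; rw [h0, zero_smul] at hsum; exact h3 hsum
    · rw [← hsum]; exact h5
    · rw [← hsum, ← hbi]; exact h6
  · intro ρ hρ ρ' hρ' hne hw hg
    refine hRi ρ hρ ρ' hρ' hne hw ?_
    have hsum := sum_T (hR ρ hρ).2.1
    have hsum' := sum_T (hR ρ' hρ').2.1
    rw [Finset.sum_pair hij, (hR ρ hρ).2.2.2.1, zero_smul, zero_add] at hsum
    rw [Finset.sum_pair hij, (hR ρ' hρ').2.2.2.1, zero_smul, zero_add] at hsum'
    rw [hsum, hsum']
    dsimp only at hg
    rw [hg]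

end TM
end

section
set_option linter.unusedSimpArgs false
set_option linter.unusedVariables false

namespace TM
variable {r : ℕ} {V : Type} [AddCommGroup V] [Module ℚ V]
open Module

section
variable {C : Cfg r V} {B b f : Basis (Fin r) ℚ V} {J : Finset (Fin r)} {j0 : Fin r}

theorem mem_T_pair {i j : Fin r} {x : V} :
    x ∈ T b {i, j} ↔ ∃ a d : ℚ, x = a • b i + d • b j := by
  constructor
  · intro h
    obtain ⟨a, ha⟩ := mem_T_insert h
    obtain ⟨d, hd⟩ := mem_T_single.1 ha
    exact ⟨a, d, by rw [← hd]; module⟩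
  · rintro ⟨a, d, rfl⟩
    exact add_mem ((T b _).smul_mem _ (B_mem_T b (by simp)))
      ((T b _).smul_mem _ (B_mem_T b (by simp)))

def pmhalf (g : ℚ) : Prop := g = 1 / 2 ∨ g = -1 / 2

/-- the four points of a doubled pair -/
def Cfg.D (C : Cfg r V) (c v w : V) (g : ℚ) : Prop :=
  pmhalf g ∧ w ∈ C.S ∧ w + v ∈ C.S ∧ w + g • c ∈ C.S ∧ w + g • c + v ∈ C.S

def Cfg.HW (C : Cfg r V) (c p : V) : Prop :=
  ∃ l h : ℚ, p + l • c ∈ C.S ∧ p + h • c ∈ C.S ∧ h - l = 1 / 2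

theorem hw_of {c p : V} {l h : ℚ} (h1 : p + l • c ∈ C.S) (h2 : p + h • c ∈ C.S)
    (hg : pmhalf (h - l)) : C.HW c p := by
  rcases hg with hg | hg
  · exact ⟨l, h, h1, h2, hg⟩
  · exact ⟨h, l, h2, h1, by linarith⟩

theorem hw_of' {c p : V} {g : ℚ} (h1 : p ∈ C.S) (h2 : p + g • c ∈ C.S)
    (hg : pmhalf g) : C.HW c p :=
  hw_of (l := 0) (h := g) (by simpa using h1) h2 (by simpa using hg)

theorem Cfg.Odd.five0 (hO : C.Odd B {j0}) (hf : C.JFr B {j0} f) {i1 i2 i3 i4 : Fin r}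
    (h1 : i1 ≠ j0) (h2 : i2 ≠ j0) (h3 : i3 ≠ j0) (h4 : i4 ≠ j0) (h12 : i1 ≠ i2) (h13 : i1 ≠ i3)
    (h14 : i1 ≠ i4) (h23 : i2 ≠ i3) (h24 : i2 ≠ i4) (h34 : i3 ≠ i4)
    (w1 : C.HW (B j0) (f i1)) (w2 : C.HW (B j0) (f i2)) (w3 : C.HW (B j0) (f i3))
    (w4 : C.HW (B j0) (f i4)) {y : V} (hy : C.HW (B j0) y)
    (y1 : |f.repr y i1| = 1) (y2 : |f.repr y i2| = 1) (y3 : |f.repr y i3| = 1)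
    (y4 : |f.repr y i4| = 1) : False := by
  classical
  have hI : ∀ i ∈ ({i1, i2, i3, i4} : Finset (Fin r)), C.HW (B j0) (f i) := by
    intro i hi
    simp only [Finset.mem_insert, Finset.mem_singleton] at hi
    rcases hi with rfl | rfl | rfl | rfl <;> assumption
  have hIj : ∀ i ∈ ({i1, i2, i3, i4} : Finset (Fin r)), i ∉ ({j0} : Finset (Fin r)) := by
    intro i hi
    simp only [Finset.mem_insert, Finset.mem_singleton] at hi ⊢
    rcases hi with rfl | rfl | rfl | rfl <;> assumption
  choose! l h hl hh hlh using hI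
  obtain ⟨p, q, hp, hq, hpq⟩ := hy
  have hT : ∀ g : ℚ, g • B j0 ∈ T B {j0} := fun g => mem_T_single.2 ⟨g, rfl⟩
  have hfj : f j0 = B j0 := hf.2 j0 (by simp)
  have hrepr : ∀ i, i ≠ j0 → f.repr (y + p • B j0) i = f.repr y i := by
    intro i hi
    rw [← hfj]; simp [Ne.symm hi]
  have := hO.range hf hp hq (by convert hT (q - p) using 1; module) {i1, i2, i3, i4} hIj
    (fun i => f i + l i • B j0) (fun i => f i + h i • B j0) hl hh
    (fun i _ => by rw [add_sub_cancel_left]; exact hT _)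
    (fun i _ => by rw [add_sub_cancel_left]; exact hT _) j0
  have e1 : B.repr (y + q • B j0 - (y + p • B j0)) j0 = 1 / 2 := by
    rw [show y + q • B j0 - (y + p • B j0) = (q - p) • B j0 by module, hpq]; simp
  have e2 : ∀ i ∈ ({i1, i2, i3, i4} : Finset (Fin r)), |f.repr (y + p • B j0) i| *
      B.repr (f i + h i • B j0 - (f i + l i • B j0)) j0 = 1 / 2 := by
    intro i hi
    rw [show f i + h i • B j0 - (f i + l i • B j0) = (h i - l i) • B j0 by module, hlh i hi,
      hrepr i (by simpa using hIj i hi)]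
    have : |f.repr y i| = 1 := by
      simp only [Finset.mem_insert, Finset.mem_singleton] at hi
      rcases hi with rfl | rfl | rfl | rfl <;> assumption
    rw [this]; simp
  rw [e1, Finset.sum_congr rfl e2, Finset.sum_const] at this
  have hc : ({i1, i2, i3, i4} : Finset (Fin r)).card = 4 := by
    rw [Finset.card_insert_of_notMem (by simp [h12, h13, h14]),
      Finset.card_insert_of_notMem (by simp [h23, h24]), Finset.card_pair h34]
  rw [hc] at this
  norm_num at this

theorem Cfg.Odd.five (hO : C.Odd B {j0}) (hf : C.JFr B {j0} f) {i1 i2 i3 i4 : Fin r}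
    (h1 : i1 ≠ j0) (h2 : i2 ≠ j0) (h3 : i3 ≠ j0) (h4 : i4 ≠ j0) (h12 : i1 ≠ i2) (h13 : i1 ≠ i3)
    (h14 : i1 ≠ i4) (h23 : i2 ≠ i3) (h24 : i2 ≠ i4) (h34 : i3 ≠ i4) {g1 g2 g4 ε : ℚ}
    (d1 : C.D (B j0) (f i1) (f i2) g1) (d2 : C.D (B j0) (f i1) (f i3) g2)
    (d4 : C.D (B j0) (f i2 + ε • B j0) (f i4) g4) : False := by
  have hfj : f j0 = B j0 := hf.2 j0 (by simp)
  obtain ⟨a1, a2, a3, a4, a5⟩ := d1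
  obtain ⟨b1, b2, b3, b4, b5⟩ := d2
  obtain ⟨c1, c2, c3, c4, c5⟩ := d4
  obtain ⟨f', hf', e1, e2⟩ := hf.pivot (x := f i2 + f i1) a3 (i := i1) (by simpa using h1)
    (by simp [h12.symm])
  have hfj' : f' j0 = B j0 := hf'.2 j0 (by simp)
  obtain ⟨f2, hf2, e3, e4⟩ := hf'.pivot (x := f i4 + (f i2 + ε • B j0)) c3 (i := i2)
    (by simpa using h2) (by
      rw [← hfj', ← e2 i4 h14.symm, ← e2 i2 h12.symm]; simp [h24.symm, h2.symm])
  have hfj2 : f2 j0 = B j0 := hf2.2 j0 (by simp)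
  have k1 : f2 i1 = f i2 + f i1 := by rw [e4 _ h12, e1]
  have k3 : f2 i3 = f i3 := by rw [e4 _ h23.symm, e2 _ h13.symm]
  have k4 : f2 i4 = f i4 := by rw [e4 _ h24.symm, e2 _ h14.symm]
  have ky : f i3 + f i1 = f2 i3 + f2 i1 - f2 i2 + f2 i4 + ε • f2 j0 := by
    rw [k1, e3, k3, k4, hfj2]; module
  refine hO.five0 hf2 h1 h2 h3 h4 h12 h13 h14 h23 h24 h34 (y := f i3 + f i1) ?_ ?_ ?_ ?_ ?_ ?_ ?_ ?_ ?_
  · rw [k1]; exact hw_of' a3 (by convert a5 using 1; module) a1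
  · rw [e3]; exact hw_of' c3 (by convert c5 using 1; module) c1
  · rw [k3]; exact hw_of' b2 b4 b1
  · rw [k4]; exact hw_of' c2 c4 c1
  · exact hw_of' b3 (by convert b5 using 1; module) b1
  all_goals rw [ky]
  · simp [h12, h13, h14, h1, h12.symm, h13.symm, h14.symm, h1.symm]
  · simp [h12, h23, h24, h2, h12.symm, h23.symm, h24.symm, h2.symm]
  · simp [h13, h23, h34, h3, h13.symm, h23.symm, h34.symm, h3.symm]
  · simp [h14, h24, h34, h4, h14.symm, h24.symm, h34.symm, h4.symm]

theorem Cfg.Odd.nonpar (hO : C.Odd B {j0})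
    (hii : ∀ x ∈ C.S, x ∉ T B {j0} → x + B j0 ∉ C.S) (hf : C.JFr B {j0} f) {i2 : Fin r}
    (h2 : i2 ≠ j0) {γ g1 g3 : ℚ} (hγ : γ ≠ 0) {x1 x3 : V}
    (d1 : C.D (B j0) (f i2) x1 g1) (d3 : C.D (B j0) (f i2 + γ • B j0) x3 g3)
    (hx1 : x1 ∉ T f {j0, i2})
    (hx3 : x3 ∉ T f {j0, i2}) (a : ℚ) : x3 - a • x1 ∉ T f {j0, i2} := by
  classical
  intro hp
  have hfj : f j0 = B j0 := hf.2 j0 (by simp)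
  have hOf : C.Odd f {j0, i2} := (hf.odd hO).mono (by simp)
  have ha := hOf.par_pm d1.2.1 d3.2.1 hx3 hp
  -- reduce to a = 1
  obtain ⟨x, g, hx, d⟩ : ∃ x g, x - x1 ∈ T f {j0, i2} ∧ C.D (B j0) (f i2 + γ • B j0) x g := by
    rcases ha with rfl | rfl
    · exact ⟨x3, g3, by simpa using hp, d3⟩
    · obtain ⟨c1, c2, c3, c4, c5⟩ := d3
      refine ⟨-(x3 + (f i2 + γ • B j0)), -g3, ?_, ?_, Cfg.neg_mem c3, ?_, ?_, ?_⟩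
      · obtain ⟨p, q, h⟩ := mem_T_pair.1 hp
        refine mem_T_pair.2 ⟨-p - γ, -q - 1, ?_⟩
        have : x3 = -x1 + p • f j0 + q • f i2 := by
          rw [add_assoc, ← h]; module
        rw [this, hfj]; module
      · rcases c1 with h | h
        · right; rw [h]; norm_num
        · left; rw [h]; norm_num
      · convert Cfg.neg_mem c2 using 1; module
      · convert Cfg.neg_mem c5 using 1; module
      · convert Cfg.neg_mem c4 using 1; module
  obtain ⟨p, q, h⟩ := mem_T_pair.1 hx
  have hx' : x = x1 + p • f j0 + q • f i2 := by rw [add_assoc, ← h]; module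
  obtain ⟨a1, a2, a3, a4, a5⟩ := d1
  obtain ⟨c1, c2, c3, c4, c5⟩ := d
  have w1 := hOf.width a2 c3 hx1 (mem_T_pair.2 ⟨p + γ, q + 1, by rw [hx', ← hfj]; module⟩) i2
  have hxT : x ∉ T f {j0, i2} := fun hh => hx1 (by simpa using sub_mem hh hx)
  have w2 := hOf.width c2 a3 hxT (mem_T_pair.2 ⟨-p, 1 - q, by rw [hx']; module⟩) i2
  rw [hx', ← hfj] at w1
  rw [hx'] at w2
  simp [h2, h2.symm] at w1 w2
  have hq : q = 0 := by linarith
  subst hq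
  rw [zero_smul, add_zero, hfj] at hx'
  subst hx'
  have t1 : x1 ∉ T B {j0} := by
    intro hh
    obtain ⟨s, hs⟩ := mem_T_single.1 hh
    exact hx1 (mem_T_pair.2 ⟨s, 0, by rw [hs, hfj]; module⟩)
  have t2 : x1 + f i2 ∉ T B {j0} := by
    intro hh
    obtain ⟨s, hs⟩ := mem_T_single.1 hh
    refine hx1 (mem_T_pair.2 ⟨s, -1, ?_⟩)
    rw [hfj, ← hs]; module
  have m1 : x1 + (0 : ℚ) • B j0 ∈ C.S := by simpa using a2
  have m3 : x1 + (p + g) • B j0 ∈ C.S := by convert c4 using 1; module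
  have u1 := _root_.abs_le.1 (hO.gam2 hii t1 m1 c2)
  have u2 := _root_.abs_le.1 (hO.gam2 hii t1 m1 m3)
  have u3 := _root_.abs_le.1 (hO.gam2 hii t1 a4 c2)
  have u4 := _root_.abs_le.1 (hO.gam2 hii t1 a4 m3)
  have n1 : x1 + f i2 + (0 : ℚ) • B j0 ∈ C.S := by simpa using a3
  have n2 : x1 + f i2 + g1 • B j0 ∈ C.S := by convert a5 using 1; module
  have n3 : x1 + f i2 + (p + γ) • B j0 ∈ C.S := by convert c3 using 1; module
  have n4 : x1 + f i2 + (p + γ + g) • B j0 ∈ C.S := by convert c5 using 1; module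
  have v1 := _root_.abs_le.1 (hO.gam2 hii t2 n1 n3)
  have v2 := _root_.abs_le.1 (hO.gam2 hii t2 n1 n4)
  have v3 := _root_.abs_le.1 (hO.gam2 hii t2 n2 n3)
  have v4 := _root_.abs_le.1 (hO.gam2 hii t2 n2 n4)
  apply hγ
  rcases a1 with rfl | rfl <;> rcases c1 with rfl | rfl <;> linarith [u1.1, u1.2, u2.1, u2.2, u3.1, u3.2, u4.1, u4.2, v1.1, v1.2, v2.1, v2.2, v3.1, v3.2, v4.1, v4.2]

end

end TM
end

section
set_option linter.unusedSimpArgs false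

namespace TM
variable {r : ℕ} {V : Type} [AddCommGroup V] [Module ℚ V]
open Module

section
variable {C : Cfg r V} {B b f : Basis (Fin r) ℚ V} {J : Finset (Fin r)} {j0 : Fin r}

theorem Cfg.D.notT_pair {i2 : Fin r} {x v : V} (h : ∀ a b : ℚ, x ≠ a • B j0 + b • v) (hfj : f j0 = B j0)
    {γ : ℚ} (hv : v = f i2 + γ • B j0) : x ∉ T f {j0, i2} := by
  intro hh
  obtain ⟨p, q, hpq⟩ := mem_T_pair.1 hh
  exact h (p - q * γ) q (by rw [hpq, hv, hfj]; module)

theorem Cfg.Odd.caseC (hO : C.Odd B {j0})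
    (hii : ∀ x ∈ C.S, x ∉ T B {j0} → x + B j0 ∉ C.S)
    (hD : ∀ v ∈ C.S, v ∉ T B {j0} → (∃ g, pmhalf g ∧ v + g • B j0 ∈ C.S) →
      ∃ w1 w2 g1 g2, C.D (B j0) v w1 g1 ∧ C.D (B j0) v w2 g2 ∧
        (∀ a b : ℚ, w1 ≠ a • B j0 + b • v) ∧ (∀ a b : ℚ, w2 ≠ a • B j0 + b • v) ∧
        (∀ a b d : ℚ, w2 ≠ a • B j0 + b • v + d • w1))
    {v : V} (hv : v ∈ C.S) (hvT : v ∉ T B {j0}) (hvg : ∃ g, pmhalf g ∧ v + g • B j0 ∈ C.S) :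
    False := by
  classical
  obtain ⟨z1, z2, γ1, γ2, d1, d2, n1, n1', n2⟩ := hD v hv hvT hvg
  have zT : z1 ∉ T B {j0} := by
    intro hh
    obtain ⟨s, hs⟩ := mem_T_single.1 hh
    exact n1 s 0 (by rw [hs]; module)
  obtain ⟨x1, x2, g1, g2, e1, e2, m1, m1', m2⟩ := hD z1 d1.2.1 zT ⟨γ1, d1.1, d1.2.2.2.1⟩
  obtain ⟨x3, -, g3, -, e3, -, m3, -, -⟩ := hD (z1 + γ1 • B j0) d1.2.2.2.1 (notT_add zT _) ⟨-γ1, by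
    rcases d1.1 with h | h
    · right; rw [h]; norm_num
    · left; rw [h]; norm_num, by convert d1.2.1 using 1; module⟩
  have hγ : γ1 ≠ 0 := by rcases d1.1 with h | h <;> rw [h] <;> norm_num
  -- frame
  obtain ⟨f1, i1, hi1, q1, F1, O1⟩ := hO.ext hv hvT
  have c1 : f1 j0 = B j0 := F1.2 j0 (by simp)
  obtain ⟨f2, i2, hi2, q2, F2, O2⟩ := O1.ext (x := z1) d1.2.1 (by
    intro hh
    obtain ⟨p, q, hpq⟩ := mem_T_pair.1 hh
    exact n1 q p (by rw [hpq, q1, c1]; module))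
  have c2 : f2 j0 = B j0 := (F2.2 j0 (by simp)).trans c1
  have q21 : f2 i1 = v := (F2.2 i1 (by simp)).trans q1
  obtain ⟨f, i3, hi3, q3, F3, O3⟩ := O2.ext (x := z2) d2.2.1 (by
    intro hh
    obtain ⟨p, hp⟩ := mem_T_insert hh
    obtain ⟨s, t, hst⟩ := mem_T_pair.1 hp
    refine n2 t s p ?_
    rw [← c2, ← q21, ← q2, sub_eq_iff_eq_add.1 hst]; module)
  have c3 : f j0 = B j0 := (F3.2 j0 (by simp)).trans c2
  have q31 : f i1 = v := (F3.2 i1 (by simp)).trans q21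
  have q32 : f i2 = z1 := (F3.2 i2 (by simp)).trans q2
  simp only [Finset.mem_insert, Finset.mem_singleton, not_or] at hi1 hi2 hi3
  have hf : C.JFr B {j0} f := ⟨F3.1, by
    intro j hj; rw [Finset.mem_singleton.1 hj]; exact c3⟩
  have hbig : ∀ (x : V) (g ε : ℚ), C.D (B j0) (z1 + ε • B j0) x g → x ∈ T f (insert i3 {i2, i1, j0}) := by
    intro x g ε hd
    by_contra hx
    obtain ⟨f', i4, hi4, q4, F4, O4⟩ := O3.ext hd.2.1 hx
    simp only [Finset.mem_insert, Finset.mem_singleton, not_or] at hi4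
    have k1 : f' i1 = v := (F4.2 i1 (by simp)).trans q31
    have k2 : f' i2 = z1 := (F4.2 i2 (by simp)).trans q32
    have k3 : f' i3 = z2 := (F4.2 i3 (by simp)).trans q3
    have k0 : f' j0 = B j0 := (F4.2 j0 (by simp)).trans c3
    refine hO.five (f := f') ⟨F4.1, ?_⟩ (i1 := i1) (i2 := i2) (i3 := i3) (i4 := i4) hi1 hi2.2 hi3.2.2
      hi4.2.2.2 (Ne.symm hi2.1) (Ne.symm hi3.2.1) (Ne.symm hi4.2.2.1) (Ne.symm hi3.1)
      (Ne.symm hi4.2.1) (Ne.symm hi4.1) (g1 := γ1) (g2 := γ2) (g4 := g) (ε := ε) ?_ ?_ ?_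
    · intro j hj; rw [Finset.mem_singleton.1 hj]; exact k0
    · rw [k1, k2]; exact d1
    · rw [k1, k3]; exact d2
    · rw [k2, q4]; exact hd
  have b1 := hbig x1 g1 0 (by simpa using e1)
  have b2 := hbig x2 g2 0 (by simpa using e2)
  have b3 := hbig x3 g3 γ1 e3
  have z10 : z1 = f i2 + (0 : ℚ) • B j0 := by rw [q32]; simp
  have t1 : x1 ∉ T f {j0, i2} := Cfg.D.notT_pair m1 c3 z10
  have t2 : x2 ∉ T f {j0, i2} := Cfg.D.notT_pair m1' c3 z10
  have t3 : x3 ∉ T f {j0, i2} := Cfg.D.notT_pair m3 c3 (by rw [q32])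
  have p12 : ∀ a : ℚ, x2 - a • x1 ∉ T f {j0, i2} := by
    intro a hh
    obtain ⟨p, q, hpq⟩ := mem_T_pair.1 hh
    refine m2 p q a ?_
    rw [← c3, ← q32, sub_eq_iff_eq_add.1 hpq]
  have p13 := hO.nonpar hii hf hi2.2 hγ (by rw [q32]; exact e1) (by rw [q32]; exact e3) t1 t3
  have p23 := hO.nonpar hii hf hi2.2 hγ (by rw [q32]; exact e2) (by rw [q32]; exact e3) t2 t3
  have p21 : ∀ a : ℚ, x1 - a • x2 ∉ T f {j0, i2} := fun a h => p12 _ (par_symm t1 h)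
  have p31 : ∀ a : ℚ, x1 - a • x3 ∉ T f {j0, i2} := fun a h => p13 _ (par_symm t1 h)
  have p32 : ∀ a : ℚ, x2 - a • x3 ∉ T f {j0, i2} := fun a h => p23 _ (par_symm t2 h)
  have hOf : C.Odd f {j0, i2} := (hf.odd hO).mono (by simp)
  have hui : f.repr z1 i2 = 1 := by rw [← q32]; simp
  have hwide : ∀ x u, x ∈ C.S → x + u ∈ C.S → u ∈ T f {j0, i2} → f.repr u i2 = 1 →
      C.Wide f {j0, i2} i2 x := by
    intro x u hx hxu hu h1
    refine ⟨x, hx, x + u, hxu, by simp, by simpa using hu, ?_⟩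
    rw [add_sub_cancel_left, h1]
  have hz1T : z1 ∈ T f {j0, i2} := by rw [← q32]; exact B_mem_T f (by simp)
  have hz1T' : z1 + γ1 • B j0 ∈ T f {j0, i2} := by
    rw [← c3]; exact add_mem hz1T ((T f _).smul_mem _ (B_mem_T f (by simp)))
  have hne : ∀ x y, (∀ a : ℚ, x - a • y ∉ T f {j0, i2}) → x ≠ y := by
    rintro x y h rfl
    exact h 1 (by simp)
  obtain ⟨b, hb, hbi⟩ := hOf.L1 i2 {x1, x2, x3} (by
      intro z hz; simp only [Finset.mem_insert, Finset.mem_singleton] at hz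
      rcases hz with rfl | rfl | rfl
      exacts [e1.2.1, e2.2.1, e3.2.1]) (by
      intro z hz; simp only [Finset.mem_insert, Finset.mem_singleton] at hz
      rcases hz with rfl | rfl | rfl <;> assumption) (by
      intro z hz; simp only [Finset.mem_insert, Finset.mem_singleton] at hz
      rcases hz with rfl | rfl | rfl
      · exact hwide _ _ e1.2.1 e1.2.2.1 hz1T hui
      · exact hwide _ _ e2.2.1 e2.2.2.1 hz1T hui
      · refine hwide _ _ e3.2.1 e3.2.2.1 hz1T' ?_
        rw [← c3, map_add, Finsupp.add_apply, hui]; simp [Ne.symm hi2.2]) (by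
      intro z hz z' hz' hzz
      simp only [Finset.mem_insert, Finset.mem_singleton] at hz hz'
      rcases hz with rfl | rfl | rfl <;> rcases hz' with rfl | rfl | rfl <;>
        first | exact absurd rfl hzz | assumption)
  obtain ⟨k1, hk1, l1⟩ := hbi x1 (by simp)
  obtain ⟨k2, hk2, l2⟩ := hbi x2 (by simp)
  obtain ⟨k3, hk3, l3⟩ := hbi x3 (by simp)
  have k12 : k1 ≠ k2 := by rintro rfl; exact hne _ _ p12 (l2.symm.trans l1)
  have k13 : k1 ≠ k3 := by rintro rfl; exact hne _ _ p13 (l3.symm.trans l1)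
  have k23 : k2 ≠ k3 := by rintro rfl; exact hne _ _ p23 (l3.symm.trans l2)
  simp only [Finset.mem_insert, Finset.mem_singleton, not_or] at hk1 hk2 hk3
  have hdim := dim_le (b := b) (I := {k1, k2, k3, j0, i2}) (J := insert i3 {i2, i1, j0}) f (by
    intro i hi
    simp only [Finset.mem_insert, Finset.mem_singleton] at hi
    rcases hi with rfl | rfl | rfl | rfl | rfl
    · rw [l1]; exact b1
    · rw [l2]; exact b2
    · rw [l3]; exact b3
    · rw [hb.2 _ (by simp)]; exact B_mem_T f (by simp)
    · rw [hb.2 _ (by simp)]; exact B_mem_T f (by simp))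
  have hc5 : ({k1, k2, k3, j0, i2} : Finset (Fin r)).card = 5 := by
    rw [Finset.card_insert_of_notMem (by simp [k12, k13, hk1]),
      Finset.card_insert_of_notMem (by simp [k23, hk2]),
      Finset.card_insert_of_notMem (by simp [hk3]), Finset.card_pair (Ne.symm hi2.2)]
  have hc4 : (insert i3 ({i2, i1, j0} : Finset (Fin r))).card ≤ 4 := Finset.card_le_four
  omega

end

end TM
end

section
set_option linter.unusedSimpArgs false

namespace TM
variable {r : ℕ} {V : Type} [AddCommGroup V] [Module ℚ V]
open Module

theorem Cfg.t1_step (C : Cfg (r + 1) V) (hr : 1 ≤ r) (B : Basis (Fin (r + 1)) ℚ V)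
    (j0 : Fin (r + 1)) (hO : C.Odd B {j0}) : ∃ C' : Cfg r (Fin r → ℚ),
      (∃ B' J', C'.Odd B' J' ∧ J'.card ≤ 1) ∧ C.X.card ≤ C'.X.card + r + 2 := by
  classical
  by_cases hi : ∃ v ∈ C.S, v ∉ T B {j0} ∧ v + B j0 ∈ C.S
  · obtain ⟨v, hv, hvT, hvc⟩ := hi
    obtain ⟨C', hC', b, i, N, W0, Rest, wf, gf, hij, hb, hbi, hcard, hN, ⟨hW, hWp, hWc⟩, hR, hRi⟩ :=
      C.t1_contract B j0 hO hv hvT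
    refine ⟨C', hC', ?_⟩
    have hG : (C.Gam (B j0) v).card ≤ 2 := by
      have : C.Gam (B j0) v ⊆ {1 / 2, 1} := by
        intro g hg
        simp only [Cfg.Gam, Finset.mem_filter, Finset.mem_insert, Finset.mem_singleton] at hg
        have w := hO.width hg.2 hvc (notT_add hvT g)
          (mem_T_single.2 ⟨1 - g, by module⟩) j0
        rw [show v + B j0 - (v + g • B j0) = (1 - g) • B j0 by module] at w
        simp at w
        rcases hg.1 with h | h | h | h
        · simp [h]
        · rw [h] at w; norm_num at w
        · simp [h]
        · rw [h] at w; norm_num at w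
      exact (Finset.card_le_card this).trans Finset.card_le_two
    have hRest : Rest = ∅ := by
      rw [Finset.eq_empty_iff_forall_notMem]
      intro ρ hρ
      obtain ⟨h1, h2, h3, h4⟩ := hR ρ hρ
      obtain ⟨k1, k2, k3⟩ := hW _ h1
      have hbj : b j0 = B j0 := hb.2 j0 (by simp)
      obtain ⟨w, g, hg, m2, m3, m4⟩ : ∃ (w : V) (g : ℚ), 0 < g ∧ w + v ∈ C.S ∧
          w + g • B j0 ∈ C.S ∧ ∀ a d : ℚ, w ≠ a • B j0 + d • v := by
        have : ∀ a d : ℚ, wf ρ ≠ a • B j0 + d • v := by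
          intro a d h
          exact k3 (mem_T_pair.2 ⟨d, a, by rw [h, hbi, hbj]; module⟩)
        rcases lt_or_gt_of_ne h2 with h | h
        · refine ⟨wf ρ + gf ρ • B j0, -gf ρ, by linarith, h4, by convert k1 using 1; module, ?_⟩
          intro a d h
          refine this (a - gf ρ) d ?_
          rw [eq_sub_of_add_eq h]; module
        · exact ⟨wf ρ, gf ρ, h, k2, h3, this⟩
      obtain ⟨b1, i1, hi1, q1, F1, O1⟩ := hO.ext hvc (by simpa using notT_add hvT 1)
      have c1 : b1 j0 = B j0 := F1.2 j0 (by simp)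
      obtain ⟨b2, i2, hi2, q2, F2, O2⟩ := O1.ext m3 (by
        intro hh
        obtain ⟨p, q, hpq⟩ := mem_T_pair.1 hh
        rw [q1, c1] at hpq
        refine m4 (p + q - g) p ?_
        rw [eq_sub_of_add_eq hpq]; module)
      have c2 : b2 j0 = B j0 := (F2.2 j0 (by simp)).trans c1
      have q21 : b2 i1 = v + B j0 := (F2.2 i1 (by simp)).trans q1
      have := O2.ge1 m2 j0
      rw [show w + v = b2 i2 + b2 i1 - (1 + g) • b2 j0 by rw [q2, q21, c2]; module] at this
      simp only [Finset.mem_insert, Finset.mem_singleton, not_or] at hi1 hi2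
      simp [hi1, hi2.2] at this
      linarith
    rw [hRest, Finset.card_empty] at hcard
    omega
  push Not at hi
  by_contra hcon
  push Not at hcon
  -- key facts in case (ii)
  have hh : ∀ w ∈ C.S, w ∉ T B {j0} → ∀ g : ℚ, g ≠ 0 → w + g • B j0 ∈ C.S → pmhalf g := by
    intro w hw hwT g hg hwg
    rcases hO.gam hw hwT hwg with h | h | h | h | h
    · exact absurd h hg
    · exact Or.inl h
    · exact Or.inr h
    · exact absurd (by rw [h, one_smul] at hwg; exact hwg) (hi w hw hwT)
    · exfalso
      rw [h] at hwg
      refine hi _ hwg (notT_add hwT _) ?_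
      convert hw using 1; module
  have hpq : ∀ w, w ∉ T B {j0} → ∀ g g' : ℚ, pmhalf g → pmhalf g' → w + g • B j0 ∈ C.S →
      w + g' • B j0 ∈ C.S → g = g' := by
    intro w hwT g g' h h' m m'
    have := _root_.abs_le.1 (hO.gam2 hi hwT m m')
    rcases h with rfl | rfl <;> rcases h' with rfl | rfl
    · rfl
    · exfalso; linarith [this.1]
    · exfalso; linarith [this.2]
    · rfl
  have hG : ∀ v ∈ C.S, v ∉ T B {j0} → ∀ g ∈ C.Gam (B j0) v, pmhalf g ∧ v + g • B j0 ∈ C.S := by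
    intro v hv hvT g hg
    simp only [Cfg.Gam, Finset.mem_filter, Finset.mem_insert, Finset.mem_singleton] at hg
    refine ⟨hh v hv hvT g ?_ hg.2, hg.2⟩
    rintro rfl
    norm_num at hg
  have hD : ∀ v ∈ C.S, v ∉ T B {j0} → (∃ g, pmhalf g ∧ v + g • B j0 ∈ C.S) →
      ∃ w1 w2 g1 g2, C.D (B j0) v w1 g1 ∧ C.D (B j0) v w2 g2 ∧
        (∀ a b : ℚ, w1 ≠ a • B j0 + b • v) ∧ (∀ a b : ℚ, w2 ≠ a • B j0 + b • v) ∧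
        (∀ a b d : ℚ, w2 ≠ a • B j0 + b • v + d • w1) := by
    intro v hv hvT _
    obtain ⟨C', hC', b, i, N, W0, Rest, wf, gf, hij, hb, hbi, hcard, hN, ⟨hW, hWp, hWc⟩, hR, hRi⟩ :=
      C.t1_contract B j0 hO hv hvT
    have h1 := hcon C' hC'
    have h2 : (C.Gam (B j0) v).card ≤ 1 := by
      rw [Finset.card_le_one]
      intro g hg g' hg'
      obtain ⟨a1, a2⟩ := hG v hv hvT g hg
      obtain ⟨b1, b2⟩ := hG v hv hvT g' hg'
      exact hpq v hvT g g' a1 b1 a2 b2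
    have h3 : 1 < Rest.card := by omega
    obtain ⟨ρ, hρ, ρ', hρ', hne⟩ := Finset.one_lt_card.1 h3
    have hbj : b j0 = B j0 := hb.2 j0 (by simp)
    have hel : ∀ w ∈ W0, ∀ a d : ℚ, w ≠ a • B j0 + d • v := by
      intro w hw a d h
      exact (hW w hw).2.2 (mem_T_pair.2 ⟨d, a, by rw [h, hbi, hbj]; module⟩)
    have hwT : ∀ w ∈ W0, w ∉ T B {j0} := by
      intro w hw h
      obtain ⟨a, ha⟩ := mem_T_single.1 h
      exact hel w hw a 0 (by rw [ha]; module)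
    have hDD : ∀ ρ ∈ Rest, C.D (B j0) v (wf ρ) (gf ρ) := by
      intro ρ hρ
      obtain ⟨m1, m2, m3, m4⟩ := hR ρ hρ
      obtain ⟨k1, k2, k3⟩ := hW _ m1
      exact ⟨hh _ k1 (hwT _ m1) _ m2 m3, k1, k2, m3, m4⟩
    have hw0 := (hR ρ hρ).1
    have hw0' := (hR ρ' hρ').1
    have hww : wf ρ ≠ wf ρ' := by
      intro h
      refine hRi ρ hρ ρ' hρ' hne h (hpq (wf ρ) (hwT _ hw0) _ _ (hDD ρ hρ).1 (hDD ρ' hρ').1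
        (hDD ρ hρ).2.2.2.1 ?_)
      rw [h]; exact (hDD ρ' hρ').2.2.2.1
    refine ⟨wf ρ, wf ρ', gf ρ, gf ρ', hDD ρ hρ, hDD ρ' hρ', hel _ hw0, hel _ hw0', ?_⟩
    intro a d e h
    refine hWp _ hw0 _ hw0' hww e (mem_T_pair.2 ⟨d, a, ?_⟩)
    rw [h, hbi, hbj]; module
  obtain ⟨i0, hi0⟩ : ∃ i0 : Fin (r + 1), i0 ≠ j0 := by
    have : Nontrivial (Fin (r + 1)) := Fin.nontrivial_iff_two_le.2 (by omega)
    exact exists_ne j0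
  have hnT : B i0 ∉ T B {j0} := by
    intro h
    have := mem_T.1 h i0 (by simpa using hi0)
    simp at this
  have hno : ∀ v ∈ C.S, v ∉ T B {j0} → ∀ g, pmhalf g → v + g • B j0 ∉ C.S :=
    fun v hv hvT g hg hm => hO.caseC hi hD hv hvT ⟨g, hg, hm⟩
  obtain ⟨C', hC', b, i, N, W0, Rest, wf, gf, hij, hb, hbi, hcard, hN, ⟨hW, hWp, hWc⟩, hR, hRi⟩ :=
      C.t1_contract B j0 hO (hO.1 i0) hnT
  have h1 := hcon C' hC'
  have hG0 : C.Gam (B j0) (B i0) = ∅ := by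
    rw [Finset.eq_empty_iff_forall_notMem]
    intro g hg
    obtain ⟨a1, a2⟩ := hG _ (hO.1 i0) hnT g hg
    exact hno _ (hO.1 i0) hnT g a1 a2
  have hR0 : Rest = ∅ := by
    rw [Finset.eq_empty_iff_forall_notMem]
    intro ρ hρ
    obtain ⟨m1, m2, m3, m4⟩ := hR ρ hρ
    obtain ⟨k1, k2, k3⟩ := hW _ m1
    have hbj : b j0 = B j0 := hb.2 j0 (by simp)
    have hwT : wf ρ ∉ T B {j0} := by
      intro h
      obtain ⟨a, ha⟩ := mem_T_single.1 h
      exact k3 (mem_T_pair.2 ⟨0, a, by rw [ha, hbj]; module⟩)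
    exact hno _ k1 hwT _ (hh _ k1 hwT _ m2 m3) m3
  rw [hG0, Finset.card_empty] at hN
  rw [hR0, Finset.card_empty] at hcard
  omega

/-- the class of configurations with an odd set of size at most one -/
theorem Cfg.t1 : ∀ (r : ℕ) (hr : 1 ≤ r) (V : Type) [AddCommGroup V] [Module ℚ V] (C : Cfg r V)
    (B : Basis (Fin r) ℚ V) (J : Finset (Fin r)), C.Odd B J → J.card ≤ 1 →
    2 * C.X.card + 2 ≤ r ^ 2 + 3 * r := by
  intro r hr
  induction r, hr using Nat.le_induction with
  | base =>
    intro V _ _ C B J hO _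
    have : C.X.card ≤ 1 := by
      rw [Finset.card_le_one]
      intro x hx y hy
      have hx0 := C.nz x hx
      have h1 := B.sum_repr x
      have h2 := B.sum_repr y
      simp only [Fin.sum_univ_one] at h1 h2
      have hx1 : B.repr x 0 ≠ 0 := by
        intro h; rw [h, zero_smul] at h1; exact hx0 h1.symm
      symm
      generalize B.repr x 0 = p at h1 hx1
      generalize B.repr y 0 = q at h2
      refine C.np x hx y hy (q * p⁻¹) ?_
      rw [← h1, ← h2, smul_smul, mul_assoc, inv_mul_cancel₀ hx1, mul_one]
    omega
  | succ r hr ih =>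
    intro V _ _ C B J hO hJ
    obtain ⟨j0, hj0⟩ : ∃ j0, J ⊆ {j0} := by
      rcases Nat.le_one_iff_eq_zero_or_eq_one.1 hJ with h | h
      · exact ⟨0, by rw [Finset.card_eq_zero.1 h]; simp⟩
      · obtain ⟨j, hj⟩ := Finset.card_eq_one.1 h
        exact ⟨j, by rw [hj]⟩
    obtain ⟨C', ⟨B', J', hO', hJ'⟩, hc⟩ := C.t1_step hr B j0 (hO.mono hj0)
    have := ih _ C' B' J' hO' hJ'
    nlinarith

end TM
end

section
set_option linter.unusedSimpArgs false

namespace TM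
variable {r : ℕ} {V : Type} [AddCommGroup V] [Module ℚ V]
open Module

section
variable {C : Cfg r V} {B b f : Basis (Fin r) ℚ V} {J : Finset (Fin r)} {j0 : Fin r}

def Cfg.Min (C : Cfg r V) (b : Basis (Fin r) ℚ V) (J : Finset (Fin r)) : Prop :=
  C.Odd b J ∧ (∀ (B' : Basis (Fin r) ℚ V) (J' : Finset (Fin r)), C.Odd B' J' → J.card ≤ J'.card) ∧
    2 ≤ J.card

theorem Cfg.Min.jfr (hM : C.Min b J) (hf : C.JFr b J f) : C.Min f J :=
  ⟨hf.odd hM.1, hM.2⟩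

theorem Cfg.Min.half (hM : C.Min b J) {x : V} (hx : x ∈ C.S) :
    (∀ j ∈ J, ∃ k : ℤ, b.repr x j = k) ∨ (∀ j ∈ J, pmhalf (b.repr x j)) := by
  classical
  choose z hz hz2 using fun i => hM.1.coord hx i
  by_cases hH : ∃ h ∈ J, _root_.Odd (z h)
  · right
    obtain ⟨h, hh, hodd⟩ := hH
    have := C.odd_of_rel b hM.1.1 hx z (fun i => by rw [hz]; ring)
      (J.filter fun j => _root_.Odd (z j)) (by
        intro i hi
        by_cases hiJ : i ∈ J
        · rw [← Int.not_odd_iff_even]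
          intro ho; exact hi (Finset.mem_filter.2 ⟨hiJ, ho⟩)
        · have hq := hz i
          rcases hM.1.outer hx hiJ with h1 | h1 | h1 <;> rw [h1] at hq
          · have : z i = 0 := by
              have : (z i : ℚ) = 0 := by linarith
              exact_mod_cast this
            rw [this]; decide
          · have : z i = 2 := by
              have : (z i : ℚ) = 2 := by linarith
              exact_mod_cast this
            rw [this]; decide
          · have : z i = -2 := by
              have : (z i : ℚ) = -2 := by linarith
              exact_mod_cast this
            rw [this]; decide)
      h (Finset.mem_filter.2 ⟨hh, hodd⟩) hodd
    have hc := hM.2.1 _ _ this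
    have heq := Finset.eq_of_subset_of_card_le (Finset.filter_subset _ _) hc
    intro j hj
    rw [← heq] at hj
    have ho := (Finset.mem_filter.1 hj).2
    have h2 := hz2 j
    have h3 := hz j
    rw [_root_.abs_le] at h2
    obtain ⟨h2a, h2b⟩ := h2
    generalize z j = k at ho h2a h2b h3
    rw [h3]
    interval_cases k
    · exact absurd ho (by decide)
    · right; norm_num
    · exact absurd ho (by decide)
    · left; norm_num
    · exact absurd ho (by decide)
  · left
    push Not at hH
    intro j hj
    have := hH j hj
    rw [Int.not_odd_iff_even] at this
    obtain ⟨k, hk⟩ := this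
    exact ⟨k, by rw [hz, hk]; push_cast; ring⟩

theorem pmhalf.eq {q : ℚ} (h : pmhalf q) : ∃ k : ℤ, q = k + 1 / 2 := by
  rcases h with rfl | rfl
  · exact ⟨0, by norm_num⟩
  · exact ⟨-1, by norm_num⟩

theorem not_int_half {q : ℚ} {k l : ℤ} (h1 : q = k) (h2 : q = l + 1 / 2) : False := by
  have : (2 * k : ℚ) = 2 * l + 1 := by linarith
  have h : 2 * k = 2 * l + 1 := by exact_mod_cast this
  omega

theorem Cfg.Min.diff (hM : C.Min b J) {x y : V} (hx : x ∈ C.S) (hy : y ∈ C.S) :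
    (∀ j ∈ J, ∃ k : ℤ, b.repr (y - x) j = k) ∨
      (∀ j ∈ J, ∃ k : ℤ, b.repr (y - x) j = k + 1 / 2) := by
  simp only [map_sub, Finsupp.sub_apply]
  rcases hM.half hx with h1 | h1 <;> rcases hM.half hy with h2 | h2
  · left; intro j hj
    obtain ⟨k, hk⟩ := h1 j hj
    obtain ⟨l, hl⟩ := h2 j hj
    exact ⟨l - k, by rw [hk, hl]; push_cast; ring⟩
  · right; intro j hj
    obtain ⟨k, hk⟩ := h1 j hj
    obtain ⟨l, hl⟩ := (h2 j hj).eq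
    exact ⟨l - k, by rw [hk, hl]; push_cast; ring⟩
  · right; intro j hj
    obtain ⟨k, hk⟩ := (h1 j hj).eq
    obtain ⟨l, hl⟩ := h2 j hj
    exact ⟨l - k - 1, by rw [hk, hl]; push_cast; ring⟩
  · left; intro j hj
    obtain ⟨k, hk⟩ := (h1 j hj).eq
    obtain ⟨l, hl⟩ := (h2 j hj).eq
    exact ⟨l - k, by rw [hk, hl]; push_cast; ring⟩

/-- integrality at one coordinate propagates -/
theorem Cfg.Min.dint (hM : C.Min b J) {x y : V} (hx : x ∈ C.S) (hy : y ∈ C.S) {j : Fin r}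
    (hj : j ∈ J) {k : ℤ} (hk : b.repr (y - x) j = k) : ∀ j ∈ J, ∃ k : ℤ, b.repr (y - x) j = k := by
  rcases hM.diff hx hy with h | h
  · exact h
  · obtain ⟨l, hl⟩ := h j hj
    exact (not_int_half hk hl).elim

theorem Cfg.Min.exists_half (hM : C.Min b J) : ∃ h ∈ C.S, ∀ j ∈ J, pmhalf (b.repr h j) := by
  classical
  by_contra hcon
  push Not at hcon
  have hint : ∀ x ∈ C.S, ∀ i, ∃ k : ℤ, b.repr x i = k := by
    intro x hx i
    by_cases hi : i ∈ J
    · rcases hM.half hx with h | h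
      · exact h i hi
      · obtain ⟨j, hj, hh⟩ := hcon x hx
        exact absurd (h j hj) hh
    · rcases hM.1.outer hx hi with h | h | h <;> rw [h]
      · exact ⟨0, by simp⟩
      · exact ⟨1, by simp⟩
      · exact ⟨-1, by simp⟩
  have : C.Odd b ∅ := by
    refine ⟨hM.1.1, ?_⟩
    intro y hy _
    obtain ⟨g, hg, -, hω⟩ := C.ω_minor b id Function.injective_id y
    have hgy : g = y := funext hg
    rw [hgy] at hω
    choose M hMm using fun p q => hint (y p) (hy p) q
    have hdet : (Matrix.of fun p q => b.repr (y p) (id q)).det = (((Matrix.of M).det : ℤ) : ℚ) := by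
      rw [Int.cast_det]
      congr 1
      ext p q
      simp [hMm]
    rw [hω, hdet]
    rcases hM.1.two with h | h <;> rw [h]
    · exact ⟨(Matrix.of M).det, by ring⟩
    · exact ⟨-(Matrix.of M).det, by push_cast; ring⟩
  have h1 := hM.2.1 _ _ this
  have h2 := hM.2.2
  rw [Finset.card_empty] at h1
  omega

theorem Cfg.Min.P (hM : C.Min b J) {x : V} (hx : x ∈ C.S)
    (hi : ∀ j ∈ J, ∃ k : ℤ, b.repr x j = k) :
    (J.filter fun j => b.repr x j ≠ 0).card ≤ 1 + (Jᶜ.filter fun i => b.repr x i ≠ 0).card := by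
  classical
  by_cases hemp : ∃ j1 ∈ J, b.repr x j1 ≠ 0
  swap
  · push Not at hemp
    rw [Finset.filter_false_of_mem (by intro j hj; simpa using hemp j hj)]
    simp
  obtain ⟨j1, hj1, hx1⟩ := hemp
  have hval : ∀ i, b.repr x i = 0 ∨ b.repr x i = 1 ∨ b.repr x i = -1 := by
    intro i
    by_cases hiJ : i ∈ J
    · obtain ⟨k, hk⟩ := hi i hiJ
      have h1 := hM.1.abs_le hx i
      rw [hk] at h1 ⊢
      have h2 : |k| ≤ 1 := by exact_mod_cast h1
      rw [_root_.abs_le] at h2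
      obtain ⟨h3, h4⟩ := h2
      interval_cases k <;> simp
    · exact hM.1.outer hx hiJ
  obtain ⟨b', hb'⟩ := C.mkBasis (Function.update b j1 x) (by
    rw [C.ω_update]; exact mul_ne_zero hx1 (C.ω_basis b))
  have e1 : b' j1 = x := by rw [hb']; simp
  have e2 : ∀ k, k ≠ j1 → b' k = b k := by intro k hk; rw [hb', Function.update_of_ne hk]
  have hb'S : ∀ i, b' i ∈ C.S := by
    intro i
    by_cases h : i = j1
    · rw [h, e1]; exact hx
    · rw [e2 i h]; exact hM.1.1 i
  obtain ⟨h, hh, hhalf⟩ := hM.exists_half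
  set ε := b.repr x j1 with hε
  have hε1 : ε * ε = 1 := by rcases hval j1 with h | h | h
                             · exact absurd h hx1
                             · rw [← hε] at h; rw [h]; norm_num
                             · rw [← hε] at h; rw [h]; norm_num
  have hcoord : ∀ i, b'.repr h i = if i = j1 then ε * b.repr h j1 else
      b.repr h i - ε * b.repr h j1 * b.repr x i := by
    intro i
    have hsum : h = (ε * b.repr h j1) • b' j1 + ∑ i ∈ Finset.univ.erase j1,
        (b.repr h i - ε * b.repr h j1 * b.repr x i) • b' i := by
      have a1 := Finset.add_sum_erase Finset.univ (fun i => b.repr h i • b i) (Finset.mem_univ j1)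
      have a2 := Finset.add_sum_erase Finset.univ (fun i => b.repr x i • b i) (Finset.mem_univ j1)
      rw [b.sum_repr] at a1 a2
      have a3 : ∑ i ∈ Finset.univ.erase j1, (b.repr h i - ε * b.repr h j1 * b.repr x i) • b' i =
          ∑ i ∈ Finset.univ.erase j1, b.repr h i • b i - (ε * b.repr h j1) •
            ∑ i ∈ Finset.univ.erase j1, b.repr x i • b i := by
        rw [Finset.smul_sum, ← Finset.sum_sub_distrib]
        refine Finset.sum_congr rfl fun i hi => ?_
        rw [e2 i (Finset.ne_of_mem_erase hi)]; module
      rw [a3, e1]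
      rw [eq_sub_of_add_eq' a1, eq_sub_of_add_eq' a2, ← hε]
      have : (ε * b.repr h j1) • x + (h - b.repr h j1 • b j1 - (ε * b.repr h j1) • (x - ε • b j1))
        = h + ((ε * ε - 1) * b.repr h j1) • b j1 := by module
      rw [this, hε1]; simp
    have := congrArg (fun u => b'.repr u i) hsum
    rw [this]
    simp only [map_add, map_smul, Finsupp.add_apply, Finsupp.smul_apply, Basis.repr_self, map_sum,
      Finsupp.finsetSum_apply, Finsupp.single_apply, smul_eq_mul, mul_ite, mul_one, mul_zero]
    rw [Finset.sum_ite_eq']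
    by_cases hij : i = j1
    · subst hij; simp
    · simp [hij, Ne.symm hij]
  -- integrality data
  have hout : ∀ i, i ∉ J → ∃ k : ℤ, b.repr h i = k := by
    intro i hiJ
    rcases hM.1.outer hh hiJ with h | h | h <;> rw [h]
    · exact ⟨0, by simp⟩
    · exact ⟨1, by simp⟩
    · exact ⟨-1, by simp⟩
  have h2b : ∀ i, ∃ m : ℤ, 2 * b.repr h i = m := by
    intro i
    obtain ⟨z, hz, _⟩ := hM.1.coord hh i
    exact ⟨z, by rw [hz]; ring⟩
  have hεz : ∃ e : ℤ, ε = e := hi j1 hj1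
  have hxz : ∀ i, ∃ e : ℤ, b.repr x i = e := by
    intro i
    rcases hval i with h | h | h <;> rw [h]
    · exact ⟨0, by simp⟩
    · exact ⟨1, by simp⟩
    · exact ⟨-1, by simp⟩
  have hm : ∀ i, ∃ m : ℤ, 2 * b'.repr h i = m := by
    intro i
    rw [hcoord]
    obtain ⟨e, he⟩ := hεz
    obtain ⟨m1, hm1⟩ := h2b j1
    obtain ⟨m2, hm2⟩ := h2b i
    obtain ⟨e2, he2⟩ := hxz i
    split_ifs
    · exact ⟨e * m1, by push_cast; rw [← hm1, ← he]; ring⟩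
    · exact ⟨m2 - e * m1 * e2, by push_cast; rw [← hm1, ← he, ← he2, ← hm2]; ring⟩
  choose m hm using hm
  have hεpm : ε = 1 ∨ ε = -1 := by
    rcases hval j1 with h | h | h
    · exact absurd h hx1
    · exact Or.inl h
    · exact Or.inr h
  set H : Finset (Fin r) := insert j1 ((J.filter fun j => b.repr x j = 0) ∪
    (Jᶜ.filter fun i => b.repr x i ≠ 0)) with hH
  have hodd := C.odd_of_rel b' hb'S hh m hm H (by
      intro i hi
      have hij : i ≠ j1 := by rintro rfl; exact hi (by simp [hH])
      have hmi := hm i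
      rw [hcoord, if_neg hij] at hmi
      suffices hs : ∃ k : ℤ, b.repr h i - ε * b.repr h j1 * b.repr x i = k by
        obtain ⟨k, hk⟩ := hs
        rw [hk] at hmi
        have : 2 * k = m i := by exact_mod_cast hmi
        exact ⟨k, by omega⟩
      by_cases hiJ : i ∈ J
      · have hxi : b.repr x i ≠ 0 := by
          intro h0; exact hi (by simp [hH, hiJ, h0])
        have hxi' := (hval i).resolve_left hxi
        rcases hhalf i hiJ with h1 | h1 <;> rcases hhalf j1 hj1 with h2 | h2 <;>
          rcases hεpm with h3 | h3 <;> rcases hxi' with h4 | h4 <;> rw [h1, h2, h3, h4]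
        all_goals first | (refine ⟨0, ?_⟩; norm_num; done) | (refine ⟨1, ?_⟩; norm_num; done) | (refine ⟨-1, ?_⟩; norm_num)
      · have hxi : b.repr x i = 0 := by
          by_contra h0; exact hi (by simp [hH, hiJ, h0])
        rw [hxi, mul_zero, sub_zero]; exact hout i hiJ) j1 (by simp [hH]) (by
      have := hm j1
      rw [hcoord, if_pos rfl] at this
      rcases hhalf j1 hj1 with h2 | h2 <;> rcases hεpm with h3 | h3 <;> rw [h2, h3] at this <;>
        norm_num at this
      · have : m j1 = 1 := by exact_mod_cast this.symm
        rw [this]; decide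
      · have : m j1 = -1 := by exact_mod_cast this.symm
        rw [this]; decide
      · have : m j1 = -1 := by exact_mod_cast this.symm
        rw [this]; decide
      · have : m j1 = 1 := by exact_mod_cast this.symm
        rw [this]; decide)
  have hc := hM.2.1 _ _ hodd
  have hc2 : H.card ≤ ((J.filter fun j => b.repr x j = 0).card +
    (Jᶜ.filter fun i => b.repr x i ≠ 0).card) + 1 :=
    (Finset.card_insert_le _ _).trans (Nat.add_le_add_right (Finset.card_union_le _ _) 1)
  have hc3 := Finset.card_filter_add_card_filter_not (s := J) (fun j => b.repr x j = 0)
  simp only [ne_eq] at hc2 hc3 ⊢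
  omega

end

end TM
end

section
set_option linter.unusedSimpArgs false

namespace TM
variable {r : ℕ} {V : Type} [AddCommGroup V] [Module ℚ V]
open Module

section
variable {C : Cfg r V} {B b f : Basis (Fin r) ℚ V} {J : Finset (Fin r)} {j0 : Fin r}

theorem sum_T_single {x : V} (hx : x ∈ T b J) {j : Fin r} (hj : j ∈ J)
    (h : ∀ l ∈ J, l ≠ j → b.repr x l = 0) : x = b.repr x j • b j := by
  conv_lhs => rw [sum_T hx]
  rw [Finset.sum_eq_single_of_mem j hj]
  intro l hl hlj
  rw [h l hl hlj, zero_smul]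

theorem Cfg.Min.P1 (hM : C.Min b J) {x : V} (hx : x ∈ C.S) (hT : x ∈ T b J) :
    (∃ j ∈ J, x = b j ∨ x = -b j) ∨ ∀ j ∈ J, pmhalf (b.repr x j) := by
  classical
  rcases hM.half hx with h | h
  · left
    have hP := hM.P hx h
    rw [Finset.filter_false_of_mem (s := Jᶜ)] at hP
    swap
    · intro i hi
      rw [Finset.mem_compl] at hi
      simpa using mem_T.1 hT i hi
    simp only [Finset.card_empty, add_zero] at hP
    rw [Finset.card_le_one] at hP
    have hex : ∃ j ∈ J, b.repr x j ≠ 0 := by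
      by_contra hcon
      push Not at hcon
      apply Cfg.S_nz hx
      rw [sum_T hT]
      exact Finset.sum_eq_zero fun j hj => by rw [hcon j hj, zero_smul]
    obtain ⟨j, hj, hj0⟩ := hex
    refine ⟨j, hj, Cfg.S_np (hM.1.1 j) hx (b.repr x j) (sum_T_single hT hj ?_)⟩
    intro l hl hlj
    by_contra hl0
    exact hlj (hP l (by simp [hl, hl0]) j (by simp [hj, hj0]))
  · exact Or.inr h

theorem Cfg.Odd.dabs (hO : C.Odd b J) {x y : V} (hx : x ∈ C.S) (hy : y ∈ C.S) (hxT : x ∉ T b J)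
    (h : y - x ∈ T b J) (j : Fin r) : |b.repr (y - x) j| ≤ 1 := by
  have hyT : y ∉ T b J := fun hh => hxT (by simpa using sub_mem hh h)
  rw [_root_.abs_le]
  have h1 := hO.width hy hx hyT (by simpa using (T b J).neg_mem h) j
  refine ⟨?_, hO.width hx hy hxT h j⟩
  rw [← neg_sub, map_neg, Finsupp.neg_apply] at h1
  linarith

theorem int01 {q : ℚ} {k : ℤ} (hk : q = k) (h : |q| ≤ 1) : q = 0 ∨ q = 1 ∨ q = -1 := by
  rw [hk] at h ⊢
  have h2 : |k| ≤ 1 := by exact_mod_cast h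
  rw [_root_.abs_le] at h2
  obtain ⟨h3, h4⟩ := h2
  interval_cases k <;> simp

theorem half01 {q : ℚ} {k : ℤ} (hk : q = k + 1 / 2) (h : |q| ≤ 1) : pmhalf q := by
  rw [_root_.abs_le] at h
  have h3 : (-2 : ℚ) < k := by linarith [h.1]
  have h4 : (k : ℚ) < 1 := by linarith [h.2]
  have h3 : -2 < k := by exact_mod_cast h3
  have h4 : k < 1 := by exact_mod_cast h4
  rw [hk]
  interval_cases k
  · right; norm_num
  · left; norm_num

theorem Cfg.Min.P2 (hM : C.Min b J) {x y : V} (hx : x ∈ C.S) (hy : y ∈ C.S) (hxT : x ∉ T b J)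
    (hT : y - x ∈ T b J) (hi : ∀ j ∈ J, ∃ k : ℤ, b.repr (y - x) j = k) :
    (J.filter fun j => b.repr (y - x) j ≠ 0).card ≤ 2 := by
  classical
  obtain ⟨f, i, hiJ, hfi, hf, -⟩ := hM.1.ext hx hxT
  have hMf := hM.jfr hf
  have e : ∀ j, f.repr y j = f.repr x j + b.repr (y - x) j := fun j => hf.repr_add hT j
  have ex : ∀ j, j ≠ i → f.repr x j = 0 := by
    intro j hj; rw [← hfi]; simp [Ne.symm hj]
  have eJ : ∀ j ∈ J, f.repr y j = b.repr (y - x) j := by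
    intro j hj
    rw [e, ex j (by rintro rfl; exact hiJ hj), zero_add]
  have hP := hMf.P hy (by intro j hj; rw [eJ j hj]; exact hi j hj)
  have h1 : (Jᶜ.filter fun l => f.repr y l ≠ 0).card ≤ 1 := by
    rw [Finset.card_le_one]
    have : ∀ l ∈ (Jᶜ.filter fun l => f.repr y l ≠ 0), l = i := by
      intro l hl
      rw [Finset.mem_filter, Finset.mem_compl] at hl
      by_contra hli
      apply hl.2
      rw [e, ex l hli, mem_T.1 hT l hl.1, add_zero]
    intro l hl l' hl'
    rw [this l hl, this l' hl']
  have h2 : (J.filter fun j => b.repr (y - x) j ≠ 0) = J.filter fun j => f.repr y j ≠ 0 := by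
    apply Finset.filter_congr
    intro j hj; rw [eJ j hj]
  rw [h2]; omega

theorem Cfg.Min.P2ne (hM : C.Min b J) {x y : V} (hx : x ∈ C.S) (hy : y ∈ C.S) (hxT : x ∉ T b J)
    (hT : y - x ∈ T b J) (hi : ∀ j ∈ J, ∃ k : ℤ, b.repr (y - x) j = k) {j l m : Fin r}
    (hj : j ∈ J) (hl : l ∈ J) (hm : m ∈ J) (hjl : j ≠ l) (hjm : j ≠ m) (hlm : l ≠ m)
    (h1 : b.repr (y - x) j ≠ 0) (h2 : b.repr (y - x) l ≠ 0) (h3 : b.repr (y - x) m ≠ 0) : False := by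
  classical
  have hP := hM.P2 hx hy hxT hT hi
  have : ({j, l, m} : Finset (Fin r)) ⊆ J.filter fun j => b.repr (y - x) j ≠ 0 := by
    intro k hk
    simp only [Finset.mem_insert, Finset.mem_singleton] at hk
    rw [Finset.mem_filter]
    rcases hk with rfl | rfl | rfl
    exacts [⟨hj, h1⟩, ⟨hl, h2⟩, ⟨hm, h3⟩]
  have h4 := Finset.card_le_card this
  rw [Finset.card_eq_three.2 ⟨j, l, m, hjl, hjm, hlm, rfl⟩] at h4
  omega

theorem Cfg.Min.P2form (hM : C.Min b J) {x y : V} (hx : x ∈ C.S) (hy : y ∈ C.S) (hxT : x ∉ T b J)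
    (hT : y - x ∈ T b J) (hi : ∀ j ∈ J, ∃ k : ℤ, b.repr (y - x) j = k) {j : Fin r}
    (hj : j ∈ J) (h0 : b.repr (y - x) j ≠ 0) :
    ∃ e : ℚ, (e = 1 ∨ e = -1) ∧ (y - x = e • b j ∨ ∃ l ∈ J, l ≠ j ∧ ∃ e' : ℚ, (e' = 1 ∨ e' = -1) ∧
      y - x = e • b j + e' • b l) := by
  classical
  have h01 : ∀ l ∈ J, b.repr (y - x) l ≠ 0 → b.repr (y - x) l = 1 ∨ b.repr (y - x) l = -1 := by
    intro l hl h
    obtain ⟨k, hk⟩ := hi l hl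
    exact (int01 hk (hM.1.dabs hx hy hxT hT l)).resolve_left h
  refine ⟨_, h01 j hj h0, ?_⟩
  by_cases hl : ∃ l ∈ J, l ≠ j ∧ b.repr (y - x) l ≠ 0
  · obtain ⟨l, hlJ, hlj, hl0⟩ := hl
    right
    refine ⟨l, hlJ, hlj, _, h01 l hlJ hl0, ?_⟩
    conv_lhs => rw [sum_T hT]
    rw [← Finset.add_sum_erase J _ hj, ← Finset.add_sum_erase (J.erase j) _
      (Finset.mem_erase.2 ⟨hlj, hlJ⟩), Finset.sum_eq_zero, add_zero]
    intro m hm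
    simp only [Finset.mem_erase] at hm
    have : b.repr (y - x) m = 0 := by
      by_contra hm0
      exact hM.P2ne hx hy hxT hT hi hj hlJ hm.2.2 (Ne.symm hlj) (Ne.symm hm.2.1) (Ne.symm hm.1)
        h0 hl0 hm0
    rw [this, zero_smul]
  · push Not at hl
    left
    exact sum_T_single hT hj hl

/-- a square in directions `j0, j` based at `x` -/
def Cfg.Sq (C : Cfg r V) (b : Basis (Fin r) ℚ V) (J : Finset (Fin r)) (j0 j : Fin r) (x : V) :
    Prop := (j0 ∈ J ∧ j ∈ J ∧ j ≠ j0) ∧ x ∉ T b J ∧ x ∈ C.S ∧ x + b j0 ∈ C.S ∧ x + b j ∈ C.S ∧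
      x + b j0 + b j ∈ C.S

/-- corner pairs of a square -/
theorem Cfg.Sq.corner {j : Fin r} {x : V} (h : C.Sq b J j0 j x) (σ τ : ℚ) (hσ : σ = 1 ∨ σ = -1)
    (hτ : τ = 1 ∨ τ = -1) : ∃ p ∈ C.S, p + (σ • b j0 + τ • b j) ∈ C.S ∧ p - x ∈ T b J := by
  obtain ⟨⟨hj0, hj, hne⟩, hxT, h0, h1, h2, h3⟩ := h
  have m1 := B_mem_T b hj0
  have m2 := B_mem_T b hj
  rcases hσ with rfl | rfl <;> rcases hτ with rfl | rfl
  · exact ⟨x, h0, by convert h3 using 1; module, by simp⟩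
  · exact ⟨x + b j, h2, by convert h1 using 1; module, by simpa using m2⟩
  · exact ⟨x + b j0, h1, by convert h2 using 1; module, by simpa using m1⟩
  · exact ⟨x + b j0 + b j, h3, by convert h0 using 1; module, by
      rw [add_assoc, add_sub_cancel_left]; exact add_mem m1 m2⟩

theorem notT_sub {x p : V} (hx : x ∉ T b J) (h : p - x ∈ T b J) : p ∉ T b J := by
  intro hh; apply hx; have := sub_mem hh h; simpa using this

theorem npar_sub {x p z : V} (hx : ∀ a : ℚ, z - a • x ∉ T b J) (h : p - x ∈ T b J) :
    ∀ a : ℚ, z - a • p ∉ T b J := by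
  intro a hh
  apply hx a
  have := add_mem hh ((T b J).smul_mem a h)
  convert this using 1; module

/-- frame containing two given independent elements -/
theorem Cfg.Odd.frame2 (hO : C.Odd b J) {p z : V} (hp : p ∈ C.S) (hz : z ∈ C.S) (hpT : p ∉ T b J)
    (hzp : ∀ a : ℚ, z - a • p ∉ T b J) : ∃ f i1 i2, C.JFr b J f ∧ i1 ∉ J ∧ i2 ∉ J ∧ i1 ≠ i2 ∧
      f i1 = p ∧ f i2 = z := by
  obtain ⟨f1, i1, h1, e1, F1, O1⟩ := hO.ext hp hpT
  obtain ⟨f2, i2, h2, e2, F2, O2⟩ := O1.ext hz (by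
    intro hh
    obtain ⟨a, ha⟩ := mem_T_insert hh
    rw [e1, F1.T_eq] at ha
    exact hzp a ha)
  simp only [Finset.mem_insert, not_or] at h2
  exact ⟨f2, i1, i2, ⟨F2.1, fun j hj => (F2.2 j (by simp [hj])).trans (F1.2 j hj)⟩, h1, h2.2,
    Ne.symm h2.1, (F2.2 i1 (by simp)).trans e1, e2⟩

theorem Cfg.Odd.L3 (hO : C.Odd b J) {j : Fin r} {x : V} (h : C.Sq b J j0 j x) {z z' : V}
    (hz : z ∈ C.S) (hz' : z' ∈ C.S) (hzx : ∀ a : ℚ, z - a • x ∉ T b J) {α β : ℚ}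
    (hα : α = 1 ∨ α = -1) (hβ : β = 1 ∨ β = -1) (hd : z' - z = α • b j0 + β • b j) : False := by
  obtain ⟨p, hp, hp', hpx⟩ := h.corner 1 (-(α * β)) (Or.inl rfl) (by
    rcases hα with rfl | rfl <;> rcases hβ with rfl | rfl <;> norm_num)
  obtain ⟨⟨hj0, hj, hne⟩, hxT, -⟩ := h
  obtain ⟨f, i1, i2, hf, hi1, hi2, hi12, e1, e2⟩ := hO.frame2 hp hz (notT_sub hxT hpx)
    (npar_sub hzx hpx)
  have n1 : i1 ≠ j0 := by rintro rfl; exact hi1 hj0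
  have n2 : i1 ≠ j := by rintro rfl; exact hi1 hj
  have n3 : i2 ≠ j0 := by rintro rfl; exact hi2 hj0
  have n4 : i2 ≠ j := by rintro rfl; exact hi2 hj
  have := (hf.odd hO).minor2 hne hz' hp'
  rw [eq_add_of_sub_eq hd, ← e1, ← e2, ← hf.2 _ hj0, ← hf.2 _ hj] at this
  simp [n1, n2, n3, n4, hne, hne.symm] at this
  rcases hα with rfl | rfl <;> rcases hβ with rfl | rfl <;> norm_num at this

theorem Cfg.Odd.L4 (hO : C.Odd b J) {j l : Fin r} {x : V} (h : C.Sq b J j0 j x) {z z' : V}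
    (hl : l ∈ J) (hlj : l ≠ j) (hl0 : l ≠ j0)
    (hz : z ∈ C.S) (hz' : z' ∈ C.S) (hzx : ∀ a : ℚ, z - a • x ∉ T b J) {α β : ℚ}
    (hα : α = 1 ∨ α = -1) (hβ : β = 1 ∨ β = -1) (hd : z' - z = α • b j0 + β • b l)
    {y : V} (hy : y ∈ C.S) (hyT : y ∈ T b J) (hh : ∀ j ∈ J, pmhalf (b.repr y j))
    (hsgn : b.repr y l = -(α * β) * b.repr y j0) : False := by
  obtain ⟨⟨hj0, hj, hne⟩, hxT, -⟩ := id h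
  have hs : ∃ σ : ℚ, (σ = 1 ∨ σ = -1) ∧ b.repr y j = - σ * b.repr y j0 := by
    rcases hh j hj with h1 | h1 <;> rcases hh j0 hj0 with h2 | h2 <;> rw [h1, h2]
    · exact ⟨-1, by norm_num⟩
    · exact ⟨1, by norm_num⟩
    · exact ⟨1, by norm_num⟩
    · exact ⟨-1, by norm_num⟩
  obtain ⟨σ, hσ, hσ'⟩ := hs
  obtain ⟨p, hp, hp', hpx⟩ := h.corner σ 1 hσ (Or.inl rfl)
  obtain ⟨f, i1, i2, hf, hi1, hi2, hi12, e1, e2⟩ := hO.frame2 hp hz (notT_sub hxT hpx)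
    (npar_sub hzx hpx)
  have n1 : i1 ≠ j0 := by rintro rfl; exact hi1 hj0
  have n2 : i1 ≠ j := by rintro rfl; exact hi1 hj
  have n3 : i2 ≠ j0 := by rintro rfl; exact hi2 hj0
  have n4 : i2 ≠ j := by rintro rfl; exact hi2 hj
  have n5 : i1 ≠ l := by rintro rfl; exact hi1 hl
  have n6 : i2 ≠ l := by rintro rfl; exact hi2 hl
  have := (hf.odd hO).minor3 (Ne.symm hne) (Ne.symm hl0) (Ne.symm hlj) hp' hz' hy
  rw [hf.repr_T hyT] at this
  rw [eq_add_of_sub_eq hd, ← e1, ← e2, ← hf.2 _ hj0, ← hf.2 _ hj, ← hf.2 _ hl] at this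
  simp [n1, n2, n3, n4, n5, n6, hne, hne.symm, hlj, hl0, hlj.symm, hl0.symm] at this
  rw [hsgn, hσ'] at this
  rcases hh j0 hj0 with h2 | h2 <;> rw [h2] at this <;>
  rcases hα with rfl | rfl <;> rcases hβ with rfl | rfl <;> rcases hσ with rfl | rfl <;>
  norm_num [abs_le] at this

end

end TM
end

section
set_option linter.unusedSimpArgs false

namespace TM
variable {r : ℕ} {V : Type} [AddCommGroup V] [Module ℚ V]
open Module

section
variable {C : Cfg r V} {B b f : Basis (Fin r) ℚ V} {J : Finset (Fin r)} {j0 : Fin r}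

theorem pmhalf.ratio {p q : ℚ} (hp : pmhalf p) (hq : pmhalf q) :
    ∃ s : ℚ, (s = 1 ∨ s = -1) ∧ p = s * q := by
  rcases hp with rfl | rfl <;> rcases hq with rfl | rfl
  · exact ⟨1, by norm_num⟩
  · exact ⟨-1, by norm_num⟩
  · exact ⟨-1, by norm_num⟩
  · exact ⟨1, by norm_num⟩

theorem Cfg.Min.rest1 (hM : C.Min b J) (hj0 : j0 ∈ J) {w d : V} (hw : w ∈ C.S) (hwT : w ∉ T b J)
    (hw1 : w + b j0 ∈ C.S) (hd : d ∈ T b J) (hd0 : d ≠ 0) (hdj : b.repr d j0 = 0)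
    (h1 : w + d ∈ C.S) (h2 : w + d + b j0 ∈ C.S) :
    ∃ j x, C.Sq b J j0 j x ∧ x - w ∈ T b J ∧ (d = b j ∨ d = -b j) := by
  have hm := B_mem_T b hj0
  have hint := hM.dint hw1 h1 (j := j0) hj0 (k := -1) (by
    have : w + d - (w + b j0) = d - b j0 := by abel
    rw [this]; simp [hdj])
  have e : w + d - (w + b j0) = d - b j0 := by abel
  have hc : b.repr (w + d - (w + b j0)) j0 = -1 := by rw [e]; simp [hdj]
  obtain ⟨ε, hε, h⟩ := hM.P2form hw1 h1 (by
      intro hh; exact hwT (by simpa using sub_mem hh hm)) (by rw [e]; exact sub_mem hd hm) hint hj0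
      (by rw [hc]; norm_num)
  rw [e] at h hc
  rcases h with h | ⟨l, hl, hlj, e', he', h⟩
  · rw [h] at hc; simp at hc
    subst hc
    exact absurd (by simpa using h) hd0
  · rw [h] at hc; simp [hlj] at hc
    subst hc
    have hd' : d = e' • b l := by
      have : d = (d - b j0) + b j0 := by abel
      rw [this, h]; module
    rcases he' with rfl | rfl
    · rw [one_smul] at hd'
      refine ⟨l, w, ⟨⟨hj0, hl, hlj⟩, hwT, hw, hw1, hd' ▸ h1, ?_⟩, by simp, Or.inl hd'⟩
      rw [← hd']; convert h2 using 1; abel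
    · have hd' : d = -b l := by rw [hd']; simp
      refine ⟨l, w + d, ⟨⟨hj0, hl, hlj⟩, ?_, h1, h2, ?_, ?_⟩, by simpa using hd, Or.inr hd'⟩
      · intro hh; exact hwT (by simpa using sub_mem hh hd)
      · rw [hd']; simpa using hw
      · rw [hd']; convert hw1 using 1; abel

theorem Cfg.Min.sq_ne (hM : C.Min b J) {j l : Fin r} {x x' : V} (h : C.Sq b J j0 j x)
    (h' : C.Sq b J j0 l x') (hp : ∀ a : ℚ, x' - a • x ∉ T b J) : j ≠ l := by
  rintro rfl
  obtain ⟨p, hp1, hp2, hpx⟩ := h'.corner 1 1 (Or.inl rfl) (Or.inl rfl)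
  refine hM.1.L3 h hp1 hp2 ?_ (Or.inl rfl) (Or.inl rfl) (add_sub_cancel_left _ _)
  intro a hh
  apply hp a
  have := sub_mem hh hpx
  convert this using 1; abel

theorem Cfg.Min.sq_half (hM : C.Min b J) {j l : Fin r} {x x' : V} (h : C.Sq b J j0 j x)
    (h' : C.Sq b J j0 l x') (hp : ∀ a : ℚ, x' - a • x ∉ T b J) {y : V} (hy : y ∈ C.S)
    (hyT : y ∈ T b J) (hh : ∀ j ∈ J, pmhalf (b.repr y j)) : False := by
  have hne := hM.sq_ne h h' hp
  obtain ⟨⟨hj0, hl, hlj⟩, -⟩ := id h'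
  obtain ⟨s, hs, hsy⟩ := (hh l hl).ratio (hh j0 hj0)
  obtain ⟨p, hp1, hp2, hpx⟩ := h'.corner 1 (-s) (Or.inl rfl) (by
    rcases hs with rfl | rfl <;> norm_num)
  refine hM.1.L4 h hl hne.symm hlj hp1 hp2 ?_ (Or.inl rfl) (by
    rcases hs with rfl | rfl <;> norm_num) (add_sub_cancel_left _ _) hy hyT hh (by rw [hsy]; ring)
  intro a hh
  apply hp a
  have := sub_mem hh hpx
  convert this using 1; abel

/-- all half patterns are present -/
def Cfg.AllH (C : Cfg r V) (b : Basis (Fin r) ℚ V) (J : Finset (Fin r)) : Prop :=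
  ∀ η : Fin r → ℚ, (∀ j ∈ J, pmhalf (η j)) → ∑ j ∈ J, η j • b j ∈ C.S

theorem Cfg.AllH.Q (hA : C.AllH b J) (hM : C.Min b J) {j l : Fin r} {x z z' : V}
    (h : C.Sq b J j0 j x) (hl : l ∈ J) (hlj : l ≠ j0) (hz : z ∈ C.S) (hz' : z' ∈ C.S)
    (hzx : ∀ a : ℚ, z - a • x ∉ T b J) {α β : ℚ}
    (hα : α = 1 ∨ α = -1) (hβ : β = 1 ∨ β = -1) (hd : z' - z = α • b j0 + β • b l) : False := by
  classical
  by_cases hne : l = j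
  · subst hne
    exact hM.1.L3 h hz hz' hzx hα hβ hd
  have hαβ : α * β = 1 ∨ α * β = -1 := by
    rcases hα with rfl | rfl <;> rcases hβ with rfl | rfl <;> norm_num
  let η : Fin r → ℚ := fun i => if i = l then -(α * β) / 2 else 1 / 2
  have hη : ∀ j ∈ J, pmhalf (η j) := by
    intro i _
    by_cases hi : i = l
    · simp only [η, hi, if_true]
      rcases hαβ with h | h <;> rw [h]
      · right; norm_num
      · left; norm_num
    · simp only [η, hi, if_false]; left; rfl
  have hr : ∀ i ∈ J, b.repr (∑ j ∈ J, η j • b j) i = η i := by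
    intro i hi
    simp [Finsupp.single_apply, hi]
  refine hM.1.L4 h hl hne hlj hz hz' hzx hα hβ hd (hA η hη)
    (Submodule.sum_mem _ fun j hj => (T b J).smul_mem _ (B_mem_T b hj)) ?_ ?_
  · intro i hi; rw [hr i hi]; exact hη i hi
  · rw [hr l hl, hr j0 h.1.1]
    simp [η, Ne.symm hlj]
    ring

theorem Cfg.Min.restK (hM : C.Min b J) (hj0 : j0 ∈ J) {W0 Rest : Finset V} {wf df : V → V}
    (hW : ∀ w ∈ W0, w ∈ C.S ∧ w + b j0 ∈ C.S ∧ w ∉ T b J)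
    (hWp : ∀ w ∈ W0, ∀ w' ∈ W0, w ≠ w' → ∀ a : ℚ, w' - a • w ∉ T b J)
    (hR : ∀ ρ ∈ Rest, wf ρ ∈ W0 ∧ df ρ ∈ T b J ∧ df ρ ≠ 0 ∧ b.repr (df ρ) j0 = 0 ∧
          wf ρ + df ρ ∈ C.S ∧ wf ρ + df ρ + b j0 ∈ C.S)
    (hRi : ∀ ρ ∈ Rest, ∀ ρ' ∈ Rest, ρ ≠ ρ' → wf ρ = wf ρ' → df ρ ≠ df ρ') :
    Rest.card + 1 ≤ J.card ∧ ((∃ y ∈ C.S, y ∈ T b J ∧ ∀ j ∈ J, pmhalf (b.repr y j)) →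
      Rest.card ≤ 1) ∧ (Rest.Nonempty → ∃ j x, C.Sq b J j0 j x) := by
  classical
  have key : ∀ ρ, ∃ j, ∃ x, ρ ∈ Rest → C.Sq b J j0 j x ∧ x - wf ρ ∈ T b J ∧
      (df ρ = b j ∨ df ρ = -b j) := by
    intro ρ
    by_cases hρ : ρ ∈ Rest
    · obtain ⟨h1, h2, h3, h4, h5, h6⟩ := hR ρ hρ
      obtain ⟨g1, g2, g3⟩ := hW _ h1
      obtain ⟨j, x, h⟩ := hM.rest1 hj0 g1 g3 g2 h2 h3 h4 h5 h6
      exact ⟨j, x, fun _ => h⟩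
    · exact ⟨j0, 0, fun h => absurd h hρ⟩
  choose jf xf hk using key
  have hpar : ∀ ρ ∈ Rest, ∀ ρ' ∈ Rest, wf ρ ≠ wf ρ' → ∀ a : ℚ, xf ρ' - a • xf ρ ∉ T b J := by
    intro ρ hρ ρ' hρ' hne a hh
    apply hWp _ (hR ρ hρ).1 _ (hR ρ' hρ').1 hne a
    have h1 := (hk ρ hρ).2.1
    have h2 := (hk ρ' hρ').2.1
    have := add_mem (sub_mem hh h2) ((T b J).smul_mem a h1)
    convert this using 1; module
  have hinj : ∀ ρ ∈ Rest, ∀ ρ' ∈ Rest, ρ ≠ ρ' → jf ρ ≠ jf ρ' := by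
    intro ρ hρ ρ' hρ' hne
    by_cases hw : wf ρ = wf ρ'
    · intro hj
      have hd := hRi ρ hρ ρ' hρ' hne hw
      obtain ⟨h1, h2, h3, h4, h5, h6⟩ := hR ρ hρ
      obtain ⟨h1', h2', h3', h4', h5', h6'⟩ := hR ρ' hρ'
      have hd1 := hM.1.dabs h5 h5' (by
        intro hh; exact (hW _ h1).2.2 (by simpa using sub_mem hh h2))
        (by rw [← hw]; convert sub_mem h2' h2 using 1; abel) (jf ρ)
      have : wf ρ' + df ρ' - (wf ρ + df ρ) = df ρ' - df ρ := by rw [hw]; abel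
      rw [this] at hd1
      rcases (hk ρ hρ).2.2 with e | e <;> rcases (hk ρ' hρ').2.2 with e' | e' <;> rw [← hj] at e'
      · exact hd (e.trans e'.symm)
      · rw [e, e'] at hd1; norm_num at hd1
      · rw [e, e'] at hd1; norm_num at hd1
      · exact hd (e.trans e'.symm)
    · exact hM.sq_ne (hk ρ hρ).1 (hk ρ' hρ').1 (hpar ρ hρ ρ' hρ' hw)
  refine ⟨?_, ?_, ?_⟩
  · have : Rest.card ≤ (J.erase j0).card := by
      apply Finset.card_le_card_of_injOn jf
      · intro ρ hρ
        have := (hk ρ hρ).1.1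
        exact Finset.mem_coe.2 (Finset.mem_erase.2 ⟨this.2.2, this.2.1⟩)
      · intro ρ hρ ρ' hρ' h
        by_contra hne
        exact hinj ρ hρ ρ' hρ' hne h
    rw [Finset.card_erase_of_mem hj0] at this
    have := hM.2.2
    omega
  · rintro ⟨y, hy, hyT, hh⟩
    rw [Finset.card_le_one]
    intro ρ hρ ρ' hρ'
    by_contra hne
    by_cases hw : wf ρ = wf ρ'
    · obtain ⟨h1, h2, h3, h4, h5, h6⟩ := hR ρ hρ
      obtain ⟨h1', h2', h3', h4', h5', h6'⟩ := hR ρ' hρ'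
      have hjj := hinj ρ hρ ρ' hρ' hne
      have a1 := (hk ρ hρ).1.1
      have a2 := (hk ρ' hρ').1.1
      have e1 : wf ρ' + df ρ' - (wf ρ + df ρ + b j0) = df ρ' - df ρ - b j0 := by rw [hw]; abel
      have hn : wf ρ + df ρ + b j0 ∉ T b J := by
        intro hh
        have := sub_mem (sub_mem hh (B_mem_T b hj0)) h2
        exact (hW _ h1).2.2 (by simpa using this)
      refine hM.P2ne h6 h5' hn (by rw [e1]; exact sub_mem (sub_mem h2' h2) (B_mem_T b hj0))
        (hM.dint h6 h5' hj0 (k := -1) ?_) hj0 a1.2.1 a2.2.1 a1.2.2.symm a2.2.2.symm hjj ?_ ?_ ?_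
      · rw [e1]; simp [h4, h4']
      · rw [e1]; simp [h4, h4']
      · rw [e1]
        rcases (hk ρ hρ).2.2 with e | e <;> rcases (hk ρ' hρ').2.2 with e' | e' <;> rw [e, e'] <;>
          simp [a1.2.2, a2.2.2, hjj, hjj.symm, a1.2.2.symm]
      · rw [e1]
        rcases (hk ρ hρ).2.2 with e | e <;> rcases (hk ρ' hρ').2.2 with e' | e' <;> rw [e, e'] <;>
          simp [a1.2.2, a2.2.2, hjj, hjj.symm, a2.2.2.symm]
    · exact hM.sq_half (hk ρ hρ).1 (hk ρ' hρ').1 (hpar ρ hρ ρ' hρ' hw) hy hyT hh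
  · rintro ⟨ρ, hρ⟩
    exact ⟨_, _, (hk ρ hρ).1⟩

end

end TM
end

section
set_option linter.unusedSimpArgs false

namespace TM
variable {r : ℕ} {V : Type} [AddCommGroup V] [Module ℚ V]
open Module

section
variable {C : Cfg r V} {B b f : Basis (Fin r) ℚ V} {J : Finset (Fin r)} {j0 : Fin r}

theorem T_ext {x y : V} (hx : x ∈ T b J) (hy : y ∈ T b J) (h : ∀ j ∈ J, b.repr x j = b.repr y j) :
    x = y := by
  rw [sum_T hx, sum_T hy]
  exact Finset.sum_congr rfl fun j hj => by rw [h j hj]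

theorem repr_sum {η : Fin r → ℚ} {i : Fin r} (hi : i ∈ J) :
    b.repr (∑ j ∈ J, η j • b j) i = η i := by
  simp [Finsupp.single_apply, hi]

theorem half_scale {ι : Type*} {I : Finset ι} {j1 : ι} (h1 : j1 ∈ I) {p q : ι → ℚ}
    (hp : ∀ j ∈ I, pmhalf (p j)) (hq : ∀ j ∈ I, pmhalf (q j))
    (h : ∀ j ∈ I, j ≠ j1 → (p j = p j1 ↔ q j = q j1)) : ∃ s : ℚ, (s = 1 ∨ s = -1) ∧
      ∀ j ∈ I, p j = s * q j := by
  obtain ⟨s, hs, hs1⟩ := (hp j1 h1).ratio (hq j1 h1)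
  refine ⟨s, hs, fun j hj => ?_⟩
  by_cases hj1 : j = j1
  · rw [hj1]; exact hs1
  have := h j hj hj1
  rcases hp j hj with a | a <;> rcases hq j hj with c | c <;> rcases hp j1 h1 with a1 | a1 <;>
    rcases hq j1 h1 with c1 | c1 <;> rcases hs with rfl | rfl <;> rw [a1, c1] at hs1 <;>
    rw [a, c, a1, c1] at this <;> rw [a, c] <;> norm_num at *

theorem Cfg.X_eq {z z' : V} {s : ℚ} (hz : z ∈ C.X) (hz' : z' ∈ C.X) (h : z = s • z') : z = z' :=
  C.np z' hz' z hz s h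

theorem Cfg.Min.zt (hM : C.Min b J) (hj0 : j0 ∈ J) {Y ZT K : Finset V}
    (hY : Y ⊆ C.X) (hKY : K ⊆ Y) (hKj : ∀ j ∈ J, j ≠ j0 → b j ∈ K ∨ -b j ∈ K)
    (hY0 : ∀ y ∈ Y, ∀ a : ℚ, y ≠ a • b j0)
    (hYp : ∀ y ∈ Y, ∀ y' ∈ Y, y ≠ y' → ∀ a c : ℚ, y' ≠ a • y + c • b j0)
    (hZ : ZT ⊆ C.X) (hZT : ∀ z ∈ ZT, z ∈ T b J ∧ z ∉ Y ∧ (∀ a : ℚ, z ≠ a • b j0) ∧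
        ∃ y ∈ Y, ∃ a c : ℚ, a ≠ 0 ∧ c ≠ 0 ∧ z = a • y + c • b j0) :
    (∀ z ∈ ZT, ∀ j ∈ J, pmhalf (b.repr z j)) ∧
    (J.card = 2 → ZT.card ≤ 2 ∧ (2 ≤ ZT.card → C.AllH b J)) ∧
    (3 ≤ J.card → ZT.card ≤ 2 ^ (J.card - 2) ∧ (2 ^ (J.card - 2) ≤ ZT.card → C.AllH b J)) := by
  classical
  have hh : ∀ z ∈ ZT, ∀ j ∈ J, pmhalf (b.repr z j) := by
    intro z hz
    obtain ⟨h1, h2, h3, -⟩ := hZT z hz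
    rcases hM.P1 (Cfg.S_of_X (hZ hz)) h1 with ⟨j, hj, h⟩ | h
    swap
    · exact h
    exfalso
    by_cases hjj : j = j0
    · subst hjj
      rcases h with h | h
      · exact h3 1 (by simpa using h)
      · exact h3 (-1) (by simpa using h)
    · apply h2
      rcases hKj j hj hjj with hk | hk
      · have : z = b j := by
          rcases h with h | h
          · exact h
          · exact Cfg.X_np (hY (hKY hk)) (hZ hz) h
        rw [this]; exact hKY hk
      · have : z = -b j := by
          rcases h with h | h
          · exact Cfg.X_np (hY (hKY hk)) (hZ hz) (by simpa using h)
          · exact h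
        rw [this]; exact hKY hk
  obtain ⟨j1, hj1, hj10⟩ : ∃ j1 ∈ J, j1 ≠ j0 :=
    Finset.exists_mem_ne (by have := hM.2.2; omega) j0
  have hj1' : j1 ∈ J.erase j0 := Finset.mem_erase.2 ⟨hj10, hj1⟩
  refine ⟨hh, ?_, ?_⟩
  · intro hc
    let φ : V → Finset (Fin r) := fun z => (J.erase j1).filter fun j => b.repr z j = b.repr z j1
    have hcP : (J.erase j1).powerset.card = 2 := by
      rw [Finset.card_powerset, Finset.card_erase_of_mem hj1, hc]; norm_num
    have hmaps : ∀ z ∈ ZT, φ z ∈ (J.erase j1).powerset := by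
      intro z _; rw [Finset.mem_powerset]; exact Finset.filter_subset _ _
    have hinj : Set.InjOn φ ZT := by
      intro z hz z' hz' h
      obtain ⟨s, hs, hs'⟩ := half_scale hj1 (hh z hz) (hh z' hz') (by
        intro j hj hjj
        have := Finset.ext_iff.1 h j
        simpa [φ, hjj, hj] using this)
      refine Cfg.X_eq (hZ hz) (hZ hz') (T_ext (hZT z hz).1 ((T b J).smul_mem s (hZT z' hz').1) ?_)
      intro j hj
      rw [hs' j hj]; simp
    refine ⟨hcP ▸ Finset.card_le_card_of_injOn φ hmaps hinj, fun h2 η hη => ?_⟩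
    have himg : ZT.image φ = (J.erase j1).powerset := by
      apply Finset.eq_of_subset_of_card_le
      · intro P hP
        obtain ⟨z, hz, rfl⟩ := Finset.mem_image.1 hP
        exact hmaps z hz
      · rw [Finset.card_image_of_injOn hinj, hcP]; exact h2
    have hmem : ((J.erase j1).filter fun j => η j = η j1) ∈ ZT.image φ := by
      rw [himg, Finset.mem_powerset]; exact Finset.filter_subset _ _
    obtain ⟨z, hz, hzφ⟩ := Finset.mem_image.1 hmem
    obtain ⟨s, hs, hs'⟩ := half_scale hj1 hη (hh z hz) (by
        intro j hj hjj
        have := Finset.ext_iff.1 hzφ.symm j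
        simpa [φ, hjj, hj] using this)
    have : ∑ j ∈ J, η j • b j = s • z := by
      conv_rhs => rw [sum_T (hZT z hz).1]
      rw [Finset.smul_sum]
      refine Finset.sum_congr rfl fun j hj => ?_
      rw [hs' j hj, mul_smul]
    rw [this]
    rcases hs with rfl | rfl
    · simpa using Cfg.S_of_X (hZ hz)
    · simpa using Cfg.neg_mem (Cfg.S_of_X (hZ hz))
  · intro hc
    -- mates
    have mate : ∀ z ∈ ZT, ∃ y ∈ Y, ∃ a : ℚ, (a = 1 ∨ a = -1) ∧
        a • y = z - (2 * b.repr z j0) • b j0 := by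
      intro z hz
      obtain ⟨h1, h2, h3, y, hy, a, c, ha, hc0, hzy⟩ := hZT z hz
      have hyT : y ∈ T b J := by
        have : y = a⁻¹ • (z - c • b j0) := by
          rw [hzy, add_sub_cancel_right, smul_smul, inv_mul_cancel₀ ha, one_smul]
        rw [this]
        exact (T b J).smul_mem _ (sub_mem h1 ((T b J).smul_mem _ (B_mem_T b hj0)))
      have hzj : ∀ j, j ≠ j0 → b.repr z j = a * b.repr y j := by
        intro j hj; rw [hzy]; simp [Ne.symm hj]
      have hz0 : b.repr z j0 = a * b.repr y j0 + c := by rw [hzy]; simp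
      have hyh : ∀ j ∈ J, pmhalf (b.repr y j) := by
        rcases hM.P1 (Cfg.S_of_X (hY hy)) hyT with ⟨j, hj, h⟩ | h
        swap
        · exact h
        exfalso
        obtain ⟨l, hl⟩ : ∃ l, l ∈ (J.erase j0).erase j := by
          rw [← Finset.Nonempty, ← Finset.card_pos]
          have a1 := Finset.pred_card_le_card_erase (s := J) (a := j0)
          have a2 := Finset.pred_card_le_card_erase (s := J.erase j0) (a := j)
          omega
        simp only [Finset.mem_erase] at hl
        have hl1 := hh z hz l hl.2.2
        rw [hzj l hl.2.1] at hl1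
        have : b.repr y l = 0 := by
          rcases h with h | h <;> rw [h] <;> simp [Ne.symm hl.1]
        rw [this, mul_zero] at hl1
        rcases hl1 with h | h <;> norm_num at h
      have ha1 : a = 1 ∨ a = -1 := by
        have e := hzj j1 hj10
        rcases hh z hz j1 hj1 with h | h <;> rcases hyh j1 hj1 with h' | h' <;> rw [h, h'] at e
        · left; linarith
        · right; linarith
        · right; linarith
        · left; linarith
      refine ⟨y, hy, a, ha1, ?_⟩
      have : c = 2 * b.repr z j0 := by
        rcases hh z hz j0 hj0 with h | h <;> rcases hyh j0 hj0 with h' | h' <;>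
          rcases ha1 with rfl | rfl <;> rw [h, h'] at hz0 <;> rw [h] <;>
          first
          | linarith
          | exact absurd (by linarith) hc0
      rw [← this, hzy]; abel
    let φ : V → Finset (Fin r) := fun z =>
      ((J.erase j0).erase j1).filter fun j => b.repr z j = b.repr z j1
    have hcP : ((J.erase j0).erase j1).powerset.card = 2 ^ (J.card - 2) := by
      rw [Finset.card_powerset, Finset.card_erase_of_mem hj1', Finset.card_erase_of_mem hj0]
      rfl
    have hmaps : ∀ z ∈ ZT, φ z ∈ ((J.erase j0).erase j1).powerset := by
      intro z _; rw [Finset.mem_powerset]; exact Finset.filter_subset _ _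
    have hE : ∀ z ∈ ZT, ∀ j ∈ J.erase j0, pmhalf (b.repr z j) := fun z hz j hj =>
      hh z hz j (Finset.mem_of_mem_erase hj)
    have hinj : Set.InjOn φ ZT := by
      intro z hz z' hz' h
      obtain ⟨s, hs, hs'⟩ := half_scale hj1' (hE z hz) (hE z' hz') (by
        intro j hj hjj
        have := Finset.ext_iff.1 h j
        simp only [Finset.mem_erase] at hj
        simpa [φ, hjj, hj.1, hj.2] using this)
      have hzz : ∀ c : ℚ, b.repr z j0 = s * b.repr z' j0 + c → z = s • z' + c • b j0 := by
        intro c hc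
        refine T_ext (hZT z hz).1 (add_mem ((T b J).smul_mem s (hZT z' hz').1)
          ((T b J).smul_mem c (B_mem_T b hj0))) ?_
        intro j hj
        by_cases hjj : j = j0
        · subst hjj; rw [hc]; simp
        · rw [hs' j (Finset.mem_erase.2 ⟨hjj, hj⟩)]; simp [Ne.symm hjj]
      obtain ⟨s', hs1, hs2⟩ := (hh z hz j0 hj0).ratio (hh z' hz' j0 hj0)
      by_cases hss : s' = s
      · rw [hss] at hs2
        have := hzz 0 (by rw [hs2, add_zero])
        exact Cfg.X_eq (hZ hz) (hZ hz') (s := s) (by simpa using this)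
      · have hss : s' = - s := by
          rcases hs with rfl | rfl <;> rcases hs1 with rfl | rfl <;> first | exact absurd rfl hss | norm_num
        have e := hzz (2 * b.repr z j0) (by rw [hs2, hss]; ring)
        obtain ⟨y, hy, a, ha, hay⟩ := mate z hz
        obtain ⟨y', hy', a', ha', hay'⟩ := mate z' hz'
        have hyy : y = y' := by
          by_contra hne
          apply hYp y' hy' y hy (Ne.symm hne) (a * s * a') (a * s * (2 * b.repr z' j0))
          have e1 : a • a • y = y := by rcases ha with rfl | rfl <;> simp
          rw [← e1, hay, sub_eq_of_eq_add e]
          have : z' = a' • y' + (2 * b.repr z' j0) • b j0 := by rw [hay']; abel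
          conv_lhs => rw [this]
          module
        have e2 : z = (a * a') • z' := by
          have e1 : a' • a' • y = y := by rcases ha' with rfl | rfl <;> simp
          refine T_ext (hZT z hz).1 ((T b J).smul_mem _ (hZT z' hz').1) ?_
          rw [← hyy] at hay'
          intro j hj
          have q1 := congrArg (fun u => b.repr u j) hay
          have q2 := congrArg (fun u => b.repr u j) hay'
          simp [Finsupp.single_apply] at q1 q2 ⊢
          by_cases hjj : j = j0
          · subst hjj
            simp at q1 q2
            rcases ha with rfl | rfl <;> rcases ha' with rfl | rfl <;> linarith
          · simp [Ne.symm hjj] at q1 q2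
            rcases ha with rfl | rfl <;> rcases ha' with rfl | rfl <;> linarith
        exact Cfg.X_eq (hZ hz) (hZ hz') e2
    refine ⟨hcP ▸ Finset.card_le_card_of_injOn φ hmaps hinj, fun h2 η hη => ?_⟩
    have himg : ZT.image φ = ((J.erase j0).erase j1).powerset := by
      apply Finset.eq_of_subset_of_card_le
      · intro P hP
        obtain ⟨z, hz, rfl⟩ := Finset.mem_image.1 hP
        exact hmaps z hz
      · rw [Finset.card_image_of_injOn hinj, hcP]; exact h2
    have hmem : (((J.erase j0).erase j1).filter fun j => η j = η j1) ∈ ZT.image φ := by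
      rw [himg, Finset.mem_powerset]; exact Finset.filter_subset _ _
    obtain ⟨z, hz, hzφ⟩ := Finset.mem_image.1 hmem
    obtain ⟨s, hs, hs'⟩ := half_scale hj1' (fun j hj => hη j (Finset.mem_of_mem_erase hj))
      (hE z hz) (by
        intro j hj hjj
        have := Finset.ext_iff.1 hzφ.symm j
        simp only [Finset.mem_erase] at hj
        simpa [φ, hjj, hj.1, hj.2] using this)
    obtain ⟨s', hs1, hs2⟩ := (hη j0 hj0).ratio (hh z hz j0 hj0)
    have hT : ∑ j ∈ J, η j • b j ∈ T b J :=
      Submodule.sum_mem _ fun j hj => (T b J).smul_mem _ (B_mem_T b hj)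
    have hsm : ∀ u ∈ C.S, s • u ∈ C.S := by
      intro u hu
      rcases hs with rfl | rfl
      · simpa using hu
      · simpa using Cfg.neg_mem hu
    by_cases hss : s' = s
    · have : ∑ j ∈ J, η j • b j = s • z := by
        refine T_ext hT ((T b J).smul_mem _ (hZT z hz).1) ?_
        intro j hj
        rw [repr_sum hj]
        by_cases hjj : j = j0
        · subst hjj; rw [hs2, hss]; simp
        · rw [hs' j (Finset.mem_erase.2 ⟨hjj, hj⟩)]; simp
      rw [this]; exact hsm _ (Cfg.S_of_X (hZ hz))
    · have hss : s' = - s := by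
        rcases hs with rfl | rfl <;> rcases hs1 with rfl | rfl <;> first | exact absurd rfl hss | norm_num
      obtain ⟨y, hy, a, ha, hay⟩ := mate z hz
      have haS : a • y ∈ C.S := by
        rcases ha with rfl | rfl
        · simpa using Cfg.S_of_X (hY hy)
        · simpa using Cfg.neg_mem (Cfg.S_of_X (hY hy))
      have : ∑ j ∈ J, η j • b j = s • a • y := by
        rw [hay]
        refine T_ext hT ((T b J).smul_mem _ (sub_mem (hZT z hz).1
          ((T b J).smul_mem _ (B_mem_T b hj0)))) ?_
        intro j hj
        rw [repr_sum hj]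
        by_cases hjj : j = j0
        · subst hjj; rw [hs2, hss]; simp; ring
        · rw [hs' j (Finset.mem_erase.2 ⟨hjj, hj⟩)]; simp [Ne.symm hjj]
      rw [this]; exact hsm _ haS

end

theorem Cfg.Min.cj {C : Cfg (r + 1) V} {b : Basis (Fin (r + 1)) ℚ V} {J : Finset (Fin (r + 1))}
    (hM : C.Min b J) (h4 : J.card ≤ 4) {j0 : Fin (r + 1)} (hj0 : j0 ∈ J) :
    (∃ C' : Cfg r (Fin r → ℚ), (∃ B' J', C'.Odd B' J' ∧ J'.card + 1 ≤ J.card) ∧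
      C.X.card ≤ C'.X.card + r + 2) ∨
    ((J.card = 2 ∨ J.card = 4) ∧ C.AllH b J ∧ (∃ j x, C.Sq b J j0 j x) ∧
      ∃ f, C.JFr b J f ∧ ∀ i, i ∉ J → C.Wide b J j0 (f i)) := by
  classical
  obtain ⟨j1, hj1, hj10⟩ : ∃ j1 ∈ J, j1 ≠ j0 :=
    Finset.exists_mem_ne (by have := hM.2.2; omega) j0
  choose s hs hsX using fun j => Cfg.exists_X (hM.1.1 j)
  have hs0 : ∀ j, s j ≠ 0 := fun j => by rcases hs j with h | h <;> rw [h] <;> norm_num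
  let K : Finset V := (J.erase j0).image fun j => s j • b j
  have hKj : ∀ j ∈ J, j ≠ j0 → b j ∈ K ∨ -b j ∈ K := by
    intro j hj hjj
    have : s j • b j ∈ K := Finset.mem_image.2 ⟨j, Finset.mem_erase.2 ⟨hjj, hj⟩, rfl⟩
    rcases hs j with h | h <;> rw [h] at this
    · left; simpa using this
    · right; simpa using this
  obtain ⟨C', Y, ZT, W0, Rest, wf, df, hcard, ⟨hY, hKY, hY0, hYp⟩, ⟨hZ, hZT⟩, ⟨hW, hWp, hWc⟩,
    ⟨hR, hRi⟩, hodd⟩ := C.contract3 b J hM.1 j0 hj0 K (by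
      intro k hk
      obtain ⟨j, -, rfl⟩ := Finset.mem_image.1 hk
      exact hsX j) (by
      intro k hk a h
      obtain ⟨j, hj, rfl⟩ := Finset.mem_image.1 hk
      have := congrArg (fun x => b.repr x j) h
      simp [Ne.symm (Finset.ne_of_mem_erase hj)] at this
      exact hs0 j this) (by
      intro k hk k' hk' hne a c h
      obtain ⟨j, hj, rfl⟩ := Finset.mem_image.1 hk
      obtain ⟨j', hj', rfl⟩ := Finset.mem_image.1 hk'
      have hjj : j ≠ j' := by rintro rfl; exact hne rfl
      have := congrArg (fun x => b.repr x j') h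
      simp [Ne.symm (Finset.ne_of_mem_erase hj'), hjj] at this
      exact hs0 j' this) (by
      intro x hx y hy _ β h
      obtain ⟨k, hk⟩ := hM.dint hx hy hj1 (k := 0) (by rw [h]; simp [hj10.symm]) j0 hj0
      rw [h] at hk
      exact ⟨k, by simpa using hk⟩)
  obtain ⟨hh, hz2, hz3⟩ := hM.zt hj0 hY hKY hKj hY0 hYp hZ hZT
  obtain ⟨hR1, hR2, hR3⟩ := hM.restK hj0 hW hWp hR hRi
  by_cases hgood : ZT.card + W0.card + Rest.card ≤ r + 1
  · left
    obtain ⟨B', J', h1, h2⟩ := hodd J hM.1 hKj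
    refine ⟨C', ⟨B', J', h1, ?_⟩, by omega⟩
    rw [Finset.card_erase_of_mem hj0] at h2
    have := hM.2.2
    omega
  · right
    push Not at hgood
    have hne : ZT.Nonempty := by
      rw [← Finset.card_pos]; omega
    obtain ⟨z, hz⟩ := hne
    have hR2' := hR2 ⟨z, Cfg.S_of_X (hZ hz), (hZT z hz).1, hh z hz⟩
    have h2 := hM.2.2
    have hc : J.card = 2 ∨ J.card = 3 ∨ J.card = 4 := by omega
    have hfin : (J.card = 2 ∨ J.card = 4) ∧ C.AllH b J ∧ 1 ≤ Rest.card ∧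
        W0.card + J.card = r + 1 := by
      rcases hc with hc | hc | hc
      · obtain ⟨a1, a2⟩ := hz2 hc
        exact ⟨Or.inl hc, a2 (by omega), by omega, by omega⟩
      · obtain ⟨a1, a2⟩ := hz3 (by omega)
        rw [hc] at a1
        norm_num at a1
        omega
      · obtain ⟨a1, a2⟩ := hz3 (by omega)
        rw [hc] at a1 a2
        norm_num at a1 a2
        exact ⟨Or.inr hc, a2 (by omega), by omega, by omega⟩
    obtain ⟨g1, g2, g3, g4⟩ := hfin
    refine ⟨g1, g2, hR3 (Finset.card_pos.1 g3), ?_⟩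
    have hwide : ∀ w ∈ W0, C.Wide b J j0 w := by
      intro w hw
      obtain ⟨h1, h2, h3⟩ := hW w hw
      exact ⟨w, h1, w + b j0, h2, by simp, by simpa using B_mem_T b hj0, by simp⟩
    obtain ⟨f, hf, hfi⟩ := hM.1.L1 j0 W0 (fun w hw => (hW w hw).1) (fun w hw => (hW w hw).2.2)
      hwide hWp
    refine ⟨f, hf, ?_⟩
    have : W0 = (Jᶜ).image f := by
      apply Finset.eq_of_subset_of_card_le
      · intro w hw
        obtain ⟨i, hi, rfl⟩ := hfi w hw
        exact Finset.mem_image.2 ⟨i, Finset.mem_compl.2 hi, rfl⟩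
      · refine Finset.card_image_le.trans ?_
        rw [Finset.card_compl, Fintype.card_fin]; omega
    intro i hi
    apply hwide
    rw [this]
    exact Finset.mem_image.2 ⟨i, Finset.mem_compl.2 hi, rfl⟩

end TM
end

section
set_option linter.unusedSimpArgs false

namespace TM
variable {r : ℕ} {V : Type} [AddCommGroup V] [Module ℚ V]
open Module

section
variable {C : Cfg r V} {B b f : Basis (Fin r) ℚ V} {J : Finset (Fin r)} {j0 : Fin r}

theorem Cfg.Sq.jfr {j : Fin r} {x : V} (h : C.Sq b J j0 j x) (hf : C.JFr b J f) :
    C.Sq f J j0 j x := by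
  obtain ⟨⟨h1, h2, h3⟩, h4, h5, h6, h7, h8⟩ := h
  refine ⟨⟨h1, h2, h3⟩, ?_, h5, ?_, ?_, ?_⟩
  · rwa [hf.T_eq]
  · rwa [hf.2 _ h1]
  · rwa [hf.2 _ h2]
  · rwa [hf.2 _ h2, hf.2 _ h1]

theorem Cfg.AllH.jfr (h : C.AllH b J) (hf : C.JFr b J f) : C.AllH f J := by
  intro η hη
  convert h η hη using 1
  exact Finset.sum_congr rfl fun j hj => by rw [hf.2 j hj]

theorem Cfg.Wide.jfr {j : Fin r} {z : V} (h : C.Wide b J j z) (hf : C.JFr b J f) :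
    C.Wide f J j z := by
  obtain ⟨x, hx, y, hy, h1, h2, h3⟩ := h
  refine ⟨x, hx, y, hy, ?_, ?_, ?_⟩
  · rwa [hf.T_eq]
  · rwa [hf.T_eq]
  · rwa [hf.repr_T]
    have := sub_mem h2 h1
    convert this using 1; abel

theorem Cfg.wide_of {j : Fin r} {z d : V} (hz : z ∈ C.S) (hd : d ∈ T b J) (h : z + d ∈ C.S)
    (hj : 1 ≤ |b.repr d j|) : C.Wide b J j z := by
  rcases le_abs.1 hj with h1 | h1
  · exact ⟨z, hz, z + d, h, by simp, by simpa using hd, by simpa using h1⟩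
  · exact ⟨z + d, h, z, hz, by simpa using hd, by simp, by simpa using h1⟩

theorem Cfg.Odd.full_single (hO : C.Odd b J) (hf : C.JFr b J f) {j : Fin r}
    (hW : ∀ i, i ∉ J → C.Wide b J j (f i)) {z : V} (hz : z ∈ C.S) (hzT : z ∉ T b J) :
    (∃ i, i ∉ J ∧ ∃ s : ℚ, (s = 1 ∨ s = -1) ∧ z - s • f i ∈ T b J) ∨
      ∀ z' ∈ C.S, z' - z ∈ T b J → b.repr (z' - z) j = 0 := by
  obtain ⟨i, hi, h0⟩ := exists_out (b := f) (J := J) (z := z) (by rwa [hf.T_eq])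
  by_cases h2 : ∃ i2, i2 ∉ J ∧ i ≠ i2 ∧ f.repr z i2 ≠ 0
  · obtain ⟨i2, hi2, hne, h20⟩ := h2
    right
    intro z' hz' hT
    apply le_antisymm
    · exact hO.wide2 hf hz hz' hT hi hi2 hne (hW i hi) (hW i2 hi2) h0 h20
    · have hT' : z - z' ∈ T b J := by rw [← neg_sub]; exact (T b J).neg_mem hT
      have := hO.wide2 hf (j := j) hz' hz hT' hi hi2 hne (hW i hi) (hW i2 hi2)
        (by rwa [hf.repr_out hT hi]) (by rwa [hf.repr_out hT hi2])
      rw [← neg_sub, map_neg, Finsupp.neg_apply] at this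
      linarith
  · push Not at h2
    left
    refine ⟨i, hi, f.repr z i, ((hf.odd hO).outer hz hi).resolve_left h0, ?_⟩
    rw [← hf.T_eq, mem_T]
    intro k hk
    by_cases hki : k = i
    · subst hki; simp
    · simp [h2 k hk (Ne.symm hki), Ne.symm hki]

theorem Cfg.Odd.wide_single (hO : C.Odd b J) (hf : C.JFr b J f) {j : Fin r}
    (hW : ∀ i, i ∉ J → C.Wide b J j (f i)) {z : V} (hzT : z ∉ T b J)
    (hz : C.Wide b J j z) : ∃ i, i ∉ J ∧ ∃ s : ℚ, (s = 1 ∨ s = -1) ∧ z - s • f i ∈ T b J := by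
  obtain ⟨x, hx, y, hy, h1, h2, h3⟩ := hz
  have hxT : x ∉ T b J := notT_sub hzT h1
  rcases hO.full_single hf hW hx hxT with ⟨i, hi, s, hs, h⟩ | h
  · refine ⟨i, hi, s, hs, ?_⟩
    have := sub_mem h h1
    convert this using 1; abel
  · have := h y hy (by convert sub_mem h2 h1 using 1; abel)
    rw [this] at h3; norm_num at h3

theorem Cfg.Odd.F1 (hO : C.Odd b J) (hf : C.JFr b J f) {j : Fin r}
    (hW : ∀ i, i ∉ J → C.Wide b J j (f i)) {z : V} (hz : z ∈ C.S) (hzT : z ∉ T b J) :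
    C.Wide b J j z ∨ ∀ z' ∈ C.S, z' - z ∈ T b J → b.repr (z' - z) j = 0 := by
  rcases hO.full_single hf hW hz hzT with ⟨i, hi, s, hs, h⟩ | h
  · left
    have h' : s • f i - z ∈ T b J := by rw [← neg_sub]; exact (T b J).neg_mem h
    rcases hs with rfl | rfl
    · exact (hW i hi).shift (by simpa using h')
    · exact (hW i hi).neg.shift (by simpa using h')
  · exact Or.inr h

/-- coordinates of the `T`-part in a frame containing `p, q` -/
theorem Cfg.Odd.frame_repr (hO : C.Odd b J) {p q z : V} (hp : p ∈ C.S) (hq : q ∈ C.S)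
    (hpT : p ∉ T b J)
    (hpq : ∀ a : ℚ, q - a • p ∉ T b J) {α β : ℚ} (hz : z - (α • p + β • q) ∈ T b J) :
    ∃ f, C.JFr b J f ∧ ∀ j ∈ J, f.repr z j = b.repr (z - (α • p + β • q)) j := by
  obtain ⟨f, i1, i2, hf, h1, h2, h12, e1, e2⟩ := hO.frame2 hp hq hpT hpq
  refine ⟨f, hf, fun j hj => ?_⟩
  rw [hf.repr_add hz, ← e1, ← e2]
  have n1 : i1 ≠ j := by rintro rfl; exact h1 hj
  have n2 : i2 ≠ j := by rintro rfl; exact h2 hj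
  simp [n1, n2]

theorem Cfg.Odd.frame_abs (hO : C.Odd b J) {p q z : V} (hp : p ∈ C.S) (hq : q ∈ C.S)
    (hz : z ∈ C.S) (hpT : p ∉ T b J)
    (hpq : ∀ a : ℚ, q - a • p ∉ T b J) {α β : ℚ} (hT : z - (α • p + β • q) ∈ T b J)
    {j : Fin r} (hj : j ∈ J) : |b.repr (z - (α • p + β • q)) j| ≤ 1 := by
  obtain ⟨f, hf, h⟩ := hO.frame_repr hp hq hpT hpq hT
  rw [← h j hj]
  exact (hf.odd hO).abs_le hz j

end

theorem Cfg.Min.lemV {C : Cfg (r + 1) V} {b : Basis (Fin (r + 1)) ℚ V} {J : Finset (Fin (r + 1))}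
    (hM : C.Min b J) (hA : C.AllH b J) (hSq : ∀ j ∈ J, ∃ l x, C.Sq b J j l x)
    {i j1 : Fin (r + 1)} (hi : i ∉ J) (hj1 : j1 ∈ J) (hv1 : b i + b j1 ∈ C.S)
    (hfib : ∀ z ∈ C.S, z - b i ∈ T b J → z = b i ∨ z = b i + b j1) :
    ∃ C' : Cfg r (Fin r → ℚ), C.X.card ≤ C'.X.card + 1 + r := by
  classical
  set v := b i with hv
  have hvS : v ∈ C.S := hM.1.1 i
  have hvT : v ∉ T b J := by
    intro h
    have := mem_T.1 h i hi
    rw [hv] at this; simp at this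
  have hO2 : C.Odd b (insert i J) := hM.1.mono (Finset.subset_insert _ _)
  have hbj1 := B_mem_T b hj1
  obtain ⟨C', Y, ZT, W0, Rest, wf, df, hcard, ⟨hY, hKY, hY0, hYp⟩, ⟨hZ, hZT⟩, ⟨hW, hWp, hWc⟩,
    ⟨hR, hRi⟩, -⟩ := C.contract3 b (insert i J) hO2 i (Finset.mem_insert_self _ _)
      (C.X.filter fun x => x ∈ T b J) (Finset.filter_subset _ _) (by
      intro k hk a h
      obtain ⟨hk1, hk2⟩ := Finset.mem_filter.1 hk
      have : a = 0 := by
        have := mem_T.1 hk2 i hi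
        rw [h] at this; simpa using this
      rw [this, zero_smul] at h
      exact C.nz k hk1 h) (by
      intro k hk k' hk' hne a c h
      obtain ⟨hk1, hk2⟩ := Finset.mem_filter.1 hk
      obtain ⟨hk1', hk2'⟩ := Finset.mem_filter.1 hk'
      have : c = 0 := by
        have e1 := mem_T.1 hk2 i hi
        have := mem_T.1 hk2' i hi
        rw [h] at this; simpa [e1] using this
      rw [this, zero_smul, add_zero] at h
      exact hne (C.np k hk1 k' hk1' a h).symm) (by
      intro x hx y hy _ β h
      have := congrArg (fun x => b.repr x i) h
      simp at this
      rcases hM.1.outer hx hi with h1 | h1 | h1 <;>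
      rcases hM.1.outer hy hi with h2 | h2 | h2 <;>
      rw [h1, h2] at this
      · exact ⟨0, by rw [← this]; norm_num⟩
      · exact ⟨1, by rw [← this]; norm_num⟩
      · exact ⟨-1, by rw [← this]; norm_num⟩
      · exact ⟨-1, by rw [← this]; norm_num⟩
      · exact ⟨0, by rw [← this]; norm_num⟩
      · exact ⟨-2, by rw [← this]; norm_num⟩
      · exact ⟨1, by rw [← this]; norm_num⟩
      · exact ⟨2, by rw [← this]; norm_num⟩
      · exact ⟨0, by rw [← this]; norm_num⟩)
  refine ⟨C', ?_⟩
  simp only [← hv] at hY0 hYp hZT hW hR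
  have hZ1 : ZT.card ≤ 1 := by
    have key : ∀ z ∈ ZT, ∃ s : ℚ, (s = 1 ∨ s = -1) ∧ z = s • (v + b j1) := by
      intro z hz
      obtain ⟨h1, h2, h3, -⟩ := hZT z hz
      have hzS := Cfg.S_of_X (hZ hz)
      have hzT : z ∉ T b J := fun h => h2 (hKY (Finset.mem_filter.2 ⟨hZ hz, h⟩))
      have hT : z - b.repr z i • v ∈ T b J := by
        rw [mem_T]
        intro k hk
        by_cases hki : k = i
        · subst hki; rw [hv]; simp
        · rw [hv]; simp [Ne.symm hki, mem_T.1 h1 k (by simp [hki, hk])]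
      have h0 : b.repr z i ≠ 0 := by
        intro h0; rw [h0, zero_smul, sub_zero] at hT; exact hzT hT
      rcases (hM.1.outer hzS hi).resolve_left h0 with h | h <;> rw [h] at hT
      · refine ⟨1, Or.inl rfl, ?_⟩
        rcases hfib z hzS (by simpa using hT) with h' | h'
        · exact absurd (by simpa using h') (h3 1)
        · simpa using h'
      · refine ⟨-1, Or.inr rfl, ?_⟩
        rcases hfib (-z) (Cfg.neg_mem hzS) (by
          have := (T b J).neg_mem hT
          convert this using 1; module) with h' | h'
        · exact absurd (by rw [← h']; simp) (h3 (-1))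
        · rw [← h']; simp
    rw [Finset.card_le_one]
    intro z hz z' hz'
    obtain ⟨s, hs, h⟩ := key z hz
    obtain ⟨s', hs', h'⟩ := key z' hz'
    refine Cfg.X_eq (hZ hz) (hZ hz') (s := s * s') ?_
    rw [h, h']
    rcases hs with rfl | rfl <;> rcases hs' with rfl | rfl <;> module
  have hWn : ∀ w ∈ W0, (∀ a : ℚ, w - a • v ∉ T b J) ∧ w ∉ T b J := by
    intro w hw
    have h1 : ∀ a : ℚ, w - a • v ∉ T b J := fun a h => (hW w hw).2.2 (T_insert_of h)
    exact ⟨h1, by simpa using h1 0⟩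
  have key : ∀ ρ, ∃ j, ρ ∈ Rest → df ρ ∈ T b J ∧ j ∈ J.erase j1 ∧ (df ρ = b j ∨ df ρ = -b j) := by
    intro ρ
    by_cases hρ : ρ ∈ Rest
    swap
    · exact ⟨j1, fun h => absurd h hρ⟩
    obtain ⟨h1, h2, h3, h4, h5, h6⟩ := hR ρ hρ
    obtain ⟨g1, g2, -⟩ := hW _ h1
    obtain ⟨g3, g4⟩ := hWn _ h1
    set w := wf ρ with hw
    set d := df ρ with hd
    have hdT : d ∈ T b J := by
      rw [mem_T]; intro k hk
      by_cases hki : k = i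
      · subst hki; exact h4
      · exact mem_T.1 h2 k (by simp [hki, hk])
    have hvw : ∀ a : ℚ, v - a • w ∉ T b J := fun a h => g3 _ (par_symm hvT h)
    have hd1 : b.repr d j1 = 0 := by
      by_contra hne
      rcases lt_or_gt_of_ne hne with hlt | hgt
      · have e : w + d + v - ((1 : ℚ) • w + (1 : ℚ) • (v + b j1)) = d - b j1 := by module
        have := hM.1.frame_abs g1 hv1 h6 g4 (α := 1) (β := 1) (by
          intro a hh; apply hvw a; have := sub_mem hh hbj1; convert this using 1; abel)
          (by rw [e]; exact sub_mem hdT hbj1) hj1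
        rw [e, _root_.abs_le] at this
        simp at this
        linarith [this.1]
      · have e : w + v - ((1 : ℚ) • (w + d) + (1 : ℚ) • (v + b j1)) = - d - b j1 := by module
        have := hM.1.frame_abs h5 hv1 g2 (by
            intro hh; exact g4 (by simpa using sub_mem hh hdT)) (α := 1) (β := 1) (by
          intro a hh; apply hvw a
          have := add_mem (sub_mem hh hbj1) ((T b J).smul_mem a hdT)
          convert this using 1; module)
          (by rw [e]; exact sub_mem ((T b J).neg_mem hdT) hbj1) hj1
        rw [e, _root_.abs_le] at this
        simp at this
        linarith [this.1]
    have ed : w + d - w = d := by abel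
    have hint := hM.dint g1 h5 hj1 (k := 0) (by rw [ed]; simpa using hd1)
    obtain ⟨j, hj, hdj⟩ : ∃ j ∈ J, b.repr d j ≠ 0 := by
      by_contra hcon
      push Not at hcon
      apply h3
      rw [sum_T hdT]
      exact Finset.sum_eq_zero fun j hj => by rw [hcon j hj, zero_smul]
    have hjj : j ≠ j1 := by rintro rfl; exact hdj hd1
    obtain ⟨e, he, h⟩ := hM.P2form g1 h5 g4 (by rw [ed]; exact hdT) hint hj (by rw [ed]; exact hdj)
    rw [ed] at h
    refine ⟨j, fun _ => ⟨hdT, Finset.mem_erase.2 ⟨hjj, hj⟩, ?_⟩⟩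
    rcases h with h | ⟨l, hl, hlj, e', he', h⟩
    · rcases he with rfl | rfl
      · left; simpa using h
      · right; simpa using h
    · exfalso
      obtain ⟨l', x, hx⟩ := hSq j hj
      have hxT := hx.2.1
      by_cases hpar : ∀ a : ℚ, w - a • x ∉ T b J
      · exact hA.Q hM hx hl hlj g1 h5 hpar he he' (by rw [ed]; exact h)
      · push Not at hpar
        obtain ⟨a, ha⟩ := hpar
        refine hA.Q hM hx hl hlj g2 h6 ?_ he he' (by rw [← h]; abel)
        intro a' ha'
        have h7 : v - (a' - a) • x ∈ T b J := by
          have := sub_mem ha' ha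
          convert this using 1; module
        have h8 := par_symm hvT h7
        apply g3 (a * (a' - a)⁻¹)
        have := add_mem ha ((T b J).smul_mem a h8)
        convert this using 1
        module
  choose jf hk using key
  have habs : ∀ ρ ∈ Rest, 1 ≤ |b.repr (df ρ) (jf ρ)| := by
    intro ρ hρ
    rcases (hk ρ hρ).2.2 with h | h <;> rw [h] <;> simp
  have hRest : Rest.card ≤ (J.erase j1).card := by
    apply Finset.card_le_card_of_injOn jf
    · intro ρ hρ; exact Finset.mem_coe.2 (hk ρ hρ).2.1
    intro ρ hρ ρ' hρ' hj
    by_contra hne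
    obtain ⟨h1, h2, h3, h4, h5, h6⟩ := hR ρ hρ
    obtain ⟨h1', h2', h3', h4', h5', h6'⟩ := hR ρ' hρ'
    obtain ⟨hd, hjJ, hdb⟩ := hk ρ hρ
    obtain ⟨hd', hjJ', hdb'⟩ := hk ρ' hρ'
    by_cases hw : wf ρ = wf ρ'
    · have hdd := hRi ρ hρ ρ' hρ' hne hw
      have hd1 := hM.1.dabs h5 h5' (by
        intro hh; exact (hWn _ h1).2 (by simpa using sub_mem hh hd))
        (by rw [← hw]; convert sub_mem hd' hd using 1; abel) (jf ρ)
      have : wf ρ' + df ρ' - (wf ρ + df ρ) = df ρ' - df ρ := by rw [hw]; abel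
      rw [this] at hd1
      rcases hdb with e | e <;> rcases hdb' with e' | e' <;> rw [← hj] at e'
      · exact hdd (e.trans e'.symm)
      · rw [e, e'] at hd1; norm_num at hd1
      · rw [e, e'] at hd1; norm_num at hd1
      · exact hdd (e.trans e'.symm)
    · obtain ⟨g, i1, i2, hg, n1, n2, n12, e1, e2⟩ := hO2.frame2 (hW _ h1).1 (hW _ h1').1
        (hW _ h1).2.2 (hWp _ h1 _ h1' hw)
      simp only [Finset.mem_insert, not_or] at n1 n2
      have hgi : g i = v := (hg.2 i (Finset.mem_insert_self _ _))
      have hgJ : C.JFr b J g := hg.mono (Finset.subset_insert _ _)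
      obtain ⟨g', hg', q1, q2⟩ := hgJ.pivot (hW _ h1).2.1 hi (by
        rw [← e1, ← hgi]; simp [n1.1])
      have w1 : C.Wide b J (jf ρ) (g' i1) := by
        rw [q2 i1 n1.1, e1]; exact Cfg.wide_of (hW _ h1).1 hd h5 (habs ρ hρ)
      have habs' : 1 ≤ |b.repr (df ρ') (jf ρ)| := by rw [hj]; exact habs ρ' hρ'
      have w2 : C.Wide b J (jf ρ) (g' i2) := by
        rw [q2 i2 n2.1, e2]; exact Cfg.wide_of (hW _ h1').1 hd' h5' habs'
      have ez : wf ρ' + v = g' i2 + g' i - g' i1 := by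
        rw [q1, q2 i1 n1.1, q2 i2 n2.1, e1, e2]; abel
      have c1 : g'.repr (wf ρ' + v) i1 ≠ 0 := by
        rw [ez]; simp [n12.symm, Ne.symm n1.1]
      have c2 : g'.repr (wf ρ' + v) i2 ≠ 0 := by
        rw [ez]; simp [n12, Ne.symm n2.1]
      have ed : wf ρ' + df ρ' + v - (wf ρ' + v) = df ρ' := by abel
      have ed' : wf ρ' + v - (wf ρ' + df ρ' + v) = - df ρ' := by abel
      have a1 := hM.1.wide2 hg' (hW _ h1').2.1 h6' (by rw [ed]; exact hd') n1.2 n2.2 n12 w1 w2 c1 c2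
      have a2 := hM.1.wide2 hg' h6' (hW _ h1').2.1 (by rw [ed']; exact (T b J).neg_mem hd')
        n1.2 n2.2 n12 w1 w2
        (by rwa [hg'.repr_out (by rw [ed]; exact hd') n1.2])
        (by rwa [hg'.repr_out (by rw [ed]; exact hd') n2.2])
      rw [ed] at a1
      rw [ed', map_neg, Finsupp.neg_apply] at a2
      have : b.repr (df ρ') (jf ρ) = 0 := by linarith
      rw [this] at habs'
      norm_num at habs'
  rw [Finset.card_erase_of_mem hj1] at hRest
  rw [Finset.card_insert_of_notMem hi] at hWc
  have := hM.2.2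
  omega

/-- version without a prescribed frame -/
theorem Cfg.Min.lemV' {C : Cfg (r + 1) V} {b : Basis (Fin (r + 1)) ℚ V} {J : Finset (Fin (r + 1))}
    (hM : C.Min b J) (hA : C.AllH b J) (hSq : ∀ j ∈ J, ∃ l x, C.Sq b J j l x)
    {v : V} {j1 : Fin (r + 1)} (hv : v ∈ C.S) (hvT : v ∉ T b J) (hj1 : j1 ∈ J)
    (hv1 : v + b j1 ∈ C.S)
    (hfib : ∀ z ∈ C.S, z - v ∈ T b J → z = v ∨ z = v + b j1) :
    ∃ C' : Cfg r (Fin r → ℚ), C.X.card ≤ C'.X.card + 1 + r := by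
  obtain ⟨f, i, hi, hfi, hf, -⟩ := hM.1.ext hv hvT
  refine (hM.jfr hf).lemV (hA.jfr hf) (fun j hj => ?_) hi hj1 ?_ ?_
  · obtain ⟨l, x, h⟩ := hSq j hj
    exact ⟨l, x, h.jfr hf⟩
  · rwa [hfi, hf.2 j1 hj1]
  · rw [hfi, hf.2 j1 hj1, hf.T_eq]; exact hfib

end TM
end

section
set_option linter.unusedSimpArgs false

namespace TM
variable {r : ℕ} {V : Type} [AddCommGroup V] [Module ℚ V]
open Module

section
variable {C : Cfg r V} {B b f : Basis (Fin r) ℚ V} {J : Finset (Fin r)} {j0 : Fin r}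

theorem one_of_wide (hO : C.Odd b J) {x y : V} {j : Fin r} (hx : x ∈ C.S) (hy : y ∈ C.S)
    (hxT : x ∉ T b J) (hT : y - x ∈ T b J) (h : 1 ≤ b.repr (y - x) j) : b.repr (y - x) j = 1 :=
  le_antisymm (hO.width hx hy hxT hT j) h

/-- unit pair in a wide fibre, if differences of two axis type are excluded -/
theorem Cfg.Min.unit_pair (hM : C.Min b J) {q : V} {j : Fin r} (hj : j ∈ J) (hqT : q ∉ T b J)
    (hW : C.Wide b J j q)
    (hex : ∀ z ∈ C.S, ∀ z' ∈ C.S, z - q ∈ T b J → ∀ l ∈ J, l ≠ j → ∀ α β : ℚ, (α = 1 ∨ α = -1) →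
      (β = 1 ∨ β = -1) → z' - z = α • b j + β • b l → False) :
    ∃ u ∈ C.S, u + b j ∈ C.S ∧ u - q ∈ T b J := by
  obtain ⟨x, hx, y, hy, h1, h2, h3⟩ := hW
  have hxT := notT_sub hqT h1
  have hT : y - x ∈ T b J := by convert sub_mem h2 h1 using 1; abel
  have h4 := one_of_wide hM.1 hx hy hxT hT h3
  have hint := hM.dint hx hy hj (k := 1) (by rw [h4]; norm_num)
  obtain ⟨e, he, h⟩ := hM.P2form hx hy hxT hT hint hj (by rw [h4]; norm_num)
  rcases h with h | ⟨l, hl, hlj, e', he', h⟩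
  · rw [h] at h4
    have he1 : e = 1 := by simpa using h4
    rw [he1, one_smul] at h
    exact ⟨x, hx, by rw [← h]; simpa using hy, h1⟩
  · exact (hex x hx y hy h1 l hl hlj e e' he he' h).elim

/-- integral part of a fibre -/
theorem Cfg.Min.fib_int (hM : C.Min b J) {w z : V} {j : Fin r} (hj : j ∈ J) (hw : w ∈ C.S)
    (hwT : w ∉ T b J) (hw1 : w + b j ∈ C.S) (hz : z ∈ C.S) (hzw : z - w ∈ T b J)
    (hint : ∀ j ∈ J, ∃ k : ℤ, b.repr (z - w) j = k)
    (hex : ∀ i ∈ J, ∀ y ∈ C.S, ∀ y' ∈ C.S, y - w ∈ T b J → ∀ l ∈ J, l ≠ i → ∀ α β : ℚ,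
      (α = 1 ∨ α = -1) →
      (β = 1 ∨ β = -1) → y' - y = α • b i + β • b l → False) :
    z = w ∨ z = w + b j := by
  by_cases hd : z - w = 0
  · left; exact sub_eq_zero.1 hd
  right
  obtain ⟨i, hi, hdi⟩ : ∃ i ∈ J, b.repr (z - w) i ≠ 0 := by
    by_contra hcon
    push Not at hcon
    apply hd
    rw [sum_T hzw]
    exact Finset.sum_eq_zero fun j hj => by rw [hcon j hj, zero_smul]
  obtain ⟨e, he, h⟩ := hM.P2form hw hz hwT hzw hint hi hdi
  rcases h with h | ⟨l, hl, hlj, e', he', h⟩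
  · by_cases hij : i = j
    · subst hij
      rcases he with rfl | rfl
      · rw [one_smul] at h; rw [← h]; abel
      · exfalso
        have e1 : z - (w + b i) = (-2 : ℚ) • b i := by
          have : z - (w + b i) = (z - w) - b i := by abel
          rw [this, h]; module
        have := hM.1.dabs hw1 hz (by
          intro hh; exact hwT (by simpa using sub_mem hh (B_mem_T b hi)))
          (by rw [e1]; exact (T b J).smul_mem _ (B_mem_T b hi)) i
        rw [e1] at this
        norm_num at this
    · exfalso
      refine hex i hi (w + b j) hw1 z hz (by simpa using B_mem_T b hj) j hj (Ne.symm hij) e (-1) he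
        (Or.inr rfl) ?_
      have : z - (w + b j) = (z - w) - b j := by abel
      rw [this, h]; module
  · exact (hex i hi w hw z hz (by simp) l hl hlj e e' he he' h).elim

theorem Cfg.Odd.shift2 (hO : C.Odd b J) (hf : C.JFr b J f) {i0 i : Fin r} (h0 : i0 ∉ J) (hi : i ∉ J)
    (hne : i ≠ i0) {p q : V} (hp : p ∈ C.S) (hq : q ∈ C.S) (hpT : p - f i0 ∈ T b J)
    (hqT : q - f i ∈ T b J) (z : V) : ∃ g, C.JFr b J g ∧ ∀ j, g.repr z j =
      f.repr z j - f.repr z i0 * b.repr (p - f i0) j - f.repr z i * b.repr (q - f i) j := by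
  classical
  obtain ⟨g, hg, -, h⟩ := hf.shift (fun k => if k = i0 then p - f i0 else if k = i then q - f i
    else 0) (by
      intro k
      split_ifs
      · exact hpT
      · exact hqT
      · exact zero_mem _) (by
      intro j hj
      rw [if_neg (by rintro rfl; exact h0 hj), if_neg (by rintro rfl; exact hi hj)]) (by
      intro k
      split_ifs with h1 h2
      · rw [h1]; simpa using hp
      · rw [h2]; simpa using hq
      · simpa using hf.1 k)
  refine ⟨g, hg, fun j => ?_⟩
  rw [h, ← Finset.add_sum_erase _ _ (Finset.mem_univ i0), ← Finset.add_sum_erase _ _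
    (Finset.mem_erase.2 ⟨hne, Finset.mem_univ i⟩), Finset.sum_eq_zero]
  · simp [hne]; ring
  · intro k hk
    simp only [Finset.mem_erase, Finset.mem_univ, and_true] at hk
    simp [hk.1, hk.2]

end

section
variable {C : Cfg (r + 1) V} {b f : Basis (Fin (r + 1)) ℚ V} {J : Finset (Fin (r + 1))}

theorem Cfg.Min.bad4 (hM : C.Min b J) (hA : C.AllH b J) (h3 : 3 ≤ J.card)
    (hr : 2 * J.card ≤ r)
    (hSq : ∀ j ∈ J, ∃ l x, C.Sq b J j l x)
    (hF : ∀ j ∈ J, ∃ f, C.JFr b J f ∧ ∀ i, i ∉ J → C.Wide b J j (f i)) :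
    ∃ C' : Cfg r (Fin r → ℚ), C.X.card ≤ C'.X.card + 1 + r := by
  classical
  obtain ⟨j1, j2, j3, hj1, hj2, hj3, h12, h13, h23⟩ := Finset.two_lt_card_iff.1
    (show 2 < J.card by omega)
  have hSq' : ∀ j, ∃ l x, j ∈ J → C.Sq b J j l x := by
    intro j
    by_cases hj : j ∈ J
    · obtain ⟨l, x, h⟩ := hSq j hj; exact ⟨l, x, fun _ => h⟩
    · exact ⟨j, 0, fun h => absurd h hj⟩
  choose lf xf hsq using hSq'
  obtain ⟨f, hf, hW⟩ := hF j1 hj1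
  obtain ⟨i, hi, hnp⟩ : ∃ i, i ∉ J ∧ ∀ j ∈ J, ∀ a : ℚ, f i - a • xf j ∉ T b J := by
    by_contra hcon
    push Not at hcon
    choose! jj hjJ a ha using hcon
    have : Jᶜ.card ≤ J.card := by
      apply Finset.card_le_card_of_injOn jj
      · intro i hi; exact hjJ i (by simpa using hi)
      · intro i hi i' hi' h
        have hi : i ∉ J := by simpa using hi
        have hi' : i' ∉ J := by simpa using hi'
        by_contra hne
        have h1 := ha i hi
        have h2 := ha i' hi'
        rw [← h] at h2
        have hiT : f i' ∉ T b J := by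
          rw [← hf.T_eq]; intro hh
          have := mem_T.1 hh i' hi'
          simp at this
        have h4 := par_symm hiT h2
        have h5 := add_mem h1 ((T b J).smul_mem (a i) h4)
        rw [← hf.T_eq] at h5
        have := mem_T.1 h5 i hi
        simp [Ne.symm hne] at this
    rw [Finset.card_compl, Fintype.card_fin] at this
    omega
  set q := f i with hq
  have hqT : q ∉ T b J := by
    rw [← hf.T_eq]; intro hh
    have := mem_T.1 hh i hi
    rw [hq] at this; simp at this
  have hex : ∀ i ∈ J, ∀ y ∈ C.S, ∀ y' ∈ C.S, y - q ∈ T b J → ∀ l ∈ J, l ≠ i → ∀ α β : ℚ,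
      (α = 1 ∨ α = -1) →
      (β = 1 ∨ β = -1) → y' - y = α • b i + β • b l → False := by
    intro i hi y hy y' hy' hyq l hl hli α β hα hβ h
    refine hA.Q hM (hsq i hi) hl hli hy hy' ?_ hα hβ h
    intro a hh
    apply hnp i hi a
    have := sub_mem hh hyq
    convert this using 1; abel
  have hup : ∀ j ∈ J, C.Wide b J j q → ∃ u ∈ C.S, u + b j ∈ C.S ∧ u - q ∈ T b J := fun j hj hw =>
    hM.unit_pair hj hqT hw (hex j hj)
  have hfi : ∀ {w z : V} {j : Fin (r + 1)}, j ∈ J → w ∈ C.S → w + b j ∈ C.S → w - q ∈ T b J →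
      z ∈ C.S → z - q ∈ T b J → (∃ k : ℤ, b.repr (z - w) j1 = k) → z = w ∨ z = w + b j := by
    intro w z j hj hw hw1 hwq hz hzq hk
    obtain ⟨k, hk⟩ := hk
    refine hM.fib_int hj hw (notT_sub hqT hwq) hw1 hz (by convert sub_mem hzq hwq using 1; abel)
      (hM.dint hw hz hj1 hk) ?_
    intro i hi y hy y' hy' hyw
    exact hex i hi y hy y' hy' (by convert add_mem hyw hwq using 1; abel)
  have hneq : ∀ {w u : V} {j l : Fin (r + 1)}, j ≠ l → (u = w ∨ u = w + b j) →
      (u + b l = w ∨ u + b l = w + b j) → False := by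
    intro w u j l hjl h h'
    have key : ∀ a : ℚ, b l ≠ a • b j := by
      intro a h
      have := congrArg (fun x => b.repr x l) h
      simp [hjl] at this
    rcases h with rfl | rfl <;> rcases h' with h' | h'
    · exact key 0 (by simpa using h')
    · exact key 1 (by simpa using h')
    · apply key (-1)
      rw [add_assoc] at h'
      have : b j + b l = 0 := by simpa using h'
      rw [neg_one_smul]; exact eq_neg_of_add_eq_zero_right this
    · exact key 0 (by simpa using h')
  obtain ⟨w, hw, hw1, hwq⟩ := hup j1 hj1 (hW i hi)
  have hwT := notT_sub hqT hwq
  by_cases hall : ∀ z ∈ C.S, z - q ∈ T b J → ∃ k : ℤ, b.repr (z - w) j1 = k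
  · refine hM.lemV' hA hSq hw hwT hj1 hw1 ?_
    intro z hz hzw
    have hzq : z - q ∈ T b J := by convert add_mem hzw hwq using 1; abel
    exact hfi hj1 hw hw1 hwq hz hzq (hall z hz hzq)
  exfalso
  push Not at hall
  obtain ⟨z, hz, hzq, hznot⟩ := hall
  have hpart : ∀ j ∈ J, ∃ u ∈ C.S, u + b j ∈ C.S ∧ u - q ∈ T b J := by
    intro j hj
    obtain ⟨g, hg, hgW⟩ := hF j hj
    rcases hM.1.F1 hg hgW hw hwT with h | h
    · exact hup j hj (h.shift hwq)
    · exfalso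
      have h0 := h z hz (by convert sub_mem hzq hwq using 1; abel)
      obtain ⟨k, hk⟩ := hM.dint hw hz hj (k := 0) (by rw [h0]; simp) j1 hj1
      exact hznot k hk
  have hhalf : ∀ j ∈ J, j1 ≠ j → ∀ u ∈ C.S, u + b j ∈ C.S → u - q ∈ T b J →
      ∃ k : ℤ, b.repr (u - w) j1 = k + 1 / 2 := by
    intro j hj hjj u hu hu1 huq
    rcases hM.diff hw hu with h | h
    · exfalso
      obtain ⟨k, hk⟩ := h j1 hj1
      refine hneq hjj (hfi hj1 hw hw1 hwq hu huq ⟨k, hk⟩) (hfi hj1 hw hw1 hwq hu1 ?_ ⟨k, ?_⟩)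
      · convert add_mem huq (B_mem_T b hj) using 1; abel
      · rw [← hk]
        have : u + b j - w = u - w + b j := by abel
        rw [this]; simp [Ne.symm hjj]
    · exact h j1 hj1
  obtain ⟨u, hu, hu1, huq⟩ := hpart j2 hj2
  obtain ⟨u', hu', hu1', huq'⟩ := hpart j3 hj3
  obtain ⟨k, hk⟩ := hhalf j2 hj2 h12 u hu hu1 huq
  obtain ⟨k', hk'⟩ := hhalf j3 hj3 h13 u' hu' hu1' huq'
  have e1 : u' - u = (u' - w) - (u - w) := by abel
  have e2 : b.repr (u' - u) j1 = ((k' - k : ℤ) : ℚ) := by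
    rw [e1, map_sub, Finsupp.sub_apply, hk, hk']; push_cast; ring
  refine hneq h23 (hfi hj2 hu hu1 huq hu' huq' ⟨_, e2⟩) (hfi hj2 hu hu1 huq hu1' ?_ ⟨k' - k, ?_⟩)
  · convert add_mem huq' (B_mem_T b hj3) using 1; abel
  · have : u' + b j3 - u = u' - u + b j3 := by abel
    rw [this, map_add, Finsupp.add_apply, e2]; simp [Ne.symm h13]

theorem Cfg.Min.bad2 (hM : C.Min b J) (hA : C.AllH b J) (h2 : J.card = 2)
    (hr : 125 ≤ r)
    (hSq : ∀ j ∈ J, ∃ l x, C.Sq b J j l x)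
    (hF : ∀ j ∈ J, ∃ f, C.JFr b J f ∧ ∀ i, i ∉ J → C.Wide b J j (f i)) :
    ∃ C' : Cfg r (Fin r → ℚ), C.X.card ≤ C'.X.card + 1 + r := by
  classical
  obtain ⟨j1, j2, h12, rfl⟩ := Finset.card_eq_two.1 h2
  set J : Finset (Fin (r + 1)) := {j1, j2} with hJ
  have hj1 : j1 ∈ J := by simp [hJ]
  have hj2 : j2 ∈ J := by simp [hJ]
  have hJm : ∀ l ∈ J, l = j1 ∨ l = j2 := by intro l hl; simpa [hJ] using hl
  obtain ⟨f, hf, hW⟩ := hF j1 hj1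
  obtain ⟨f2, hf2, hW2⟩ := hF j2 hj2
  have hfT : ∀ {f : Basis (Fin (r + 1)) ℚ V}, C.JFr b J f → ∀ i, i ∉ J → f i ∉ T b J := by
    intro f hf i hi hh
    rw [← hf.T_eq] at hh
    have := mem_T.1 hh i hi
    simp at this
  by_cases hall : ∀ i, i ∉ J → C.Wide b J j2 (f i)
  swap
  · push Not at hall
    obtain ⟨i, hi, hnw⟩ := hall
    have hq0 := (hM.1.F1 hf2 hW2 (hf.1 i) (hfT hf i hi)).resolve_left hnw
    set q := f i with hq
    have hqT := hfT hf i hi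
    obtain ⟨w, hw, hw1, hwq⟩ := hM.unit_pair hj1 hqT (hW i hi) (by
      intro z hz z' hz' hzq l hl hl1 α β hα hβ h
      have hl2 := (hJm l hl).resolve_left hl1
      subst hl2
      have a1 := hq0 z hz hzq
      have hz'q : z' - q ∈ T b J := by
        have : z' - q = (z' - z) + (z - q) := by abel
        rw [this, h]
        exact add_mem (add_mem ((T b J).smul_mem _ (B_mem_T b hj1))
          ((T b J).smul_mem _ (B_mem_T b hj2))) hzq
      have a2 := hq0 z' hz' hz'q
      have e1 : z' - z = (z' - q) - (z - q) := by abel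
      have := congrArg (fun x => b.repr x l) h
      simp only [e1, map_sub, Finsupp.sub_apply] at this
      simp only [map_sub, Finsupp.sub_apply] at a1 a2
      rw [a1, a2] at this
      simp [h12] at this
      rcases hβ with rfl | rfl <;> norm_num at this)
    refine hM.lemV' hA hSq hw (notT_sub hqT hwq) hj1 hw1 ?_
    intro z hz hzw
    have hzq : z - q ∈ T b J := by convert add_mem hzw hwq using 1; abel
    have a1 := hq0 z hz hzq
    have a2 := hq0 w hw hwq
    have hz2 : b.repr (z - w) j2 = 0 := by
      have : z - w = (z - q) - (w - q) := by abel
      rw [this, map_sub, Finsupp.sub_apply, a1, a2, sub_zero]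
    have hsum := sum_T_single hzw hj1 (by
      intro l hl hl1
      rw [(hJm l hl).resolve_left hl1]; exact hz2)
    have hint := hM.dint hw hz hj2 (k := 0) (by rw [hz2]; simp)
    obtain ⟨k, hk⟩ := hint j1 hj1
    rcases int01 hk (hM.1.dabs hw hz (notT_sub hqT hwq) hzw j1) with h | h | h
    · left
      rw [h, zero_smul] at hsum
      exact sub_eq_zero.1 hsum
    · right
      rw [h, one_smul] at hsum
      rw [← hsum]; abel
    · exfalso
      rw [h] at hsum
      have e1 : z - (w + b j1) = (-2 : ℚ) • b j1 := by
        have : z - (w + b j1) = (z - w) - b j1 := by abel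
        rw [this, hsum]; module
      have := hM.1.dabs hw1 hz (by
        intro hh; exact (notT_sub hqT hwq) (by simpa using sub_mem hh (B_mem_T b hj1)))
        (by rw [e1]; exact (T b J).smul_mem _ (B_mem_T b hj1)) j1
      rw [e1] at this
      norm_num at this
  -- all wide in both directions
  obtain ⟨l, x, hx⟩ := hSq j1 hj1
  have hl := (hJm l hx.1.2.1).resolve_left hx.1.2.2
  subst hl
  obtain ⟨-, hxT, hxS, hx1, hx2, hx12⟩ := id hx
  have hxW1 : C.Wide b J j1 x := Cfg.wide_of hxS (B_mem_T b hj1) hx1 (by simp)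
  have hxW2 : C.Wide b J l x := Cfg.wide_of hxS (B_mem_T b hj2) hx2 (by simp)
  obtain ⟨i0, hi0, s, hs, hxs⟩ := hM.1.wide_single hf hW hxT hxW1
  have hx0 : f.repr x i0 ≠ 0 := by
    have := mem_T.1 (hf.T_eq ▸ hxs) i0 hi0
    simp at this
    rw [sub_eq_zero.1 this]
    rcases hs with rfl | rfl <;> norm_num
  obtain ⟨g, hg, hgx, hgo⟩ := hf.pivot hxS hi0 hx0
  have hgW1 : ∀ i, i ∉ J → C.Wide b J j1 (g i) := by
    intro i hi
    by_cases h : i = i0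
    · rw [h, hgx]; exact hxW1
    · rw [hgo i h]; exact hW i hi
  have hgW2 : ∀ i, i ∉ J → C.Wide b J l (g i) := by
    intro i hi
    by_cases h : i = i0
    · rw [h, hgx]; exact hxW2
    · rw [hgo i h]; exact hall i hi
  have claim : ∀ z ∈ C.S, ∀ i, i ∉ J → i ≠ i0 → g.repr z i0 ≠ 0 → g.repr z i ≠ 0 → False := by
    intro z hz i hi hne ha ha'
    set q := g i with hq
    have hqT := hfT hg i hi
    have hqx : ∀ y : V, y - q ∈ T b J → ∀ a : ℚ, y - a • x ∉ T b J := by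
      intro y hy a hh
      have := sub_mem hh hy
      rw [← hg.T_eq] at this
      have := mem_T.1 this i hi
      rw [hq, ← hgx] at this
      simp [Ne.symm hne] at this
    obtain ⟨u, hu, hu1, huq⟩ := hM.unit_pair hj1 hqT (hgW1 i hi) (by
      intro y hy y' hy' hyq m hm hm1 α β hα hβ h
      have hm2 := (hJm m hm).resolve_left hm1
      subst hm2
      exact hM.1.L3 hx hy hy' (hqx y hyq) hα hβ h)
    obtain ⟨s, hs, hs1, hsq⟩ := hM.unit_pair hj2 hqT (hgW2 i hi) (by
      intro y hy y' hy' hyq m hm hm1 α β hα hβ h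
      have hm2 := (hJm m hm).resolve_right hm1
      subst hm2
      exact hM.1.L3 hx hy hy' (hqx y hyq) hβ hα (by rw [h, add_comm]))
    have hTu : ∀ a c : ℚ, a • b j1 + c • b l ∈ T b J := fun a c =>
      add_mem ((T b J).smul_mem _ (B_mem_T b hj1)) ((T b J).smul_mem _ (B_mem_T b hj2))
    have hnint : ∀ k : ℤ, b.repr (s - u) l ≠ k := by
      intro k hk
      have hint := hM.dint hu hs hj2 hk
      obtain ⟨k1, hk1⟩ := hint j1 hj1
      have hsuT : s - u ∈ T b J := by convert sub_mem hsq huq using 1; abel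
      have hex : ∃ p, p ∈ C.S ∧ (p = u ∨ p = u + b j1) ∧ b.repr (s - u) j1 - b.repr (p - u) j1 ≠ 0
          ∧ (∃ k : ℤ, b.repr (p - u) j1 = k) ∧ b.repr (p - u) l = 0 := by
        by_cases h : b.repr (s - u) j1 = 0
        · exact ⟨u + b j1, hu1, Or.inr rfl, by rw [h]; simp, ⟨1, by simp⟩, by simp [h12]⟩
        · exact ⟨u, hu, Or.inl rfl, by simpa using h, ⟨0, by simp⟩, by simp⟩
      have hex' : ∃ p, p ∈ C.S ∧ (p = s ∨ p = s + b l) ∧ b.repr (s - u) l + b.repr (p - s) l ≠ 0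
          ∧ (∃ k : ℤ, b.repr (p - s) l = k) ∧ b.repr (p - s) j1 = 0 := by
        by_cases h : b.repr (s - u) l = 0
        · exact ⟨s + b l, hs1, Or.inr rfl, by rw [h]; simp, ⟨1, by simp⟩, by simp [h12.symm]⟩
        · exact ⟨s, hs, Or.inl rfl, by simpa using h, ⟨0, by simp⟩, by simp⟩
      obtain ⟨p, hp, hpc, hp0, ⟨kp, hkp⟩, hpl⟩ := hex
      obtain ⟨p', hp', hpc', hp0', ⟨kp', hkp'⟩, hpl'⟩ := hex'
      have hpu : p - u ∈ T b J := by
        rcases hpc with rfl | rfl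
        · simp
        · simpa using B_mem_T b hj1
      have hps : p' - s ∈ T b J := by
        rcases hpc' with rfl | rfl
        · simp
        · simpa using B_mem_T b hj2
      have ed : p' - p = (s - u) + (p' - s) - (p - u) := by abel
      have hdT : p' - p ∈ T b J := by rw [ed]; exact sub_mem (add_mem hsuT hps) hpu
      have hpq : p - q ∈ T b J := by convert add_mem hpu huq using 1; abel
      have d1 : b.repr (p' - p) j1 = b.repr (s - u) j1 - b.repr (p - u) j1 := by
        rw [ed, map_sub, map_add, Finsupp.sub_apply, Finsupp.add_apply, hpl', add_zero]
      have d2 : b.repr (p' - p) l = b.repr (s - u) l + b.repr (p' - s) l := by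
        rw [ed, map_sub, map_add, Finsupp.sub_apply, Finsupp.add_apply, hpl, sub_zero]
      have b1 := (int01 (q := b.repr (p' - p) j1) (k := k1 - kp) (by
        rw [d1, hk1, hkp]; push_cast; ring) (hM.1.dabs hp hp' (notT_sub hqT hpq) hdT j1)).resolve_left
        (by rw [d1]; exact hp0)
      have b2 := (int01 (q := b.repr (p' - p) l) (k := k + kp') (by
        rw [d2, hk, hkp']; push_cast; ring) (hM.1.dabs hp hp' (notT_sub hqT hpq) hdT l)).resolve_left
        (by rw [d2]; exact hp0')
      refine hM.1.L3 hx hp hp' (hqx p hpq) b1 b2 ?_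
      conv_lhs => rw [sum_T hdT]
      rw [hJ, Finset.sum_pair h12]
    set a := g.repr z i0 with hadef
    set a' := g.repr z i with hadef'
    have haa : (a = 1 ∨ a = -1) ∧ (a' = 1 ∨ a' = -1) :=
      ⟨((hg.odd hM.1).outer hz hi0).resolve_left ha, ((hg.odd hM.1).outer hz hi).resolve_left ha'⟩
    -- forcing
    have force : ∀ j ∈ J, ∀ y : V, y ∈ C.S → y + b j ∈ C.S → y - q ∈ T b J → x + b j ∈ C.S →
        g.repr z j - a' * b.repr (y - q) j = (a + a') / 2 := by
      intro j hj y hy hy1 hyq hxj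
      have hyq1 : y + b j - q ∈ T b J := by convert add_mem hyq (B_mem_T b hj) using 1; abel
      have ey : y + b j - q = y - q + b j := by abel
      have hxx : x - g i0 ∈ T b J := by rw [hgx]; simp
      have hxx1 : x + b j - g i0 ∈ T b J := by rw [hgx]; simpa using B_mem_T b hj
      have main : ∀ p ∈ C.S, ∀ p' ∈ C.S, p - g i0 ∈ T b J → p' - q ∈ T b J →
          |g.repr z j - a * b.repr (p - g i0) j - a' * b.repr (p' - q) j| ≤ 1 := by
        intro p hp p' hp' hpT hpT'
        obtain ⟨g', hg', h⟩ := hM.1.shift2 hg hi0 hi hne hp hp' hpT hpT' z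
        rw [← h]
        exact (hg'.odd hM.1).abs_le hz j
      have m1 := main x hxS y hy hxx hyq
      have m2 := main (x + b j) hxj y hy hxx1 hyq
      have m3 := main x hxS (y + b j) hy1 hxx hyq1
      have m4 := main (x + b j) hxj (y + b j) hy1 hxx1 hyq1
      rw [ey] at m3 m4
      rw [hgx, _root_.abs_le] at m1 m2 m3 m4
      simp only [add_sub_cancel_left, sub_self, map_zero, Finsupp.coe_zero, Pi.zero_apply, map_add,
        Finsupp.add_apply, Basis.repr_self, Finsupp.single_eq_same, mul_zero, sub_zero, mul_one]
        at m1 m2 m3 m4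
      generalize b.repr (y - q) j = c at *
      obtain ⟨hA1, hA2⟩ := haa
      rcases hA1 with h | h <;> rcases hA2 with h' | h' <;> simp only [h, h'] at m1 m2 m3 m4 ⊢ <;>
        linarith [m1.1, m1.2, m2.1, m2.2, m3.1, m3.2, m4.1, m4.2]
    have f1 := force j1 hj1 u hu hu1 huq hx1
    have f2 := force l hj2 s hs hs1 hsq hx2
    obtain ⟨g', hg', h⟩ := hM.1.shift2 hg hi0 hi hne hxS hu (by rw [hgx]; simp) huq z
    have hk0 : ∃ k0 : ℤ, (a + a') / 2 = k0 := by
      obtain ⟨hA1, hA2⟩ := haa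
      rcases hA1 with h | h <;> rcases hA2 with h' | h' <;> rw [h, h']
      · exact ⟨1, by norm_num⟩
      · exact ⟨0, by norm_num⟩
      · exact ⟨0, by norm_num⟩
      · exact ⟨-1, by norm_num⟩
    obtain ⟨k0, hk0⟩ := hk0
    have hg1 : ∀ j, g'.repr z j = g.repr z j - a' * b.repr (u - q) j := by
      intro j; rw [h j, hgx]; rw [sub_self, map_zero, Finsupp.coe_zero, Pi.zero_apply, mul_zero, sub_zero, ← hadef', ← hq]
    have hint : ∃ k : ℤ, g'.repr z l = k := by
      rcases (hM.jfr hg').half hz with hh | hh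
      · exact hh l hj2
      · obtain ⟨k, hk⟩ := (hh j1 hj1).eq
        rw [hg1, f1] at hk
        exact (not_int_half hk0 hk).elim
    obtain ⟨k2, hk2⟩ := hint
    rw [hg1] at hk2
    have e : b.repr (s - u) l = b.repr (s - q) l - b.repr (u - q) l := by
      have : s - u = (s - q) - (u - q) := by abel
      rw [this, map_sub, Finsupp.sub_apply]
    rcases haa.2 with h' | h' <;> rw [h'] at f2 hk2 hk0
    · apply hnint (k2 - k0)
      rw [e]; push_cast; rw [← hk2, ← hk0, h'] at *; linarith
    · apply hnint (k0 - k2)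
      rw [e]; push_cast; rw [← hk2, ← hk0, h'] at *; linarith
  obtain ⟨C', Y, Z, hcard, hY, hZ, -, hY0, hYp, hZY, hZ0, hZl, -⟩ :=
    C.contract2 g hg.1 i0 ∅ (by simp) (by simp) (by simp)
  refine ⟨C', hcard.trans (Nat.add_le_add_left ?_ _)⟩
  have hc := C.card_supp g hg.1 (insert i0 J) Z hZ (by
    intro z hz i hi
    simp only [Finset.mem_insert, not_or] at hi
    by_contra hzi
    obtain ⟨y, hy, a, c, ha, hc, hzy⟩ := hZl z hz
    have hz0 : g.repr z i0 = 0 := by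
      by_contra h; exact claim z (Cfg.S_of_X (hZ hz)) i hi.2 hi.1 h hzi
    have hyi : g.repr y i ≠ 0 := by
      intro h; apply hzi; rw [hzy]; simp [h, Ne.symm hi.1]
    have hy0 : g.repr y i0 = 0 := by
      by_contra h; exact claim y (Cfg.S_of_X (hY hy)) i hi.2 hi.1 h hyi
    rw [hzy] at hz0
    simp [hy0] at hz0
    exact hc hz0)
  rw [Finset.card_insert_of_notMem hi0, h2] at hc
  norm_num at hc
  omega

theorem Cfg.stepT (hM : C.Min b J) (h4 : J.card ≤ 4) (hr : 125 ≤ r) :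
    (∃ C' : Cfg r (Fin r → ℚ), (∃ B' J', C'.Odd B' J' ∧ J'.card + 1 ≤ J.card) ∧
      C.X.card ≤ C'.X.card + r + 2) ∨ ∃ C' : Cfg r (Fin r → ℚ), C.X.card ≤ C'.X.card + 1 + r := by
  by_cases hex : (∃ C' : Cfg r (Fin r → ℚ), (∃ B' J', C'.Odd B' J' ∧ J'.card + 1 ≤ J.card) ∧
      C.X.card ≤ C'.X.card + r + 2)
  · exact Or.inl hex
  right
  have hbad := fun j (hj : j ∈ J) => (hM.cj h4 hj).resolve_left hex
  obtain ⟨j, hj⟩ : J.Nonempty := by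
    rw [← Finset.card_pos]; have := hM.2.2; omega
  obtain ⟨hc, hA, -⟩ := hbad j hj
  rcases hc with hc | hc
  · exact hM.bad2 hA hc hr (fun j hj => (hbad j hj).2.2.1) (fun j hj => (hbad j hj).2.2.2)
  · exact hM.bad4 hA (by omega) (by omega) (fun j hj => (hbad j hj).2.2.1)
      (fun j hj => (hbad j hj).2.2.2)

end

end TM
end

section
namespace TM
open Module

def Bd (r E : ℕ) : Prop := ∀ (V : Type) [AddCommGroup V] [Module ℚ V] (C : Cfg r V),
  2 * C.X.card + 2 ≤ r ^ 2 + 3 * r + 2 * E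

theorem Bd.mono {r E E' : ℕ} (h : Bd r E) (hE : E ≤ E') : Bd r E' := by
  intro V _ _ C
  have := h V C
  omega

theorem bdt : ∀ (t : ℕ), t ≤ 4 → ∀ (r E : ℕ), 126 + t ≤ r →
    (∀ r', r' < r → r ≤ r' + t → Bd r' (E + 1)) →
    ∀ (V : Type) [AddCommGroup V] [Module ℚ V] (C : Cfg r V),
    (∃ B J, C.Odd B J ∧ J.card ≤ t) → 2 * C.X.card + 2 ≤ r ^ 2 + 3 * r + 2 * E := by
  intro t
  induction t with
  | zero =>
    rintro - r E hr - V _ _ C ⟨B, J, h, hJ⟩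
    have := Cfg.t1 r (by omega) V C B J h (by omega)
    omega
  | succ t ih =>
    rintro ht r E hr hB V _ _ C hex
    obtain ⟨r, rfl⟩ : ∃ k, r = k + 1 := ⟨r - 1, by omega⟩
    classical
    have hP : ∃ n, ∃ B J, C.Odd B J ∧ J.card = n := by
      obtain ⟨B, J, h, -⟩ := hex
      exact ⟨_, B, J, h, rfl⟩
    obtain ⟨B, J, h, hJ⟩ := Nat.find_spec hP
    have hmin : ∀ (B' : Basis (Fin (r + 1)) ℚ V) (J' : Finset (Fin (r + 1))),
        C.Odd B' J' → J.card ≤ J'.card := by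
      intro B' J' h'
      rw [hJ]
      exact Nat.find_min' hP ⟨B', J', h', rfl⟩
    have hJt : J.card ≤ t + 1 := by
      obtain ⟨B', J', h', h2⟩ := hex
      exact (hmin B' J' h').trans h2
    by_cases h1 : J.card ≤ 1
    · have := Cfg.t1 (r + 1) (by omega) V C B J h h1
      omega
    · have hM : C.Min B J := ⟨h, hmin, by omega⟩
      rcases Cfg.stepT hM (by omega) (by omega) with ⟨C', ⟨B', J', h', hc⟩, hX⟩ | ⟨C', hX⟩
      · have := ih (by omega) r E (by omega) (fun r' h1 h2 => hB r' (by omega) (by omega)) _ C'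
          ⟨B', J', h', by omega⟩
        nlinarith
      · have := hB r (by omega) (by omega) _ C'
        nlinarith

theorem bd_step (r E : ℕ) (hr : 130 ≤ r) (hB : ∀ r', r' < r → r ≤ r' + 4 → Bd r' (E + 1)) :
    Bd r E := by
  intro V _ _ C
  by_cases hex : ∃ B J, C.Odd B J ∧ J.card ≤ 4
  · exact bdt 4 le_rfl r E hr hB V C hex
  · obtain ⟨r, rfl⟩ : ∃ k, r = k + 1 := ⟨r - 1, by omega⟩
    obtain ⟨C', hX⟩ := C.stepS (fun B J h => by
      by_contra hc; exact hex ⟨B, J, h, by omega⟩)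
    have := hB r (by omega) (by omega) _ C'
    nlinarith

theorem bd_triv (r : ℕ) : Bd r (5 ^ r + 1) := by
  intro V _ _ C
  obtain ⟨B, hB⟩ := C.exists_basis
  have := C.card_supp B hB Finset.univ C.X (by simp) (by simp)
  simp at this
  nlinarith

theorem bd_base : ∃ E N, ∀ r, N ≤ r → Bd r E := by
  obtain ⟨E, hE⟩ : ∃ E, ∀ r, r < 130 → 5 ^ r + 1 ≤ E :=
    ⟨(Finset.range 130).sup (fun r => 5 ^ r + 1), fun r hr =>
      Finset.le_sup (f := fun r => 5 ^ r + 1) (Finset.mem_range.2 hr)⟩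
  refine ⟨E, 0, fun r _ => ?_⟩
  induction r using Nat.strong_induction_on with
  | _ r ih =>
    by_cases hr : r < 130
    · exact (bd_triv r).mono (hE r hr)
    · exact bd_step r E (by omega) fun r' h _ => (ih r' h (by omega)).mono (by omega)

theorem bd_main : ∃ N, ∀ r, N ≤ r → Bd r 0 := by
  obtain ⟨E, N, h⟩ := bd_base
  induction E generalizing N with
  | zero => exact ⟨N, h⟩
  | succ E ih =>
    exact ih (N + 130) fun r hr => bd_step r E (by omega) fun r' h1 h2 => h r' (by omega)

theorem exists_indep {ι W : Type} [Finite ι] [AddCommGroup W] [Module ℚ W] (v : ι → W) (r : ℕ)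
    (h : finrank ℚ (Submodule.span ℚ (Set.range v)) = r) :
    ∃ g : Fin r → ι, LinearIndependent ℚ (v ∘ g) ∧
      Submodule.span ℚ (Set.range (v ∘ g)) = Submodule.span ℚ (Set.range v) := by
  obtain ⟨κ, a, ha, hs, hi⟩ := exists_linearIndependent' ℚ v
  have : Finite κ := Finite.of_injective a ha
  have := Fintype.ofFinite κ
  have hc := finrank_span_eq_card hi
  rw [hs, h] at hc
  let e : Fin r ≃ κ := (Fintype.equivFinOfCardEq hc.symm).symm
  refine ⟨a ∘ e, ?_, ?_⟩
  · exact hi.comp e e.injective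
  · rw [← hs, ← Function.comp_assoc, Set.range_comp (v ∘ a) e, e.range_eq_univ, Set.image_univ]

end TM
end

namespace TM
open Module

theorem mk_cfg (r m n : ℕ) (A : Matrix (Fin m) (Fin n) ℤ)
    (hr : (A.map ((↑) : ℤ → ℚ)).rank = r) (h2 : IsTwoModular A r)
    (hz : ∀ i : Fin m, rowQ A i ≠ 0)
    (hi : ∀ i i' : Fin m, i ≠ i' → LinearIndependent ℚ ![rowQ A i, rowQ A i']) :
    ∃ C : Cfg r (Fin r → ℚ), C.X.card = m := by
  classical
  set Q := A.map ((↑) : ℤ → ℚ) with hQ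
  obtain ⟨g, hgi, hgs⟩ := exists_indep Q.col r (by rw [← Matrix.rank_eq_finrank_span_cols, hr])
  let M : Matrix (Fin m) (Fin r) ℚ := Q.submatrix id g
  have hMc : M.col = Q.col ∘ g := rfl
  have hMr : M.rank = r := by
    rw [Matrix.rank_eq_finrank_span_cols, hMc, hgs, ← Matrix.rank_eq_finrank_span_cols, hr]
  obtain ⟨f, hfi, -⟩ := exists_indep M.row r (by rw [← Matrix.rank_eq_finrank_span_row, hMr])
  have key : ∀ i i' : Fin m, ∀ a : ℚ, M.row i = a • M.row i' → rowQ A i = a • rowQ A i' := by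
    intro i i' a h
    ext k
    have hk : Q.col k ∈ Submodule.span ℚ (Set.range (Q.col ∘ g)) := by
      rw [hgs]; exact Submodule.subset_span ⟨k, rfl⟩
    obtain ⟨c, hc⟩ := (Submodule.mem_span_range_iff_exists_fun ℚ).1 hk
    have h1 : ∀ i, rowQ A i k = ∑ j, c j * M.row i j := by
      intro i
      have := congrFun hc i
      simp only [Finset.sum_apply, Pi.smul_apply, smul_eq_mul] at this
      exact this.symm
    rw [Pi.smul_apply, h1, h1, h, smul_eq_mul, Finset.mul_sum]
    refine Finset.sum_congr rfl fun j _ => ?_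
    simp only [Pi.smul_apply, smul_eq_mul]
    ring
  have par : ∀ i i' : Fin m, ∀ a : ℚ, M.row i = a • M.row i' → i = i' := by
    intro i i' a h
    by_contra hne
    have h1 := key i i' a h
    have h3 := (LinearIndependent.pair_iff.1 (hi i i' hne)) 1 (-a) (by rw [h1]; module)
    exact one_ne_zero h3.1
  have inj : Function.Injective M.row := fun i i' h => par i i' 1 (by rw [h, one_smul])
  refine ⟨⟨Matrix.detRowAlternating, Finset.univ.image M.row, ⟨Pi.basisFun ℚ (Fin r)⟩,
    ?_, ?_, ?_, ?_⟩, ?_⟩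
  · intro x hx
    obtain ⟨i, -, rfl⟩ := Finset.mem_image.1 hx
    intro h
    apply hz i
    have := key i i 0 (by rw [h, smul_zero])
    rw [this, zero_smul]
  · intro x hx y hy a h
    obtain ⟨i, -, rfl⟩ := Finset.mem_image.1 hx
    obtain ⟨i', -, rfl⟩ := Finset.mem_image.1 hy
    rw [par i' i a h]
  · intro v hv
    have : ∀ k, ∃ i, M.row i = v k := by
      intro k
      obtain ⟨i, -, h⟩ := Finset.mem_image.1 (hv k)
      exact ⟨i, h⟩
    choose s hs using this
    refine ⟨(A.submatrix s g).det, ?_, h2 s g⟩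
    have hv : v = (A.submatrix s g).map (Int.castRingHom ℚ) := by
      funext k; rw [← hs k]; rfl
    rw [hv]
    exact (RingHom.map_det (Int.castRingHom ℚ) (A.submatrix s g)).symm
  · refine ⟨M.row ∘ f, fun i => Finset.mem_image_of_mem _ (Finset.mem_univ _), ?_⟩
    have h := (Matrix.linearIndependent_rows_iff_isUnit (A := (M.submatrix f id))).1 hfi
    exact ((Matrix.isUnit_iff_isUnit_det _).1 h).ne_zero
  · rw [Finset.card_image_of_injective _ inj, Finset.card_univ, Fintype.card_fin]

end TM

/-- There is an `r₀` such that for all `r ≥ r₀`, a rank-`r` `2`-modular integer matrix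
with nonzero, pairwise non-parallel rows has at most `(r+2 choose 2) - 2` rows. -/
theorem statement0 :
    ∃ r₀ : ℕ, ∀ r : ℕ, r₀ ≤ r →
      ∀ (m n : ℕ) (A : Matrix (Fin m) (Fin n) ℤ),
        (A.map ((↑) : ℤ → ℚ)).rank = r →
        IsTwoModular A r →
        (∀ i : Fin m, rowQ A i ≠ 0) →
        (∀ i i' : Fin m, i ≠ i' → LinearIndependent ℚ ![rowQ A i, rowQ A i']) →
        m ≤ Nat.choose (r + 2) 2 - 2 := by
  obtain ⟨N, hN⟩ := TM.bd_main
  refine ⟨N, fun r hr m n A h1 h2 h3 h4 => ?_⟩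
  obtain ⟨C, hC⟩ := TM.mk_cfg r m n A h1 h2 h3 h4
  have hb := hN r hr _ C
  rw [hC] at hb
  rw [Nat.choose_two_right]
  have h6 : (r + 2) * (r + 2 - 1) = r ^ 2 + 3 * r + 2 := by
    rw [show r + 2 - 1 = r + 1 from rfl]; ring
  rw [h6]
  omega
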